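/- Let F ∈ ℤ[x₁,…,xₙ] be an incomplete norm form of degree d > n ≥ 2 with non-zero discriminant, k ≥ (d−2)/n with k ≥ 2, ξ₁, ξ₂ = Bⁿ(log B)^{2/3}, ξ₃ = C₁B²(log B)^{−2k/3}, C(ξ₁) = ∏_{p≤ξ₁}p^{k−1}, and 𝒟 = 𝒟(u₂) as usual. For u₁ | C(ξ₁) and u₂ ≤ ξ₃ square-free with prime divisors in (ξ₁, ξ₂], let H_{u₁,u₂}(B) be the number of (m₁,…,mₙ) ∈ ℤⁿ ∩ [−B,B]ⁿ satisfying F(m) ≡ 0 (mod u₁), F(m) ≡ 0 (mod u₂), and F(m) ≡ u₁u₂sᵏ (mod 𝒟) for some 0 ≤ s < 𝒟, such that m (mod p) ∉ 𝒮_p for every prime p | u₁u₂. Then N₃(B) ≤ Σ_{u₁ | C(ξ₁), u₂ ≤ ξ₃} H_{u₁,u₂}(B)/k^{ω(𝒟)} + N₃*(B). -/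

import Mathlib

open MvPolynomial Filter Pointwise

noncomputable section

/-- The linear form with coefficient vector `c`. -/
def linForm {R : Type*} [CommRing R] {n : ℕ} (c : Fin n → R) : MvPolynomial (Fin n) R :=
  ∑ i, C (c i) * X i

/-- `ρ_F(m)`: the number of zeros of `F` in `(ℤ/mℤ)ⁿ`. -/
def rhoF {n : ℕ} (F : MvPolynomial (Fin n) ℤ) (m : ℕ) : ℕ :=
  Nat.card {a : Fin n → ZMod m // MvPolynomial.eval a (F.map (Int.castRingHom (ZMod m))) = 0}

/-- The discriminant `Δ(F) = ∏_{i₁<⋯<iₙ} |det(L_{i₁},…,L_{iₙ})|`, the product being over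
all `n`-element subsets of the linear factors (parametrized by strictly monotone maps). -/
def discProd {n d : ℕ} (L : Fin d → Fin n → ℂ) : ℝ :=
  ∏ᶠ g ∈ {g : Fin n → Fin d | StrictMono g},
    ‖(Matrix.det (Matrix.of fun i j => L (g i) j) : ℂ)‖

/-- `F` is a decomposable form with linear factors `L₁,…,L_d` having
algebraic-integer coefficients. -/
def IsDecomp {n d : ℕ} (F : MvPolynomial (Fin n) ℤ) (L : Fin d → Fin n → ℂ) : Prop :=
  (∀ j i, IsIntegral ℤ (L j i)) ∧ F.map (Int.castRingHom ℂ) = ∏ j, linForm (L j)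

/-- An integer is `k`-free if it is divisible by no `k`-th power of a prime. -/
def KFree (k : ℕ) (N : ℤ) : Prop := ∀ p : ℕ, p.Prime → ¬ ((p : ℤ) ^ k ∣ N)

/-- `N_{F,k}(B)`. -/
def NFk {n : ℕ} (F : MvPolynomial (Fin n) ℤ) (k : ℕ) (B : ℝ) : ℕ :=
  Set.ncard {x : Fin n → ℤ | (∀ i, |(x i : ℝ)| ≤ B) ∧ KFree k (MvPolynomial.eval x F)}

def log1 (x : ℝ) : ℝ := max 1 (Real.log x)
def log2 (x : ℝ) : ℝ := log1 (log1 x)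
def log3 (x : ℝ) : ℝ := log1 (log2 x)

/-- `ξ₁` is eventually increasing, tends to infinity and is `O(log₂ B / log₃ B)`. -/
def Xi1Good (ξ₁ : ℝ → ℝ) : Prop :=
  (∃ B₀ : ℝ, ∀ ⦃B B' : ℝ⦄, B₀ ≤ B → B ≤ B' → ξ₁ B ≤ ξ₁ B') ∧
  Tendsto ξ₁ atTop atTop ∧ (ξ₁ =O[atTop] fun B => log2 B / log3 B)

def xi2 (n : ℕ) (B : ℝ) : ℝ := B ^ n * Real.log B ^ ((2 : ℝ) / 3)

def xi3 (C₁ : ℝ) (k : ℕ) (B : ℝ) : ℝ := C₁ * B ^ 2 * Real.log B ^ (-(2 * (k : ℝ)) / 3)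

/-- `C(ξ₁) = ∏_{p ≤ ξ₁} p^{k-1}`. -/
def Cxi (k : ℕ) (ξ : ℝ) : ℕ := ∏ᶠ p ∈ {p : ℕ | p.Prime ∧ (p : ℝ) ≤ ξ}, p ^ (k - 1)

/-- `𝒟(u₂) = ∏ p` over primes `ξ₁ < p ≤ (1/12)log(B²/u₂)`, `p ∤ u₂`, `p ≡ 1 (mod k)`. -/
def scrD (k : ℕ) (ξ₁ B : ℝ) (u₂ : ℕ) : ℕ :=
  ∏ᶠ p ∈ {p : ℕ | p.Prime ∧ ξ₁ < (p : ℝ) ∧ (p : ℝ) ≤ Real.log (B ^ 2 / (u₂ : ℝ)) / 12 ∧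
      ¬ p ∣ u₂ ∧ p % k = 1}, p

/-- The set `𝒮_p ⊆ 𝔽_pⁿ` attached to a factorization `F = F*·∏𝓛ᵢ` over `ℤ_p`. -/
def Sp {n : ℕ} (p : ℕ) (hp : p.Prime) {τ : ℕ}
    (𝓛 : Fin τ → Fin n → @PadicInt p ⟨hp⟩)
    (Fstar : MvPolynomial (Fin n) (@PadicInt p ⟨hp⟩)) (x : Fin n → ZMod p) : Prop :=
  (∃ i j : Fin τ, i < j ∧ (∑ m, (@PadicInt.toZMod p ⟨hp⟩) (𝓛 i m) * x m) = 0 ∧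
      (∑ m, (@PadicInt.toZMod p ⟨hp⟩) (𝓛 j m) * x m) = 0) ∨
  MvPolynomial.eval x (Fstar.map (@PadicInt.toZMod p ⟨hp⟩)) = 0

/-- The data `(𝓛ᵢ, F*)` is a factorization of `F` over `ℤ_p` with `F*` having no
linear factor over `ℚ_p`. -/
def IsPadicFact {n : ℕ} (F : MvPolynomial (Fin n) ℤ) (p : ℕ) (hp : p.Prime) {τ : ℕ}
    (𝓛 : Fin τ → Fin n → @PadicInt p ⟨hp⟩)
    (Fstar : MvPolynomial (Fin n) (@PadicInt p ⟨hp⟩)) : Prop :=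
  F.map (Int.castRingHom (@PadicInt p ⟨hp⟩)) = Fstar * ∏ i, linForm (𝓛 i) ∧
  ∀ c : Fin n → @Padic p ⟨hp⟩, (∃ i, c i ≠ 0) →
    ¬ (linForm c ∣ Fstar.map (@PadicInt.Coe.ringHom p ⟨hp⟩))


-- τ_F(p) intrinsically: number of linear factors of F mod p up to scaling
def tauFp {n : ℕ} (F : MvPolynomial (Fin n) ℤ) (p : ℕ) : ℕ :=
  Nat.card {c : Fin n → ZMod p //
    (∃ i, c i = 1 ∧ ∀ j, j < i → c j = 0) ∧
    linForm c ∣ F.map (Int.castRingHom (ZMod p))}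

def tauF {n : ℕ} (F : MvPolynomial (Fin n) ℤ) (m : ℕ) : ℕ :=
  ∏ p ∈ m.primeFactors, tauFp F p

def sigmaPow (α : ℝ) (m : ℕ) : ℝ := ∑ s ∈ m.divisors, (s : ℝ) ^ α

-- sup norm / lattice minimum / lattice point count
def supNorm {n : ℕ} (x : Fin n → ℤ) : ℕ := Finset.univ.sup fun i => (x i).natAbs

def latMin {n : ℕ} (Λ : AddSubgroup (Fin n → ℤ)) : ℕ :=
  sInf {m : ℕ | ∃ x ∈ Λ, x ≠ 0 ∧ supNorm x = m}

def NLat {n : ℕ} (Λ : AddSubgroup (Fin n → ℤ)) (B : ℝ) : ℕ :=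
  Set.ncard {x : Fin n → ℤ | x ∈ Λ ∧ ∀ i, |(x i : ℝ)| ≤ B}

-- the H_{u₁,u₂}(B) count
def Hcount {n : ℕ} (F : MvPolynomial (Fin n) ℤ)
    {τ : ∀ p : ℕ, p.Prime → ℕ}
    (𝓛 : ∀ (p : ℕ) (hp : p.Prime), Fin (τ p hp) → Fin n → @PadicInt p ⟨hp⟩)
    (Fstar : ∀ (p : ℕ) (hp : p.Prime), MvPolynomial (Fin n) (@PadicInt p ⟨hp⟩))
    (k u₁ u₂ D : ℕ) (B : ℝ) : ℕ :=
  Set.ncard {m : Fin n → ℤ | (∀ i, |(m i : ℝ)| ≤ B) ∧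
    (u₁ : ℤ) ∣ MvPolynomial.eval m F ∧ (u₂ : ℤ) ∣ MvPolynomial.eval m F ∧
    (∃ s : ℕ, s < D ∧ (D : ℤ) ∣ (MvPolynomial.eval m F - (u₁ : ℤ) * u₂ * (s : ℤ) ^ k)) ∧
    ∀ (p : ℕ) (hp : p.Prime), p ∣ u₁ * u₂ →
      ¬ Sp p hp (𝓛 p hp) (Fstar p hp) (fun i => ((m i : ZMod p)))}

-- N₃(B)
def N3count {n : ℕ} (F : MvPolynomial (Fin n) ℤ) (k : ℕ) (ξ₁ ξ₂ B : ℝ) : ℕ :=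
  Set.ncard {x : Fin n → ℤ | (∀ i, |(x i : ℝ)| ≤ B) ∧
    (∃ p : ℕ, p.Prime ∧ ξ₂ < (p : ℝ) ∧ (p : ℤ) ^ k ∣ MvPolynomial.eval x F) ∧
    (∀ p : ℕ, p.Prime → ξ₁ < (p : ℝ) → (p : ℝ) ≤ ξ₂ → ¬ ((p : ℤ) ^ 2 ∣ MvPolynomial.eval x F)) ∧
    (∀ p : ℕ, p.Prime → (p : ℤ) ^ k ∣ MvPolynomial.eval x F → ξ₁ < (p : ℝ))}

-- N₃*(B)
def N3starCount {n : ℕ}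
    {τ : ∀ p : ℕ, p.Prime → ℕ}
    (𝓛 : ∀ (p : ℕ) (hp : p.Prime), Fin (τ p hp) → Fin n → @PadicInt p ⟨hp⟩)
    (Fstar : ∀ (p : ℕ) (hp : p.Prime), MvPolynomial (Fin n) (@PadicInt p ⟨hp⟩))
    (ξ₁ B : ℝ) : ℕ :=
  Set.ncard {x : Fin n → ℤ | (∀ i, |(x i : ℝ)| ≤ B) ∧
    ∃ (p : ℕ) (hp : p.Prime), ξ₁ < (p : ℝ) ∧
      Sp p hp (𝓛 p hp) (Fstar p hp) (fun i => ((x i : ZMod p)))}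

-- N₃†(B)
def N3dag {n : ℕ} (F : MvPolynomial (Fin n) ℤ)
    {τ : ∀ p : ℕ, p.Prime → ℕ}
    (𝓛 : ∀ (p : ℕ) (hp : p.Prime), Fin (τ p hp) → Fin n → @PadicInt p ⟨hp⟩)
    (Fstar : ∀ (p : ℕ) (hp : p.Prime), MvPolynomial (Fin n) (@PadicInt p ⟨hp⟩))
    (k : ℕ) (ξ₁ ξ₂ B : ℝ) : ℕ :=
  Set.ncard {x : Fin n → ℤ | (∀ i, |(x i : ℝ)| ≤ B) ∧
    ∃ (u : ℤ) (q : ℕ), q.Prime ∧ ξ₂ < (q : ℝ) ∧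
      MvPolynomial.eval x F = u * (q : ℤ) ^ k ∧
      (∀ p : ℕ, p.Prime → (p : ℝ) ≤ ξ₁ → ¬ ((p : ℤ) ^ k ∣ u)) ∧
      (∀ p : ℕ, p.Prime → ξ₁ < (p : ℝ) → (p : ℝ) ≤ ξ₂ → ¬ ((p : ℤ) ^ 2 ∣ u)) ∧
      (∀ (p : ℕ) (hp : p.Prime), (p : ℤ) ∣ u →
        ¬ Sp p hp (𝓛 p hp) (Fstar p hp) (fun i => ((x i : ZMod p))))}

-- ℛ_l : congruence classes mod l = u₁u₂D
def Rset {n : ℕ} (F : MvPolynomial (Fin n) ℤ)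
    {τ : ∀ p : ℕ, p.Prime → ℕ}
    (𝓛 : ∀ (p : ℕ) (hp : p.Prime), Fin (τ p hp) → Fin n → @PadicInt p ⟨hp⟩)
    (Fstar : ∀ (p : ℕ) (hp : p.Prime), MvPolynomial (Fin n) (@PadicInt p ⟨hp⟩))
    (k u₁ u₂ D : ℕ) : Set (Fin n → ZMod (u₁ * u₂ * D)) :=
  {m | ∃ a : Fin n → ℤ, (∀ i, ((a i : ZMod (u₁ * u₂ * D))) = m i) ∧
    (u₁ : ℤ) ∣ MvPolynomial.eval a F ∧ (u₂ : ℤ) ∣ MvPolynomial.eval a F ∧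
    (∃ s : ℕ, s < D ∧ (D : ℤ) ∣ (MvPolynomial.eval a F - (u₁ : ℤ) * u₂ * (s : ℤ) ^ k)) ∧
    ∀ (p : ℕ) (hp : p.Prime), p ∣ u₁ * u₂ →
      ¬ Sp p hp (𝓛 p hp) (Fstar p hp) (fun i => ((a i : ZMod p)))}

-- exponential sum E_ℛ(t; l)
def Esum {n l : ℕ} (R : Set (Fin n → ZMod l)) (t : Fin n → ℤ) : ℂ :=
  ∑ᶠ a ∈ R, Complex.exp (-(2 * Real.pi * Complex.I) *
    (∑ i, ((a i).val : ℂ) * (t i : ℂ)) / (l : ℂ))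

def Mplus {n : ℕ} (l : ℕ) (R : Set (Fin n → ZMod l)) (B : ℝ) : ℝ :=
  (3 * B) ^ n * R.ncard / (l : ℝ) ^ n

def Mpp {n : ℕ} (l : ℕ) (R : Set (Fin n → ZMod l)) (B : ℝ) : ℝ :=
  B ^ n / (l : ℝ) ^ n *
    ∑ᶠ t ∈ {t : Fin n → ℤ | t ≠ 0 ∧ ∀ i, |(t i : ℝ)| ≤ (l : ℝ) / B},
      ‖(Esum R t : ℂ)‖

-- S(t; p)
def Ssum {n : ℕ} (p : ℕ) (hp : p.Prime) {τ : ℕ}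
    (𝓛 : Fin τ → Fin n → @PadicInt p ⟨hp⟩) (t : Fin n → ℤ) : ℂ :=
  ∑ i : Fin τ,
    ∑ᶠ a ∈ {a : Fin n → ZMod p | (∑ m, (@PadicInt.toZMod p ⟨hp⟩) (𝓛 i m) * a m) = 0},
      Complex.exp ((2 * Real.pi * Complex.I) *
        (∑ m, ((a m).val : ℂ) * (t m : ℂ)) / (p : ℂ))

-- |S(t; l)| for squarefree l
def SabsSF {n : ℕ} {τ : ∀ p : ℕ, p.Prime → ℕ}
    (𝓛 : ∀ (p : ℕ) (hp : p.Prime), Fin (τ p hp) → Fin n → @PadicInt p ⟨hp⟩)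
    (l : ℕ) (t : Fin n → ℤ) : ℝ :=
  ∏ p ∈ l.primeFactors.attach,
    ‖(Ssum p.1 (Nat.prime_of_mem_primeFactors p.2)
      (𝓛 p.1 (Nat.prime_of_mem_primeFactors p.2)) t : ℂ)‖

-- admissible u₂'s
def U2set (ξ₁ ξ₂ ξ₃ : ℝ) : Set ℕ :=
  {u | 0 < u ∧ (u : ℝ) ≤ ξ₃ ∧ Squarefree u ∧
    ∀ p ∈ u.primeFactors, ξ₁ < (p : ℝ) ∧ (p : ℝ) ≤ ξ₂}


-- extra defs for theorems

/-- `N₄(B)` from Lemma N4B. -/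
def N4sum {n : ℕ} (F : MvPolynomial (Fin n) ℤ)
    {τ : ∀ p : ℕ, p.Prime → ℕ}
    (𝓛 : ∀ (p : ℕ) (hp : p.Prime), Fin (τ p hp) → Fin n → @PadicInt p ⟨hp⟩)
    (Fstar : ∀ (p : ℕ) (hp : p.Prime), MvPolynomial (Fin n) (@PadicInt p ⟨hp⟩))
    (k : ℕ) (C₁ : ℝ) (ξ₁ : ℝ → ℝ) (B : ℝ) : ℝ :=
  ∑ᶠ u₁ ∈ {u₁ : ℕ | u₁ ∣ Cxi k (ξ₁ B)},
    ∑ᶠ u₂ ∈ U2set (ξ₁ B) (xi2 n B) (xi3 C₁ k B),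
      Mplus (u₁ * u₂ * scrD k (ξ₁ B) B u₂)
        (Rset F 𝓛 Fstar k u₁ u₂ (scrD k (ξ₁ B) B u₂)) B /
        (k : ℝ) ^ (scrD k (ξ₁ B) B u₂).primeFactors.card

/-- the inner truncated sum `Σ'_{|tᵢ|≤Y} |S(t;u₂)|`. -/
def Ssumbox {n : ℕ} {τ : ∀ p : ℕ, p.Prime → ℕ}
    (𝓛 : ∀ (p : ℕ) (hp : p.Prime), Fin (τ p hp) → Fin n → @PadicInt p ⟨hp⟩)
    (u₂ : ℕ) (Y : ℝ) : ℝ :=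
  ∑ᶠ t ∈ {t : Fin n → ℤ | t ≠ 0 ∧ ∀ i, |(t i : ℝ)| ≤ Y}, SabsSF 𝓛 u₂ t

/-- `Q` restricted to a set of `u₂`'s. -/
def QUgen {n : ℕ} {τ : ∀ p : ℕ, p.Prime → ℕ}
    (𝓛 : ∀ (p : ℕ) (hp : p.Prime), Fin (τ p hp) → Fin n → @PadicInt p ⟨hp⟩)
    (S : Set ℕ) (B : ℝ) : ℝ :=
  ∑ᶠ u₂ ∈ S, (1 / (u₂ : ℝ) ^ n) *
    Ssumbox 𝓛 u₂ ((u₂ : ℝ) ^ ((9 : ℝ) / 10) / B ^ ((4 : ℝ) / 5))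

/-- `l* = ∏_{p ≤ Ξ, p | u₂} p`. -/
def lstar (u₂ : ℕ) (Ξ : ℝ) : ℕ :=
  ∏ᶠ p ∈ {p : ℕ | p.Prime ∧ p ∣ u₂ ∧ (p : ℝ) ≤ Ξ}, p

/-! ### Stepanov's method -/

/-- The operator sending `a` to `f ^ (r - e) * (f ^ e * a)^{(r)}`. -/
def twistedDeriv {K : Type*} [CommRing K] (f : Polynomial K) (e : ℕ) :
    ℕ → Polynomial K →ₗ[K] Polynomial K
  | 0 => LinearMap.id
  | r + 1 => (LinearMap.mulLeft K (((e - r : ℕ) : Polynomial K) * Polynomial.derivative f) +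
      LinearMap.mulLeft K f ∘ₗ Polynomial.derivative) ∘ₗ twistedDeriv f e r

theorem iterate_derivative_mul_twistedDeriv {K : Type*} [CommRing K] (f a w : Polynomial K)
    (hw : Polynomial.derivative w = 0) (e r : ℕ) (hr : r ≤ e) :
    Polynomial.derivative^[r] (f ^ e * a * w) = f ^ (e - r) * twistedDeriv f e r a * w := by
  induction r with
  | zero => simp [twistedDeriv]
  | succ r ih =>
    rw [Function.iterate_succ_apply', ih (by omega)]
    obtain ⟨m, rfl⟩ : ∃ m, e = r + 1 + m := ⟨e - (r + 1), by omega⟩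
    have h1 : r + 1 + m - r = m + 1 := by omega
    have h2 : r + 1 + m - (r + 1) = m := by omega
    simp only [Polynomial.derivative_mul, Polynomial.derivative_pow, hw, twistedDeriv, h1, h2,
      LinearMap.comp_apply, LinearMap.add_apply, LinearMap.mulLeft_apply, Nat.add_sub_cancel]
    simp only [map_natCast]
    ring

theorem natDegree_twistedDeriv_le {K : Type*} [CommRing K] (f a : Polynomial K) {d D : ℕ}
    (hf : f.natDegree ≤ d) (ha : a.natDegree ≤ D) (e r : ℕ) :
    (twistedDeriv f e r a).natDegree ≤ D + r * d := by
  induction r with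
  | zero => simpa [twistedDeriv]
  | succ r ih =>
    have hsplit : D + (r + 1) * d = d + (D + r * d) := by ring
    simp only [twistedDeriv, LinearMap.comp_apply, LinearMap.add_apply, LinearMap.mulLeft_apply]
    rw [hsplit]
    refine (Polynomial.natDegree_add_le _ _).trans (max_le ?_ ?_)
    · refine Polynomial.natDegree_mul_le.trans (add_le_add ?_ ih)
      refine Polynomial.natDegree_mul_le.trans ?_
      rw [Polynomial.natDegree_natCast, zero_add]
      exact (Polynomial.natDegree_derivative_le f).trans ((Nat.sub_le _ _).trans hf)
    · refine Polynomial.natDegree_mul_le.trans (add_le_add hf ?_)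
      exact (Polynomial.natDegree_derivative_le _).trans ((Nat.sub_le _ _).trans ih)

/-- If a combination `∑ (a j + f ^ N * b j) X ^ (p j)` vanishes, with `a`, `b` of small degree,
then all coefficients vanish. -/
theorem stepanov_nonvanishing {p d ℓ A J : ℕ} [Fact p.Prime] (hℓ : 2 ≤ ℓ) (hdvd : ℓ ∣ p - 1)
    (f : Polynomial (ZMod p)) (hfd : f.natDegree ≤ d) (hA : d + ℓ * A ≤ p)
    {κ : Type*} [Field κ] [Algebra (ZMod p) κ] (s : κ)
    (hs : (f.map (algebraMap (ZMod p) κ)).rootMultiplicity s = 1) (hf0 : f.coeff 0 ≠ 0)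
    (a b : Fin J → Polynomial (ZMod p)) (ha : ∀ j, (a j).natDegree < A)
    (hb : ∀ j, (b j).natDegree < A)
    (h : ∑ j, (a j + f ^ ((p - 1) / ℓ) * b j) * Polynomial.X ^ (p * (j : ℕ)) = 0) :
    ∀ j, a j = 0 ∧ b j = 0 := by
  classical
  have hp : p.Prime := Fact.out
  intro j
  induction j using WellFoundedLT.induction with
  | _ j ih =>
  have hX : (Polynomial.X : Polynomial (ZMod p)) ^ p ∣ a j + f ^ ((p - 1) / ℓ) * b j := by
    rw [← Finset.add_sum_erase _ _ (Finset.mem_univ j)] at h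
    have h2 : (Polynomial.X : Polynomial (ZMod p)) ^ (p * (j : ℕ)) * Polynomial.X ^ p ∣
        ∑ i ∈ Finset.univ.erase j,
          (a i + f ^ ((p - 1) / ℓ) * b i) * Polynomial.X ^ (p * (i : ℕ)) := by
      refine Finset.dvd_sum fun i hi => ?_
      rcases lt_or_gt_of_ne (Finset.ne_of_mem_erase hi) with hij | hij
      · simp [(ih i hij).1, (ih i hij).2]
      · refine Dvd.dvd.mul_left ?_ _
        rw [← pow_add]
        refine pow_dvd_pow _ ?_
        have : (j : ℕ) + 1 ≤ i := hij
        nlinarith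
    have h3 : (Polynomial.X : Polynomial (ZMod p)) ^ (p * (j : ℕ)) * Polynomial.X ^ p ∣
        Polynomial.X ^ (p * (j : ℕ)) * (a j + f ^ ((p - 1) / ℓ) * b j) := by
      rw [mul_comm _ (a j + _), eq_neg_of_add_eq_zero_left h]
      exact (dvd_neg).2 h2
    exact (mul_dvd_mul_iff_left (pow_ne_zero _ Polynomial.X_ne_zero)).1 h3
  have hexp : (Polynomial.X : Polynomial (ZMod p)) ^ p ∣ f ^ p - Polynomial.C (f.coeff 0) := by
    have h1 : f ^ p = Polynomial.expand (ZMod p) p f := by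
      rw [ZMod.expand_card]
    rw [h1]
    have h2 : (Polynomial.X : Polynomial (ZMod p)) ∣ f - Polynomial.C (f.coeff 0) := by
      rw [Polynomial.X_dvd_iff]; simp
    have h3 := map_dvd (Polynomial.expand (ZMod p) p) h2
    simpa using h3
  have hmain : (Polynomial.X : Polynomial (ZMod p)) ^ p ∣
      f * a j ^ ℓ - Polynomial.C ((-1) ^ ℓ * f.coeff 0) * b j ^ ℓ := by
    have h1 : a j + f ^ ((p - 1) / ℓ) * b j ∣ a j ^ ℓ - (-(f ^ ((p - 1) / ℓ) * b j)) ^ ℓ := by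
      have := sub_dvd_pow_sub_pow (a j) (-(f ^ ((p - 1) / ℓ) * b j)) ℓ
      rwa [sub_neg_eq_add] at this
    have h2 : f * (-(f ^ ((p - 1) / ℓ) * b j)) ^ ℓ = (-1) ^ ℓ * b j ^ ℓ * f ^ p := by
      rw [neg_pow, mul_pow, ← pow_mul, Nat.div_mul_cancel hdvd]
      have : f ^ p = f * f ^ (p - 1) := by rw [← pow_succ', Nat.sub_add_cancel hp.one_le]
      rw [this]; ring
    have h3 : f * a j ^ ℓ - Polynomial.C ((-1) ^ ℓ * f.coeff 0) * b j ^ ℓ =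
        f * (a j ^ ℓ - (-(f ^ ((p - 1) / ℓ) * b j)) ^ ℓ) +
          (-1) ^ ℓ * b j ^ ℓ * (f ^ p - Polynomial.C (f.coeff 0)) := by
      rw [mul_sub, h2]; simp only [map_mul, map_pow, map_neg, map_one]; ring
    rw [h3]
    exact dvd_add (((hX.trans h1)).mul_left _) (hexp.mul_left _)
  have hsmall : ∀ q : Polynomial (ZMod p), q.natDegree < A → (q ^ ℓ).natDegree + ℓ ≤ ℓ * A := by
    intro q hq
    have := Polynomial.natDegree_pow_le (p := q) (n := ℓ)
    nlinarith
  have heq : f * a j ^ ℓ = Polynomial.C ((-1) ^ ℓ * f.coeff 0) * b j ^ ℓ := by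
    rw [← sub_eq_zero]
    refine Polynomial.eq_zero_of_dvd_of_natDegree_lt hmain ?_
    rw [Polynomial.natDegree_X_pow]
    refine lt_of_le_of_lt (Polynomial.natDegree_sub_le _ _) (max_lt ?_ ?_)
    · have := Polynomial.natDegree_mul_le (p := f) (q := a j ^ ℓ)
      have := hsmall _ (ha j)
      omega
    · have := Polynomial.natDegree_C_mul_le ((-1) ^ ℓ * f.coeff 0) (b j ^ ℓ)
      have := hsmall _ (hb j)
      omega
  have hc0 : (-1) ^ ℓ * f.coeff 0 ≠ 0 := mul_ne_zero (pow_ne_zero _ (by simp)) hf0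
  have hfne : f ≠ 0 := by rintro rfl; simp at hf0
  by_cases ha0 : a j = 0
  · refine ⟨ha0, ?_⟩
    rw [ha0, zero_pow (by omega), mul_zero] at heq
    have := (mul_eq_zero.1 heq.symm).resolve_left (by simpa using hf0)
    exact pow_eq_zero_iff (by omega) |>.1 this
  · exfalso
    have hb0 : b j ≠ 0 := by
      intro hb0
      rw [hb0, zero_pow (by omega), mul_zero] at heq
      rcases mul_eq_zero.1 heq with h | h
      · exact hfne h
      · exact ha0 (pow_eq_zero_iff (by omega) |>.1 h)
    have hinj : Function.Injective (algebraMap (ZMod p) κ) := (algebraMap (ZMod p) κ).injective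
    have hmapne : ∀ q : Polynomial (ZMod p), q ≠ 0 → q.map (algebraMap (ZMod p) κ) ≠ 0 :=
      fun q hq => (Polynomial.map_ne_zero_iff hinj).2 hq
    have h4 := congrArg (fun q => (Polynomial.map (algebraMap (ZMod p) κ) q).rootMultiplicity s) heq
    simp only [Polynomial.map_mul, Polynomial.map_pow, Polynomial.map_C] at h4
    have hC : Polynomial.C (algebraMap (ZMod p) κ ((-1) ^ ℓ * f.coeff 0)) ≠ 0 := by
      simpa using hf0
    rw [Polynomial.rootMultiplicity_mul (mul_ne_zero (hmapne _ hfne)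
        (pow_ne_zero _ (hmapne _ ha0))),
      Polynomial.rootMultiplicity_mul (mul_ne_zero hC (pow_ne_zero _ (hmapne _ hb0))), hs,
      Polynomial.rootMultiplicity_C, zero_add,
      ← Polynomial.count_roots, ← Polynomial.count_roots, Polynomial.roots_pow,
      Polynomial.roots_pow, Multiset.count_nsmul, Multiset.count_nsmul] at h4
    have h5 : ℓ ∣ 1 := (Nat.dvd_add_left (Dvd.intro _ rfl)).1 (h4 ▸ Dvd.intro _ rfl)
    have := Nat.le_of_dvd one_pos h5
    omega

theorem exists_stepanov_coeffs {p d N A J M : ℕ} [Fact p.Prime] (f : Polynomial (ZMod p))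
    (hfd : f.natDegree ≤ d) (hA0 : 0 < A) (c : ZMod p)
    (hcount : M * (A + M * d + J) < 2 * (J * A)) :
    ∃ a b : Fin J → Polynomial (ZMod p), (∀ j, (a j).natDegree < A) ∧
      (∀ j, (b j).natDegree < A) ∧ (¬ ∀ j, a j = 0 ∧ b j = 0) ∧
      ∀ r < M, ∑ j, (twistedDeriv f M r (a j) + c • twistedDeriv f (M + N) r (b j)) *
        Polynomial.X ^ (j : ℕ) = 0 := by
  let Q := A + M * d + J
  let V := (Fin J → Polynomial.degreeLT (ZMod p) A) × (Fin J → Polynomial.degreeLT (ZMod p) A)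
  let W : Fin M → V →ₗ[ZMod p] Polynomial (ZMod p) := fun r =>
    ∑ j : Fin J, LinearMap.mulRight (ZMod p) (Polynomial.X ^ (j : ℕ)) ∘ₗ
      (twistedDeriv f M r ∘ₗ (Polynomial.degreeLT (ZMod p) A).subtype ∘ₗ LinearMap.proj j ∘ₗ
          LinearMap.fst _ _ _ +
        c • (twistedDeriv f (M + N) r ∘ₗ (Polynomial.degreeLT (ZMod p) A).subtype ∘ₗ
          LinearMap.proj j ∘ₗ LinearMap.snd _ _ _))
  have hWapp : ∀ r v, W r v = ∑ j : Fin J, (twistedDeriv f M r (v.1 j : Polynomial (ZMod p)) +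
      c • twistedDeriv f (M + N) r (v.2 j : Polynomial (ZMod p))) * Polynomial.X ^ (j : ℕ) := by
    intro r v
    simp only [W, LinearMap.sum_apply]
    rfl
  have hdeg : ∀ q ∈ Polynomial.degreeLT (ZMod p) A, q.natDegree ≤ A - 1 := by
    intro q hq
    rw [Polynomial.mem_degreeLT] at hq
    by_cases h0 : q = 0
    · simp [h0]
    · have := (Polynomial.natDegree_lt_iff_degree_lt h0).2 hq
      omega
  have hWmem : ∀ r v, W r v ∈ Polynomial.degreeLT (ZMod p) Q := by
    intro r v
    rw [hWapp]
    refine Submodule.sum_mem _ fun j _ => ?_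
    rw [Polynomial.mem_degreeLT]
    have hr : (r : ℕ) * d ≤ M * d := Nat.mul_le_mul_right _ r.2.le
    have hj := j.2
    have h1 := natDegree_twistedDeriv_le f _ hfd (hdeg _ (v.1 j).2) M r
    have h2 := natDegree_twistedDeriv_le f _ hfd (hdeg _ (v.2 j).2) (M + N) r
    refine lt_of_le_of_lt Polynomial.degree_le_natDegree ?_
    rw [Nat.cast_lt]
    refine lt_of_le_of_lt Polynomial.natDegree_mul_le ?_
    rw [Polynomial.natDegree_X_pow]
    have h3 : (twistedDeriv f M r (v.1 j : Polynomial (ZMod p)) +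
        c • twistedDeriv f (M + N) r (v.2 j : Polynomial (ZMod p))).natDegree ≤ A - 1 + r * d :=
      (Polynomial.natDegree_add_le _ _).trans
        (max_le h1 ((Polynomial.natDegree_smul_le _ _).trans h2))
    omega
  let Φ : V →ₗ[ZMod p] (Fin M → Polynomial.degreeLT (ZMod p) Q) :=
    LinearMap.pi fun r => (W r).codRestrict _ (hWmem r)
  have hfin : ∀ q, Module.finrank (ZMod p) (Polynomial.degreeLT (ZMod p) q) = q := by
    intro q
    rw [LinearEquiv.finrank_eq (Polynomial.degreeLTEquiv (ZMod p) q)]; simp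
  have hfd' : ∀ q, Module.Finite (ZMod p) (Polynomial.degreeLT (ZMod p) q) := by
    intro q
    exact Module.Finite.equiv (Polynomial.degreeLTEquiv (ZMod p) q).symm
  have := hfd' A
  have := hfd' Q
  have hker : LinearMap.ker Φ ≠ ⊥ := by
    apply LinearMap.ker_ne_bot_of_finrank_lt
    rw [Module.finrank_prod, Module.finrank_pi_fintype, Module.finrank_pi_fintype]
    simp only [hfin, Finset.sum_const, Finset.card_univ, Fintype.card_fin, smul_eq_mul]
    have : M * Q < 2 * (J * A) := hcount
    omega
  obtain ⟨v, hv, hv0⟩ := Submodule.exists_mem_ne_zero_of_ne_bot hker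
  refine ⟨fun j => v.1 j, fun j => v.2 j, fun j => ?_, fun j => ?_, fun h => hv0 ?_,
    fun r hr => ?_⟩
  · have := hdeg _ (v.1 j).2
    change (v.1 j : Polynomial (ZMod p)).natDegree < A
    omega
  · have := hdeg _ (v.2 j).2
    change (v.2 j : Polynomial (ZMod p)).natDegree < A
    omega
  · ext j : 2
    · exact Subtype.ext (h j).1
    · exact Subtype.ext (h j).2
  · rw [LinearMap.mem_ker] at hv
    have h1 := congrArg Subtype.val (congrFun hv ⟨r, hr⟩)
    have h2 : W ⟨r, hr⟩ v = 0 := h1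
    rw [hWapp] at h2
    exact h2

theorem card_mul_le_natDegree_of_rootMultiplicity {K : Type*} [Field K] (h : Polynomial K)
    (S : Finset K) (M : ℕ) (hS : ∀ t ∈ S, M ≤ h.rootMultiplicity t) :
    S.card * M ≤ h.natDegree := by
  classical
  refine le_trans ?_ (Polynomial.card_roots' h)
  have : M • S.val ≤ h.roots := by
    rw [Multiset.le_iff_count]
    intro t
    rw [Multiset.count_nsmul, Polynomial.count_roots]
    by_cases ht : t ∈ S
    · rw [Multiset.count_eq_one_of_mem S.nodup ht]; simpa using hS t ht
    · rw [Multiset.count_eq_zero_of_notMem ht]; simp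
  have := Multiset.card_le_card this
  rw [Multiset.card_nsmul] at this
  simpa [mul_comm] using this

theorem stepanov_card_le_of_coeff_zero {p d ℓ : ℕ} [Fact p.Prime] (hℓ : 2 ≤ ℓ)
    (hdvd : ℓ ∣ p - 1) (hpd : 9 * ℓ * (d + 2) ^ 3 ≤ p)
    (f : Polynomial (ZMod p)) (hfd : f.natDegree ≤ d)
    {κ : Type*} [Field κ] [Algebra (ZMod p) κ] (s : κ)
    (hs : (f.map (algebraMap (ZMod p) κ)).rootMultiplicity s = 1) (hf0 : f.coeff 0 ≠ 0)
    (c : ZMod p) :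
    4 * (Finset.univ.filter fun t : ZMod p => f.eval t ^ ((p - 1) / ℓ) = c).card ≤ 3 * p := by
  have hp : p.Prime := Fact.out
  set N := (p - 1) / ℓ with hN
  have hNl : N * ℓ = p - 1 := Nat.div_mul_cancel hdvd
  have hN0 : N ≠ 0 := by
    rintro h
    rw [h] at hNl
    have := hp.two_le
    omega
  set A := (p - d) / ℓ with hAdef
  set M := 4 * (d + 2) with hM
  set J := 2 * (d + 2) + 1 with hJ
  have hcube : (d + 2) ^ 3 = d ^ 3 + 6 * d ^ 2 + 12 * d + 8 := by ring
  have hlc : 2 * (d + 2) ^ 3 ≤ ℓ * (d + 2) ^ 3 := Nat.mul_le_mul_right _ hℓ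
  have hdp : 18 * (d + 2) ^ 3 ≤ p := by nlinarith
  have hd3 : d ≤ d ^ 3 := Nat.le_self_pow (by norm_num) d
  have hdlp : d ≤ p := by
    omega
  have hA1 : d + ℓ * A ≤ p := by
    have := Nat.mul_div_le (p - d) ℓ
    rw [← hAdef] at this
    omega
  have hA2 : 8 * (d + 2) ^ 3 + 1 ≤ A := by
    rw [hAdef, Nat.le_div_iff_mul_le (by omega)]
    have h1 : (8 * (d + 2) ^ 3 + 1) * ℓ + ℓ * ((d + 2) ^ 3 - 1) ≤ p := by
      obtain ⟨e, he⟩ : ∃ e, (d + 2) ^ 3 = e + 1 := ⟨(d + 2) ^ 3 - 1, by omega⟩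
      rw [he] at hpd ⊢
      rw [Nat.add_sub_cancel]
      nlinarith
    have h2 : d ≤ ℓ * ((d + 2) ^ 3 - 1) := by
      have : 2 * ((d + 2) ^ 3 - 1) ≤ ℓ * ((d + 2) ^ 3 - 1) := Nat.mul_le_mul_right _ hℓ
      omega
    omega
  have hcount : M * (A + M * d + J) < 2 * (J * A) := by
    rw [hM, hJ]
    nlinarith
  obtain ⟨a, b, ha, hb, hne, hW⟩ :=
    exists_stepanov_coeffs (N := N) f hfd (by omega : 0 < A) c hcount
  set h : Polynomial (ZMod p) :=
    ∑ j, (f ^ M * a j * Polynomial.X ^ (p * (j : ℕ)) +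
      f ^ (M + N) * b j * Polynomial.X ^ (p * (j : ℕ))) with hh
  have hfne : f ≠ 0 := by rintro rfl; simp at hf0
  have hfac : h = f ^ M * ∑ j, (a j + f ^ N * b j) * Polynomial.X ^ (p * (j : ℕ)) := by
    rw [hh, Finset.mul_sum]
    refine Finset.sum_congr rfl fun j _ => ?_
    ring
  have hh0 : h ≠ 0 := by
    rw [hfac]
    refine mul_ne_zero (pow_ne_zero _ hfne) fun h0 => hne ?_
    exact stepanov_nonvanishing hℓ hdvd f hfd hA1 s hs hf0 a b ha hb h0
  have hXd : ∀ j : ℕ, Polynomial.derivative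
      ((Polynomial.X : Polynomial (ZMod p)) ^ (p * j)) = 0 := by
    intro j
    rw [Polynomial.derivative_X_pow]
    simp
  have hmult : ∀ t ∈ Finset.univ.filter (fun t : ZMod p => f.eval t ^ N = c),
      M ≤ h.rootMultiplicity t := by
    intro t ht
    have htc : f.eval t ^ N = c := (Finset.mem_filter.1 ht).2
    suffices M - 1 < h.rootMultiplicity t by omega
    refine Polynomial.lt_rootMultiplicity_of_isRoot_iterate_derivative_of_mem_nonZeroDivisors
      hh0 ?_ ?_
    · intro r hr
      have hrM : r < M := by omega
      have hW' := congrArg (Polynomial.eval t) (hW r hrM)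
      rw [Polynomial.eval_finsetSum, Polynomial.eval_zero] at hW'
      simp only [Polynomial.eval_mul, Polynomial.eval_add, Polynomial.eval_smul,
        Polynomial.eval_pow, Polynomial.eval_X, smul_eq_mul] at hW'
      rw [Polynomial.IsRoot.def, hh, Polynomial.iterate_derivative_sum,
        Polynomial.eval_finsetSum]
      calc _ = ∑ j : Fin J, f.eval t ^ (M - r) *
            (((twistedDeriv f M r (a j)).eval t + c * (twistedDeriv f (M + N) r (b j)).eval t) *
              t ^ (j : ℕ)) := by
            refine Finset.sum_congr rfl fun j _ => ?_
            rw [iterate_map_add,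
              iterate_derivative_mul_twistedDeriv _ _ _ (hXd j) _ _ hrM.le,
              iterate_derivative_mul_twistedDeriv _ _ _ (hXd j) _ _
                (hrM.le.trans (Nat.le_add_right _ _))]
            have h1 : M + N - r = (M - r) + N := Nat.sub_add_comm hrM.le
            simp only [Polynomial.eval_mul, Polynomial.eval_add, Polynomial.eval_pow,
              Polynomial.eval_X, pow_mul, ZMod.pow_card, h1, pow_add, htc]
            ring
        _ = 0 := by rw [← Finset.mul_sum, hW', mul_zero]
    · rw [mem_nonZeroDivisors_iff_ne_zero]
      intro h0
      rw [ZMod.natCast_eq_zero_iff, hp.dvd_factorial] at h0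
      omega
  have hcard := card_mul_le_natDegree_of_rootMultiplicity h _ M hmult
  have hND : 2 * (N * d) ≤ p * d := by
    have : N * 2 ≤ N * ℓ := Nat.mul_le_mul_left _ hℓ
    have : N * 2 ≤ p := by omega
    nlinarith
  have hA3 : 2 * A ≤ p := by
    have : 2 * A ≤ ℓ * A := Nat.mul_le_mul_right _ hℓ
    omega
  have hdegh : h.natDegree ≤ M * d + N * d + A + p * (2 * (d + 2)) := by
    rw [hh]
    refine Polynomial.natDegree_sum_le_of_forall_le _ _ fun j _ => ?_
    have hj : p * (j : ℕ) ≤ p * (2 * (d + 2)) := Nat.mul_le_mul_left _ (by have := j.2; omega)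
    have h1 : ∀ (e : ℕ) (q : Polynomial (ZMod p)), q.natDegree < A →
        (f ^ e * q * Polynomial.X ^ (p * (j : ℕ))).natDegree ≤
          e * d + A + p * (2 * (d + 2)) := by
      intro e q hq
      refine Polynomial.natDegree_mul_le.trans (add_le_add ?_ ?_)
      · refine Polynomial.natDegree_mul_le.trans (add_le_add ?_ hq.le)
        exact Polynomial.natDegree_pow_le.trans (Nat.mul_le_mul_left _ hfd)
      · rw [Polynomial.natDegree_X_pow]; exact hj
    refine (Polynomial.natDegree_add_le _ _).trans (max_le ?_ ?_)
    · have := h1 M _ (ha j)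
      omega
    · have := h1 (M + N) _ (hb j)
      rw [add_mul] at this
      exact this
  have hfinal := hcard.trans hdegh
  set S := (Finset.univ.filter fun t : ZMod p => f.eval t ^ N = c).card
  rw [hM] at hfinal
  by_contra hcon
  push Not at hcon
  have h8d : 8 * d ≤ p := by omega
  nlinarith

/-- **Stepanov's bound** for the values of a polynomial with a simple root in a fixed coset of
`ℓ`-th powers. -/
theorem stepanov_card_le {p d ℓ : ℕ} [Fact p.Prime] (hℓ : 2 ≤ ℓ)
    (hdvd : ℓ ∣ p - 1) (hpd : 9 * ℓ * (d + 2) ^ 3 ≤ p)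
    (f : Polynomial (ZMod p)) (hfd : f.natDegree ≤ d)
    {κ : Type*} [Field κ] [Algebra (ZMod p) κ] (s : κ)
    (hs : (f.map (algebraMap (ZMod p) κ)).rootMultiplicity s = 1)
    (c : ZMod p) :
    4 * (Finset.univ.filter fun t : ZMod p => f.eval t ^ ((p - 1) / ℓ) = c).card ≤ 3 * p := by
  have hp : p.Prime := Fact.out
  have hfne : f ≠ 0 := by
    rintro rfl
    simp at hs
  have hdp : d < p := by
    have h1 : 2 * (d + 2) ^ 3 ≤ ℓ * (d + 2) ^ 3 := Nat.mul_le_mul_right _ hℓ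
    have h2 : d + 2 ≤ (d + 2) ^ 3 := Nat.le_self_pow (by norm_num) _
    nlinarith
  obtain ⟨t₀, ht₀⟩ : ∃ t₀ : ZMod p, f.eval t₀ ≠ 0 := by
    by_contra hcon
    push Not at hcon
    refine hfne (Polynomial.eq_zero_of_natDegree_lt_card_of_eval_eq_zero' f Finset.univ
      (fun t _ => hcon t) ?_)
    rw [Finset.card_univ, ZMod.card]
    omega
  have hcomp : (f.comp (Polynomial.X + Polynomial.C t₀)).natDegree ≤ d := by
    rw [Polynomial.natDegree_comp, Polynomial.natDegree_X_add_C, mul_one]; exact hfd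
  have key := stepanov_card_le_of_coeff_zero hℓ hdvd hpd
    (f.comp (Polynomial.X + Polynomial.C t₀)) hcomp (s - algebraMap (ZMod p) κ t₀) ?_ ?_ c
  · refine le_trans (Nat.mul_le_mul_left 4 (le_of_eq ?_)) key
    refine Finset.card_bij (fun t _ => t - t₀) ?_ ?_ ?_
    · intro t ht
      simpa using ht
    · intro t _ t' _ h
      simpa using h
    · intro t ht
      exact ⟨t + t₀, by simpa using ht, by simp⟩
  · rw [Polynomial.map_comp]
    simp only [Polynomial.map_add, Polynomial.map_X, Polynomial.map_C]
    rw [Polynomial.rootMultiplicity_eq_rootMultiplicity, ← hs,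
      Polynomial.rootMultiplicity_eq_rootMultiplicity (p := Polynomial.map _ f)]
    congr 1
    rw [Polynomial.comp_assoc]
    congr 1
    simp only [Polynomial.add_comp, Polynomial.X_comp, Polynomial.C_comp, map_sub]
    ring
  · rw [Polynomial.coeff_zero_eq_eval_zero]
    simpa using ht₀

/-! ### Primes in the progression `1 mod ℓ` of controlled size -/

theorem exists_prime_orderOf_eq {K β : ℕ} (hK : 2 ≤ K) (hβ : K ∣ β) (hβ0 : β ≠ 0) :
    ∃ p : ℕ, p.Prime ∧ orderOf (β : ZMod p) = K ∧ K ∣ p - 1 ∧ p ≤ β ^ K := by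
  have hKβ : K ≤ β := Nat.le_of_dvd (Nat.pos_of_ne_zero hβ0) hβ
  set Φ := (Polynomial.eval (β : ℤ) (Polynomial.cyclotomic K ℤ)).natAbs with hΦ
  have hgt : 1 < Φ := by
    have := Polynomial.sub_one_lt_natAbs_cyclotomic_eval (n := K) (q := β) (by omega) (by omega)
    omega
  have hprime : Fact (Φ.minFac).Prime := ⟨Nat.minFac_prime hgt.ne'⟩
  set p := Φ.minFac with hp
  have hpd : (p : ℤ) ∣ Polynomial.eval (β : ℤ) (Polynomial.cyclotomic K ℤ) :=
    Int.natCast_dvd.2 (Nat.minFac_dvd _)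
  have hroot : Polynomial.IsRoot (Polynomial.cyclotomic K (ZMod p))
      (Nat.castRingHom (ZMod p) β) := by
    have : ((β : ℤ) : ZMod p) = ↑(Int.castRingHom (ZMod p) β) := by simp
    rw [Polynomial.IsRoot.def, ← Polynomial.map_cyclotomic_int K (ZMod p), Polynomial.eval_map,
      Nat.coe_castRingHom, ← Int.cast_natCast, this, Polynomial.eval₂_hom, Int.coe_castRingHom,
      ZMod.intCast_zmod_eq_zero_iff_dvd]
    exact hpd
  have hpb : ¬p ∣ β :=
    hprime.1.coprime_iff_not_dvd.1
      (Polynomial.coprime_of_root_cyclotomic (by omega) hroot).symm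
  have hdiv : orderOf (β : ZMod p) ∣ p - 1 :=
    ZMod.orderOf_dvd_card_sub_one (mt (CharP.cast_eq_zero_iff _ _ _).1 hpb)
  have : NeZero (K : ZMod p) := NeZero.of_not_dvd (ZMod p) fun hpk => hpb (hpk.trans hβ)
  have hord : K = orderOf (β : ZMod p) :=
    (Polynomial.isRoot_cyclotomic_iff.mp hroot).eq_orderOf
  refine ⟨p, hprime.1, hord.symm, hord ▸ hdiv, ?_⟩
  have h1 : (p : ℤ) ∣ (β : ℤ) ^ K - 1 := by
    refine hpd.trans ?_
    have := Polynomial.eval_dvd (x := (β : ℤ)) (Polynomial.cyclotomic.dvd_X_pow_sub_one K ℤ)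
    simpa using this
  have h2 : 1 < β ^ K := Nat.one_lt_pow (by omega) (by omega)
  have h3 : (0 : ℤ) < (β : ℤ) ^ K - 1 := by
    have : (1 : ℤ) < (β : ℤ) ^ K := by exact_mod_cast h2
    omega
  have h4 := Int.le_of_dvd h3 h1
  have h5 : (p : ℤ) ≤ (β : ℤ) ^ K := by omega
  exact_mod_cast h5

theorem exists_finset_primes_modEq_one {ℓ : ℕ} (hℓ : 2 ≤ ℓ) (N₁ R : ℕ) :
    ∃ E : Finset ℕ, E.card = R ∧ (∀ p ∈ E, p.Prime ∧ ℓ ∣ p - 1 ∧ N₁ < p) ∧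
      ((∏ p ∈ E, p : ℕ) : ℝ) ≤ Real.exp (((ℓ : ℝ) * (N₁ + R)) ^ 4) := by
  set Q := ℓ * (N₁ + R) with hQ
  set β := ℓ * (N₁ + R).factorial with hβ
  have hβ0 : β ≠ 0 := by
    rw [hβ]
    exact mul_ne_zero (by omega) (Nat.factorial_ne_zero _)
  have hm : ∀ i : Fin R, ∃ p : ℕ, p.Prime ∧ orderOf (β : ZMod p) = ℓ * (N₁ + 1 + i) ∧
      ℓ * (N₁ + 1 + i) ∣ p - 1 ∧ p ≤ β ^ (ℓ * (N₁ + 1 + i)) := by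
    intro i
    refine exists_prime_orderOf_eq ?_ ?_ hβ0
    · nlinarith
    · refine mul_dvd_mul_left _ (Nat.dvd_factorial (by omega) ?_)
      have := i.2
      omega
  choose P hP1 hP2 hP3 hP4 using hm
  have hinj : Function.Injective P := by
    intro i j hij
    have h1 := hP2 i
    rw [hij, hP2 j] at h1
    have := Nat.eq_of_mul_eq_mul_left (by omega) h1
    exact Fin.ext (by omega)
  refine ⟨Finset.univ.map ⟨P, hinj⟩, by simp, ?_, ?_⟩
  · intro p hp
    obtain ⟨i, -, rfl⟩ := Finset.mem_map.1 hp
    refine ⟨hP1 i, (Dvd.intro _ rfl).trans (hP3 i), ?_⟩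
    have h1 := Nat.le_of_dvd (Nat.sub_pos_of_lt (hP1 i).one_lt) (hP3 i)
    have h2 : 1 * (N₁ + 1 + i) ≤ ℓ * (N₁ + 1 + i) := Nat.mul_le_mul_right _ (by omega)
    change N₁ < P i
    omega
  · rw [Finset.prod_map]
    rcases Nat.eq_zero_or_pos R with rfl | hR
    · simp only [Finset.univ_eq_empty, Finset.prod_empty, Nat.cast_one]
      exact Real.one_le_exp (by positivity)
    have hQ1 : 1 ≤ Q := by
      rw [hQ]; exact Nat.one_le_iff_ne_zero.2 (mul_ne_zero (by omega) (by omega))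
    have hRQ : R ≤ Q := by rw [hQ]; nlinarith
    have hβQ : β ≤ Q ^ Q := by
      calc β ≤ ℓ * (N₁ + R) ^ (N₁ + R) := Nat.mul_le_mul_left _ (Nat.factorial_le_pow _)
        _ ≤ ℓ ^ (N₁ + R) * (N₁ + R) ^ (N₁ + R) :=
            Nat.mul_le_mul_right _ (Nat.le_self_pow (by omega) _)
        _ = Q ^ (N₁ + R) := by rw [hQ, mul_pow]
        _ ≤ Q ^ Q := Nat.pow_le_pow_right hQ1 (by rw [hQ]; nlinarith)
    have hP : ∀ i, P i ≤ Q ^ (Q * Q) := by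
      intro i
      have hi : ℓ * (N₁ + 1 + i) ≤ Q := by
        rw [hQ]; exact Nat.mul_le_mul_left _ (by have := i.2; omega)
      calc P i ≤ β ^ (ℓ * (N₁ + 1 + i)) := hP4 i
        _ ≤ (Q ^ Q) ^ (ℓ * (N₁ + 1 + i)) := Nat.pow_le_pow_left hβQ _
        _ ≤ (Q ^ Q) ^ Q := Nat.pow_le_pow_right (Nat.pow_pos hQ1) hi
        _ = Q ^ (Q * Q) := (pow_mul _ _ _).symm
    have hprod : ∏ i, P i ≤ Q ^ (Q * Q * Q) := by
      calc ∏ i, P i ≤ ∏ _i : Fin R, Q ^ (Q * Q) := Finset.prod_le_prod' fun i _ => hP i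
        _ = (Q ^ (Q * Q)) ^ R := by simp
        _ ≤ (Q ^ (Q * Q)) ^ Q := Nat.pow_le_pow_right (Nat.pow_pos hQ1) hRQ
        _ = Q ^ (Q * Q * Q) := (pow_mul _ _ _).symm
    have h1 : ((Q : ℕ) : ℝ) ≤ Real.exp Q := by
      have := Real.add_one_le_exp (Q : ℝ)
      linarith
    have h2 : ((Q ^ (Q * Q * Q) : ℕ) : ℝ) ≤ Real.exp ((Q : ℝ) ^ 4) := by
      push_cast
      calc (Q : ℝ) ^ (Q * Q * Q) ≤ Real.exp Q ^ (Q * Q * Q) := by gcongr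
        _ = Real.exp ((Q : ℝ) ^ 4) := by
          rw [← Real.exp_nat_mul]; push_cast; ring_nf
    have h3 : (((Q : ℕ) : ℝ)) = (ℓ : ℝ) * (N₁ + R) := by rw [hQ]; push_cast; ring
    rw [← h3]
    refine le_trans ?_ h2
    exact_mod_cast hprod

/-! ### Counting points of sublattices of `ℤⁿ` in boxes -/

/-- The integer points of the box `[-R, R]ⁿ`. -/
def intBox (n R : ℕ) : Finset (Fin n → ℤ) :=
  Fintype.piFinset fun _ => Finset.Icc (-(R : ℤ)) R

theorem mem_intBox {n R : ℕ} {x : Fin n → ℤ} : x ∈ intBox n R ↔ ∀ i, |x i| ≤ R := by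
  simp [intBox, abs_le]

theorem card_intBox (n R : ℕ) : (intBox n R).card = (2 * R + 1) ^ n := by
  have : ((R : ℤ) + 1 + R).toNat = 2 * R + 1 := by omega
  simp [intBox, this]

theorem supNorm_le_iff {n R : ℕ} {x : Fin n → ℤ} : supNorm x ≤ R ↔ ∀ i, |x i| ≤ R := by
  simp only [supNorm, Finset.sup_le_iff, Finset.mem_univ, true_implies]
  refine forall_congr' fun i => ?_
  rw [Int.abs_eq_natAbs]
  exact_mod_cast Iff.rfl

theorem abs_le_supNorm {n : ℕ} (x : Fin n → ℤ) (i : Fin n) : |x i| ≤ supNorm x :=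
  supNorm_le_iff.1 le_rfl i

theorem exists_abs_eq_supNorm {n : ℕ} (hn : 0 < n) (x : Fin n → ℤ) :
    ∃ i, |x i| = supNorm x := by
  have : Nonempty (Fin n) := ⟨⟨0, hn⟩⟩
  obtain ⟨i, -, hi⟩ := Finset.exists_mem_eq_sup Finset.univ Finset.univ_nonempty
    fun i => (x i).natAbs
  exact ⟨i, by rw [Int.abs_eq_natAbs, supNorm, hi]⟩

theorem supNorm_pos {n : ℕ} {x : Fin n → ℤ} (hx : x ≠ 0) : 0 < supNorm x := by
  rw [Nat.pos_iff_ne_zero]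
  intro h
  refine hx (funext fun i => ?_)
  have := abs_le_supNorm x i
  rw [h] at this
  exact abs_eq_zero.1 (le_antisymm (by simpa using this) (abs_nonneg _))

/-- A subgroup of `ℤⁿ` whose points in a box span has few of them compared to its index. -/
theorem card_mul_index_le_of_span {n R : ℕ} (M : AddSubgroup (Fin n → ℤ))
    (w : Fin n → Fin n → ℤ) (hwM : ∀ i, w i ∈ M) (hwR : ∀ i, w i ∈ intBox n R)
    (hw : LinearIndependent ℚ fun i j => (w i j : ℚ)) (T : Finset (Fin n → ℤ))
    (hT : ∀ x ∈ T, x ∈ M ∧ x ∈ intBox n R) :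
    M.index ≠ 0 ∧ T.card * M.index ≤ (2 * ((n + 1) * R) + 1) ^ n := by
  classical
  let bas := basisOfPiSpaceOfLinearIndependent hw
  have hbas : ∀ i, bas i = fun j => (w i j : ℚ) := fun i => by simp [bas]
  have hrep : ∀ c : (Fin n → ℤ) ⧸ M, ∃ r : Fin n → ℤ, (r : (Fin n → ℤ) ⧸ M) = c ∧
      r ∈ intBox n (n * R) := by
    intro c
    obtain ⟨z, rfl⟩ := QuotientAddGroup.mk_surjective c
    let α : Fin n → ℚ := fun i => bas.repr (fun j => (z j : ℚ)) i
    have hz : ∀ j, (z j : ℚ) = ∑ i, α i * w i j := by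
      intro j
      have := congrFun (bas.sum_repr (fun j => (z j : ℚ))) j
      rw [← this]
      simp [α, hbas, Finset.sum_apply]
    refine ⟨z - ∑ i, ⌊α i⌋ • w i, ?_, ?_⟩
    · rw [QuotientAddGroup.mk_sub, sub_eq_self, QuotientAddGroup.eq_zero_iff]
      exact M.sum_mem fun i _ => M.zsmul_mem (hwM i) _
    · rw [mem_intBox]
      intro j
      have h1 : (((z - ∑ i, ⌊α i⌋ • w i) j : ℤ) : ℚ) = ∑ i, Int.fract (α i) * w i j := by
        simp only [Pi.sub_apply, Finset.sum_apply, Pi.smul_apply, smul_eq_mul, Int.cast_sub,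
          Int.cast_sum, Int.cast_mul, hz j, ← Finset.sum_sub_distrib]
        refine Finset.sum_congr rfl fun i _ => ?_
        rw [← sub_mul, Int.self_sub_floor]
      have h2 : |(((z - ∑ i, ⌊α i⌋ • w i) j : ℤ) : ℚ)| ≤ ((n * R : ℕ) : ℚ) := by
        rw [h1]
        refine (Finset.abs_sum_le_sum_abs _ _).trans ?_
        calc ∑ i, |Int.fract (α i) * (w i j : ℚ)| ≤ ∑ _i : Fin n, (R : ℚ) := by
              refine Finset.sum_le_sum fun i _ => ?_
              rw [abs_mul, abs_of_nonneg (Int.fract_nonneg _)]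
              have h3 : |(w i j : ℚ)| ≤ R := by exact_mod_cast mem_intBox.1 (hwR i) j
              have := Int.fract_lt_one (α i)
              have := Int.fract_nonneg (α i)
              have := abs_nonneg (w i j : ℚ)
              nlinarith
          _ = ((n * R : ℕ) : ℚ) := by simp
      exact_mod_cast h2
  choose r hr hrbox using hrep
  have hsum : ∀ {x y : Fin n → ℤ}, x ∈ intBox n R → y ∈ intBox n (n * R) →
      x + y ∈ intBox n ((n + 1) * R) := by
    intro x y hx hy
    rw [mem_intBox] at hx hy ⊢
    intro i
    have := abs_add_le (x i) (y i)
    have := hx i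
    have := hy i
    rw [Pi.add_apply]
    push_cast at *
    linarith
  let φ : T × ((Fin n → ℤ) ⧸ M) → intBox n ((n + 1) * R) := fun q =>
    ⟨q.1 + r q.2, hsum (hT _ q.1.2).2 (hrbox _)⟩
  have hφ : Function.Injective φ := by
    rintro ⟨x, c⟩ ⟨y, e⟩ h
    have h1 : (x : Fin n → ℤ) + r c = y + r e := congrArg Subtype.val h
    have h2 := congrArg (QuotientAddGroup.mk (s := M)) h1
    rw [QuotientAddGroup.mk_add, QuotientAddGroup.mk_add, hr, hr,
      (QuotientAddGroup.eq_zero_iff _).2 (hT _ x.2).1,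
      (QuotientAddGroup.eq_zero_iff _).2 (hT _ y.2).1, zero_add, zero_add] at h2
    subst h2
    have h3 : (x : Fin n → ℤ) = y := by simpa using h1
    exact Prod.ext (Subtype.ext h3) rfl
  have hfin : Finite ((Fin n → ℤ) ⧸ M) := by
    refine Finite.of_injective (fun c => (⟨r c, hrbox c⟩ : intBox n (n * R))) ?_
    intro c e h
    have : r c = r e := congrArg Subtype.val h
    rw [← hr c, ← hr e, this]
  refine ⟨?_, ?_⟩
  · rw [AddSubgroup.index]
    exact Nat.card_pos.ne'
  · have := Nat.card_le_card_of_injective φ hφ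
    rw [Nat.card_prod] at this
    simpa [AddSubgroup.index, card_intBox] using this

/-- Points of a lattice in a box that lie on a hyperplane are few when the lattice has no short
vectors. -/
theorem card_le_of_hyperplane {n R lam : ℕ} (M : AddSubgroup (Fin n → ℤ))
    (hlam : 0 < lam) (hM : ∀ z ∈ M, z ≠ 0 → lam ≤ supNorm z)
    (h : Fin n → ℚ) (hh : h ≠ 0) (T : Finset (Fin n → ℤ))
    (hT : ∀ x ∈ T, x ∈ M ∧ x ∈ intBox n R ∧ ∑ i, h i * x i = 0) :
    T.card ≤ (2 * n * R / lam + 1) ^ (n - 1) := by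
  classical
  obtain ⟨i₁, hi₁⟩ : ∃ i, h i ≠ 0 := by
    by_contra hcon
    push Not at hcon
    exact hh (funext hcon)
  have : Nonempty (Fin n) := ⟨i₁⟩
  obtain ⟨i₀, hi₀⟩ := Finite.exists_max fun i => |h i|
  have hpos : 0 < |h i₀| := lt_of_lt_of_le (abs_pos.2 hi₁) (hi₀ i₁)
  have hn : 0 < n := lt_of_le_of_lt (Nat.zero_le _) i₁.2
  let cell : (Fin n → ℤ) → {i : Fin n // i ≠ i₀} → ℕ := fun x i =>
    n * (x i + R).toNat / lam
  have hmaps : ∀ x ∈ T, cell x ∈ Fintype.piFinset fun _ : {i : Fin n // i ≠ i₀} =>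
      Finset.range (2 * n * R / lam + 1) := by
    intro x hx
    rw [Fintype.mem_piFinset]
    intro i
    rw [Finset.mem_range, Nat.lt_succ_iff]
    refine Nat.div_le_div_right ?_
    have h1 := mem_intBox.1 (hT x hx).2.1 i
    have h2 : (x i + R).toNat ≤ 2 * R := by
      have := (abs_le.1 h1).2
      omega
    calc n * (x i + R).toNat ≤ n * (2 * R) := Nat.mul_le_mul_left _ h2
      _ = 2 * n * R := by ring
  have hinj : Set.InjOn cell T := by
    intro x hx y hy hxy
    by_contra hne
    have hsub : x - y ≠ 0 := sub_ne_zero.2 hne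
    have hlow := hM _ (M.sub_mem (hT x hx).1 (hT y hy).1) hsub
    have hδ : ∀ i, i ≠ i₀ → (n : ℤ) * |x i - y i| < lam := by
      intro i hi
      have h1 : n * (x i + R).toNat / lam = n * (y i + R).toNat / lam :=
        congrFun hxy ⟨i, hi⟩
      have hx1 := abs_le.1 (mem_intBox.1 (hT x hx).2.1 i)
      have hy1 := abs_le.1 (mem_intBox.1 (hT y hy).2.1 i)
      have h2 : ((x i + R).toNat : ℤ) = x i + R := Int.toNat_of_nonneg (by linarith)
      have h3 : ((y i + R).toNat : ℤ) = y i + R := Int.toNat_of_nonneg (by linarith)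
      have h4 := Nat.div_add_mod (n * (x i + R).toNat) lam
      have h5 := Nat.div_add_mod (n * (y i + R).toNat) lam
      have h6 := Nat.mod_lt (n * (x i + R).toNat) hlam
      have h7 := Nat.mod_lt (n * (y i + R).toNat) hlam
      rw [h1] at h4
      zify at h4 h5 h6 h7
      rw [h2, h3] at h4
      rw [h2] at h6
      rw [h3] at h5 h7
      have h8 : 0 ≤ (n * (x i + R) : ℤ) % lam := Int.emod_nonneg _ (by omega)
      have h9 : 0 ≤ (n * (y i + R) : ℤ) % lam := Int.emod_nonneg _ (by omega)
      have h10 : (n : ℤ) * |x i - y i| = |(n : ℤ) * (x i + R) - n * (y i + R)| := by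
        rw [← mul_sub, abs_mul, abs_of_nonneg (by positivity : (0 : ℤ) ≤ n)]
        congr 2
        ring
      rw [h10, abs_lt]
      constructor <;> linarith
    have hzero : ∑ i, h i * ((x i - y i : ℤ) : ℚ) = 0 := by
      have h1 := (hT x hx).2.2
      have h2 := (hT y hy).2.2
      calc _ = ∑ i, h i * x i - ∑ i, h i * y i := by
            rw [← Finset.sum_sub_distrib]
            exact Finset.sum_congr rfl fun i _ => by push_cast; ring
        _ = 0 := by rw [h1, h2, sub_zero]
    have hδ₀ : (n : ℚ) * |((x i₀ - y i₀ : ℤ) : ℚ)| < n * lam := by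
      have h1 : |h i₀| * |((x i₀ - y i₀ : ℤ) : ℚ)| ≤
          ∑ i ∈ Finset.univ.erase i₀, |h i₀| * |((x i - y i : ℤ) : ℚ)| := by
        rw [← Finset.add_sum_erase _ _ (Finset.mem_univ i₀)] at hzero
        rw [← abs_mul, eq_neg_of_add_eq_zero_left hzero, abs_neg]
        refine (Finset.abs_sum_le_sum_abs _ _).trans (Finset.sum_le_sum fun i _ => ?_)
        rw [abs_mul]
        exact mul_le_mul_of_nonneg_right (hi₀ i) (abs_nonneg _)
      rw [← Finset.mul_sum] at h1
      have h2 := le_of_mul_le_mul_left h1 hpos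
      calc (n : ℚ) * |((x i₀ - y i₀ : ℤ) : ℚ)| ≤
            n * ∑ i ∈ Finset.univ.erase i₀, |((x i - y i : ℤ) : ℚ)| := by gcongr
        _ = ∑ i ∈ Finset.univ.erase i₀, (n : ℚ) * |((x i - y i : ℤ) : ℚ)| := Finset.mul_sum _ _ _
        _ ≤ ∑ _i ∈ Finset.univ.erase i₀, (lam : ℚ) := by
            refine Finset.sum_le_sum fun i hi => ?_
            have := (hδ i (Finset.ne_of_mem_erase hi)).le
            exact_mod_cast this
        _ = ((n - 1 : ℕ) : ℚ) * lam := by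
            rw [Finset.sum_const, Finset.card_erase_of_mem (Finset.mem_univ _)]
            simp
        _ < n * lam := by
            have : ((n - 1 : ℕ) : ℚ) < n := by exact_mod_cast Nat.sub_lt hn one_pos
            have : (0 : ℚ) < lam := by exact_mod_cast hlam
            gcongr
    have hall : ∀ i, |(x - y) i| < lam := by
      intro i
      rw [Pi.sub_apply]
      by_cases hi : i = i₀
      · subst hi
        have : (0 : ℚ) < n := by exact_mod_cast hn
        have h1 := lt_of_mul_lt_mul_left hδ₀ this.le
        exact_mod_cast h1
      · have h1 := hδ i hi
        have : (1 : ℤ) ≤ n := by exact_mod_cast hn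
        nlinarith [abs_nonneg (x i - y i)]
    obtain ⟨i, hi⟩ := exists_abs_eq_supNorm hn (x - y)
    have := hall i
    omega
  have hcard := Finset.card_le_card_of_injOn cell hmaps hinj
  refine hcard.trans (le_of_eq ?_)
  rw [Fintype.card_piFinset]
  simp [Fintype.card_subtype_compl]

/-- Either the points span, or they lie on a hyperplane. -/
theorem exists_linearIndependent_or_hyperplane {n : ℕ} (T : Set (Fin n → ℤ)) :
    (∃ w : Fin n → Fin n → ℤ, (∀ i, w i ∈ T) ∧ LinearIndependent ℚ fun i j => (w i j : ℚ)) ∨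
      ∃ h : Fin n → ℚ, h ≠ 0 ∧ ∀ x ∈ T, ∑ i, h i * x i = 0 := by
  classical
  let ι : (Fin n → ℤ) → (Fin n → ℚ) := fun x j => (x j : ℚ)
  by_cases hspan : Submodule.span ℚ (ι '' T) = ⊤
  · left
    obtain ⟨b, hbT, hbspan, hbli⟩ := exists_linearIndependent ℚ (ι '' T)
    have hbtop : ⊤ ≤ Submodule.span ℚ (Set.range ((↑) : b → Fin n → ℚ)) := by
      rw [Subtype.range_coe, hbspan, hspan]
    let bas := Module.Basis.mk hbli hbtop
    let e := bas.indexEquiv (Pi.basisFun ℚ (Fin n))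
    have hw : ∀ i : Fin n, ∃ x ∈ T, ι x = (e.symm i : Fin n → ℚ) :=
      fun i => hbT (e.symm i).2
    choose w hwT hw using hw
    refine ⟨w, hwT, ?_⟩
    have : (fun i j => (w i j : ℚ)) = ((↑) : b → Fin n → ℚ) ∘ e.symm := funext hw
    rw [this]
    exact hbli.comp _ e.symm.injective
  · right
    obtain ⟨f, hf0, hf⟩ := Submodule.exists_le_ker_of_lt_top _ (lt_top_iff_ne_top.2 hspan)
    have hfx : ∀ y : Fin n → ℚ, f y = ∑ i, f (Pi.single i 1) * y i := by
      intro y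
      conv_lhs => rw [← (Pi.basisFun ℚ (Fin n)).sum_repr y]
      simp [mul_comm]
    refine ⟨fun i => f (Pi.single i 1), fun h0 => hf0 ?_, fun x hx => ?_⟩
    · ext i
      simpa using congrFun h0 i
    · rw [← hfx (ι x)]
      exact hf (Submodule.subset_span ⟨x, hx, rfl⟩)

/-- A multiple of a shortest vector. -/
theorem exists_smul_eq_of_parallel {n : ℕ} (hn : 0 < n) (M : AddSubgroup (Fin n → ℤ))
    {v y : Fin n → ℤ} (hv : v ∈ M) (hv0 : v ≠ 0) (hmin : ∀ z ∈ M, z ≠ 0 → supNorm v ≤ supNorm z)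
    (hy : y ∈ M) (hpar : ∀ i j, y i * v j = y j * v i) : ∃ q : ℤ, y = q • v := by
  obtain ⟨i₀, hi₀⟩ := exists_abs_eq_supNorm hn v
  have hvpos := supNorm_pos hv0
  have hvi : v i₀ ≠ 0 := by
    intro h
    rw [h, abs_zero] at hi₀
    omega
  set q : ℤ := (y i₀) / (v i₀) with hq
  refine ⟨q, ?_⟩
  by_contra hne
  have hz0 : y - q • v ≠ 0 := sub_ne_zero.2 hne
  have hzM : y - q • v ∈ M := M.sub_mem hy (M.zsmul_mem hv _)
  have hmain := hmin _ hzM hz0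
  have hzi : (y - q • v) i₀ = y i₀ % v i₀ := by
    simp only [Pi.sub_apply, Pi.smul_apply, smul_eq_mul]
    have := Int.mul_ediv_add_emod (y i₀) (v i₀)
    rw [hq]
    linarith
  have hlt : |(y - q • v) i₀| < |v i₀| := by
    rw [hzi, abs_of_nonneg (Int.emod_nonneg _ hvi)]
    exact Int.emod_lt_abs _ hvi
  obtain ⟨i, hi⟩ := exists_abs_eq_supNorm hn (y - q • v)
  have hpar' : (y - q • v) i * v i₀ = (y - q • v) i₀ * v i := by
    simp only [Pi.sub_apply, Pi.smul_apply, smul_eq_mul]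
    have := hpar i i₀
    linear_combination this
  have hab := congrArg abs hpar'
  rw [abs_mul, abs_mul] at hab
  have h1 : |v i| ≤ |v i₀| := by rw [hi₀]; exact abs_le_supNorm v i
  have h2 : |v i₀| ≤ |(y - q • v) i| := by rw [hi, hi₀]; exact_mod_cast hmain
  have h3 : 0 < |v i₀| := abs_pos.2 hvi
  nlinarith [abs_nonneg ((y - q • v) i₀), abs_nonneg (v i)]

/-- Minkowski's bound (with sup norm, from the pigeonhole principle). -/
theorem exists_shortest_vector {n : ℕ} (hn : 0 < n) (M : AddSubgroup (Fin n → ℤ))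
    (hM : M.index ≠ 0) :
    ∃ v ∈ M, v ≠ 0 ∧ (∀ z ∈ M, z ≠ 0 → supNorm v ≤ supNorm z) ∧ supNorm v ^ n ≤ M.index := by
  classical
  obtain ⟨m, hm1, hm2⟩ : ∃ m, m ^ n ≤ M.index ∧ M.index < (m + 1) ^ n := by
    refine ⟨Nat.findGreatest (fun m => m ^ n ≤ M.index) M.index, ?_, ?_⟩
    · exact Nat.findGreatest_spec (P := fun m => m ^ n ≤ M.index) (Nat.zero_le _)
        (by simp [zero_pow hn.ne'])
    · by_contra hcon
      push Not at hcon
      have h1 := Nat.le_findGreatest (P := fun m => m ^ n ≤ M.index)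
        ((Nat.le_self_pow hn.ne' _).trans hcon) hcon
      omega
  have hex : ∃ v ∈ M, v ≠ 0 ∧ supNorm v ≤ m := by
    have : Finite ((Fin n → ℤ) ⧸ M) := Nat.finite_of_card_ne_zero hM
    have := Fintype.ofFinite ((Fin n → ℤ) ⧸ M)
    have hcard : (Finset.univ : Finset ((Fin n → ℤ) ⧸ M)).card <
        (Fintype.piFinset fun _ : Fin n => Finset.Icc (0 : ℤ) m).card := by
      have hidx : Fintype.card ((Fin n → ℤ) ⧸ M) = M.index := Nat.card_eq_fintype_card.symm
      rw [Finset.card_univ, hidx, Fintype.card_piFinset]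
      simpa using hm2
    obtain ⟨x, hx, y, hy, hxy, hmk⟩ := Finset.exists_ne_map_eq_of_card_lt_of_maps_to hcard
      (f := fun z => (QuotientAddGroup.mk z : (Fin n → ℤ) ⧸ M)) (fun _ _ => Finset.mem_univ _)
    refine ⟨-x + y, QuotientAddGroup.eq.1 hmk, fun h => hxy ?_, ?_⟩
    · exact (neg_eq_of_add_eq_zero_right h |>.symm ▸ by simp : x = y)
    · rw [supNorm_le_iff]
      intro i
      have h1 := Finset.mem_Icc.1 (Fintype.mem_piFinset.1 hx i)
      have h2 := Finset.mem_Icc.1 (Fintype.mem_piFinset.1 hy i)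
      rw [Pi.add_apply, Pi.neg_apply, abs_le]
      constructor <;> linarith
  let P : ℕ → Prop := fun s => ∃ v ∈ M, v ≠ 0 ∧ supNorm v = s
  have hP : ∃ s, P s := by
    obtain ⟨v, hv, hv0, -⟩ := hex
    exact ⟨_, v, hv, hv0, rfl⟩
  obtain ⟨v, hv, hv0, hvs⟩ := Nat.find_spec hP
  refine ⟨v, hv, hv0, fun z hz hz0 => ?_, ?_⟩
  · rw [hvs]
    exact Nat.find_min' hP ⟨z, hz, hz0, rfl⟩
  · obtain ⟨z, hz, hz0, hzm⟩ := hex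
    refine le_trans (Nat.pow_le_pow_left ?_ n) hm1
    rw [hvs]
    exact (Nat.find_min' hP ⟨z, hz, hz0, rfl⟩).trans hzm

/-! ### Sieving along an arithmetic progression -/

theorem card_filter_mod_mem_le {ι : Type*} [Fintype ι] (m : ι → ℕ)
    (hm : Pairwise fun i j => (m i).Coprime (m j)) (A : ι → Finset ℕ)
    (T : ℕ) :
    ((Finset.range T).filter fun t => ∀ i, t % m i ∈ A i).card ≤
      (T / (∏ i, m i) + 1) * ∏ i, (A i).card := by
  classical
  rw [← Fintype.card_piFinset, ← Finset.card_range (T / (∏ i, m i) + 1), ← Finset.card_product]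
  refine Finset.card_le_card_of_injOn (fun t => (t / ∏ i, m i, fun i => t % m i)) ?_ ?_
  · intro t ht
    have ht' := Finset.mem_filter.1 ht
    have hle := (Finset.mem_range.1 ht'.1).le
    refine Finset.mem_product.2 ⟨?_, Fintype.mem_piFinset.2 ht'.2⟩
    exact Finset.mem_range.2 (Nat.lt_succ_of_le (Nat.div_le_div_right hle))
  · intro t _ t' _ h
    have h1 : t / ∏ i, m i = t' / ∏ i, m i := congrArg Prod.fst h
    have h2 : ∀ i, t % m i = t' % m i := fun i => congrFun (congrArg Prod.snd h) i
    have h3 : ((∏ i, m i : ℕ) : ℤ) ∣ (t' : ℤ) - t := by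
      push_cast
      refine Finset.prod_dvd_of_coprime (fun i _ j _ hij => ?_) fun i _ => ?_
      · exact Nat.isCoprime_iff_coprime.2 (hm hij)
      · exact Nat.modEq_iff_dvd.1 (h2 i)
    have h4 : t % ∏ i, m i = t' % ∏ i, m i := Nat.modEq_iff_dvd.2 h3
    rw [← Nat.div_add_mod t (∏ i, m i), h1, h4, Nat.div_add_mod]

theorem card_le_of_forall_exists_class {ι C : Type*} [Fintype ι] [Fintype C] {k : ℕ} (m : ι → ℕ)
    (hm : Pairwise fun i j => (m i).Coprime (m j))
    (A : C → (ι → Fin k) → ι → Finset ℕ) (a : ι → Fin k → ℕ)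
    (hA : ∀ ε w i, (A ε w i).card ≤ a i (w i)) (T : ℕ) (X : Finset ℕ)
    (hX : ∀ t ∈ X, t < T ∧ ∃ ε w, ∀ i, t % m i ∈ A ε w i) :
    X.card ≤ Fintype.card C * ((T / (∏ i, m i) + 1) * ∏ i, ∑ j, a i j) := by
  classical
  have hsub : X ⊆ Finset.univ.biUnion fun ε : C => Finset.univ.biUnion fun w : ι → Fin k =>
      (Finset.range T).filter fun t => ∀ i, t % m i ∈ A ε w i := by
    intro t ht
    obtain ⟨hT, ε, w, h⟩ := hX t ht
    simp only [Finset.mem_biUnion, Finset.mem_univ, true_and, Finset.mem_filter, Finset.mem_range]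
    exact ⟨ε, w, hT, h⟩
  refine (Finset.card_le_card hsub).trans (Finset.card_biUnion_le.trans ?_)
  calc ∑ ε : C, (Finset.univ.biUnion fun w : ι → Fin k =>
        (Finset.range T).filter fun t => ∀ i, t % m i ∈ A ε w i).card
      ≤ ∑ _ε : C, (T / (∏ i, m i) + 1) * ∏ i, ∑ j, a i j := by
        refine Finset.sum_le_sum fun ε _ => Finset.card_biUnion_le.trans ?_
        rw [Finset.prod_univ_sum, Fintype.piFinset_univ, Finset.mul_sum]
        refine Finset.sum_le_sum fun w _ => ?_
        refine (card_filter_mod_mem_le m hm _ T).trans (Nat.mul_le_mul_left _ ?_)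
        exact Finset.prod_le_prod' fun i _ => hA ε w i
    _ = _ := by rw [Finset.sum_const, Finset.card_univ, smul_eq_mul]

/-- `Φ` has a simple root in some field of characteristic `p`. -/
def HasSimpleRootMod (p : ℕ) (Φ : Polynomial ℤ) : Prop :=
  ∃ (κ : Type) (_ : Field κ) (_ : CharP κ p) (s : κ),
    (Φ.map (Int.castRingHom κ)).rootMultiplicity s = 1

theorem card_filter_mod_prime_le (p k : ℕ) (hp : p.Prime) (hk : 0 < k) (P : ZMod p → Prop)
    [DecidablePred P] [Fintype (ZMod p)] :
    ((Finset.range (p ^ k)).filter fun r : ℕ => P (r : ZMod p)).card ≤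
      (Finset.univ.filter P).card * p ^ (k - 1) := by
  have := hp.pos
  rw [← Finset.card_range (p ^ (k - 1)), ← Finset.card_product]
  refine Finset.card_le_card_of_injOn (fun r : ℕ => ((r : ZMod p), r / p)) ?_ ?_
  · intro r hr
    have hr' := Finset.mem_filter.1 hr
    refine Finset.mem_product.2 ⟨by simpa using hr'.2, Finset.mem_range.2 ?_⟩
    refine Nat.div_lt_of_lt_mul ?_
    rw [← pow_succ', Nat.sub_add_cancel hk]
    exact Finset.mem_range.1 hr'.1
  · intro r _ r' _ h
    have h1 : (r : ZMod p) = r' := congrArg Prod.fst h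
    have h2 : r / p = r' / p := congrArg Prod.snd h
    have h3 : r % p = r' % p := (ZMod.natCast_eq_natCast_iff _ _ _).1 h1
    rw [← Nat.div_add_mod r p, h2, h3, Nat.div_add_mod]

theorem card_roots_mod_le (p d : ℕ) [Fact p.Prime] (f : Polynomial (ZMod p)) (hf : f ≠ 0)
    (hd : f.natDegree ≤ d) : (Finset.univ.filter fun t : ZMod p => f.eval t = 0).card ≤ d := by
  classical
  refine le_trans ?_ ((Polynomial.card_roots' f).trans hd)
  refine le_trans (Finset.card_le_card ?_) (Multiset.toFinset_card_le f.roots)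
  intro t ht
  simpa [hf] using ht

theorem sum_card_filter_exact_le (Q p k : ℕ) (g : ℕ → ℤ) :
    ∑ j : Fin k, ((Finset.range Q).filter fun r =>
      (p : ℤ) ^ (j : ℕ) ∣ g r ∧ ¬ (p : ℤ) ^ ((j : ℕ) + 1) ∣ g r).card ≤ Q := by
  classical
  rw [← Finset.card_biUnion]
  · refine (Finset.card_le_card ?_).trans (Finset.card_range Q).le
    intro r hr
    obtain ⟨j, -, hj⟩ := Finset.mem_biUnion.1 hr
    exact (Finset.mem_filter.1 hj).1
  · intro i _ j _ hij
    rw [Function.onFun, Finset.disjoint_left]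
    intro r hi hj
    have hi' := (Finset.mem_filter.1 hi).2
    have hj' := (Finset.mem_filter.1 hj).2
    rcases lt_or_gt_of_ne hij with h | h
    · exact hi'.2 ((pow_dvd_pow _ (by omega)).trans hj'.1)
    · exact hj'.2 ((pow_dvd_pow _ (by omega)).trans hi'.1)

theorem sum_card_filter_exact_succ_le (p k d : ℕ) [Fact p.Prime] (hk : 0 < k) (Φ : Polynomial ℤ)
    (hd : Φ.natDegree ≤ d) (hΦ : Φ.map (Int.castRingHom (ZMod p)) ≠ 0) :
    ∑ j ∈ Finset.univ.filter (fun j : Fin k => (j : ℕ) ≠ 0), ((Finset.range (p ^ k)).filter fun r : ℕ =>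
      (p : ℤ) ^ (j : ℕ) ∣ Φ.eval (r : ℤ) ∧ ¬ (p : ℤ) ^ ((j : ℕ) + 1) ∣ Φ.eval (r : ℤ)).card ≤
      d * p ^ (k - 1) := by
  classical
  rw [← Finset.card_biUnion]
  · refine le_trans (Finset.card_le_card (t := (Finset.range (p ^ k)).filter fun r : ℕ =>
      (Φ.map (Int.castRingHom (ZMod p))).eval (r : ZMod p) = 0) ?_) ?_
    · intro r hr
      obtain ⟨j, hj0, hj⟩ := Finset.mem_biUnion.1 hr
      have hj' := Finset.mem_filter.1 hj
      refine Finset.mem_filter.2 ⟨hj'.1, ?_⟩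
      have h1 : (p : ℤ) ∣ Φ.eval (r : ℤ) :=
        (dvd_pow_self _ (Finset.mem_filter.1 hj0).2).trans hj'.2.1
      rw [Polynomial.eval_natCast_map, eq_intCast]
      exact (ZMod.intCast_zmod_eq_zero_iff_dvd _ _).2 h1
    · refine (card_filter_mod_prime_le p k Fact.out hk fun x =>
        (Φ.map (Int.castRingHom (ZMod p))).eval x = 0).trans (Nat.mul_le_mul_right _ ?_)
      exact card_roots_mod_le p d _ hΦ (Polynomial.natDegree_map_le.trans hd)
  · intro i _ j _ hij
    rw [Function.onFun, Finset.disjoint_left]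
    intro r hi hj
    have hi' := (Finset.mem_filter.1 hi).2
    have hj' := (Finset.mem_filter.1 hj).2
    rcases lt_or_gt_of_ne hij with h | h
    · exact hi'.2 ((pow_dvd_pow _ (by omega)).trans hj'.1)
    · exact hj'.2 ((pow_dvd_pow _ (by omega)).trans hi'.1)

theorem HasSimpleRootMod.map_ne_zero {p : ℕ} {Φ : Polynomial ℤ} (h : HasSimpleRootMod p Φ) :
    Φ.map (Int.castRingHom (ZMod p)) ≠ 0 := by
  obtain ⟨κ, _, _, s, hs⟩ := h
  intro h0
  have : Φ.map (Int.castRingHom κ) = 0 := by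
    have h1 := congrArg (Polynomial.map (ZMod.castHom (dvd_refl p) κ)) h0
    rw [Polynomial.map_map, Polynomial.map_zero] at h1
    rwa [show (Int.castRingHom κ) = (ZMod.castHom (dvd_refl p) κ).comp (Int.castRingHom (ZMod p))
      from RingHom.ext_int _ _]
  rw [this] at hs
  simp at hs

theorem HasSimpleRootMod.card_filter_pow_le {p d ℓ k : ℕ} (hp : p.Prime) (hk : 0 < k)
    (hℓ : 2 ≤ ℓ) (hdvd : ℓ ∣ p - 1) (hpd : 9 * ℓ * (d + 2) ^ 3 ≤ p) {Φ : Polynomial ℤ}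
    (hΦ : Φ.natDegree ≤ d) (h : HasSimpleRootMod p Φ) (c : ZMod p) :
    ((Finset.range (p ^ k)).filter fun r : ℕ =>
      ((Φ.eval (r : ℤ) : ℤ) : ZMod p) ^ ((p - 1) / ℓ) = c).card ≤ 3 * p / 4 * p ^ (k - 1) := by
  classical
  have : Fact p.Prime := ⟨hp⟩
  obtain ⟨κ, _, _, s, hs⟩ := h
  let _ : Algebra (ZMod p) κ := ZMod.algebra κ p
  have h1 := stepanov_card_le hℓ hdvd hpd (Φ.map (Int.castRingHom (ZMod p)))
    (Polynomial.natDegree_map_le.trans hΦ) s (by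
      rw [Polynomial.map_map,
        show (algebraMap (ZMod p) κ).comp (Int.castRingHom (ZMod p)) = Int.castRingHom κ
          from RingHom.ext_int _ _]
      exact hs) c
  have h2 := card_filter_mod_prime_le p k hp hk fun t =>
    (Φ.map (Int.castRingHom (ZMod p))).eval t ^ ((p - 1) / ℓ) = c
  refine le_trans (le_of_eq ?_) (h2.trans (Nat.mul_le_mul_right _ ?_))
  · congr 1
    refine Finset.filter_congr fun r _ => ?_
    rw [Polynomial.eval_natCast_map, eq_intCast]
  · rw [Nat.le_div_iff_mul_le (by norm_num)]
    linarith

theorem cast_prod_le_of_forall_le_ite {P G : Finset ℕ} (hGP : G ⊆ P) (m S : P → ℕ) (c : ℝ)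
    (h : ∀ p : P, (S p : ℝ) ≤ (m p : ℝ) * (if (p : ℕ) ∈ G then c else 1)) :
    ((∏ p, S p : ℕ) : ℝ) ≤ (∏ p, m p : ℕ) * c ^ G.card := by
  rw [Nat.cast_prod, Nat.cast_prod]
  refine (Finset.prod_le_prod (fun p _ => Nat.cast_nonneg _) fun p _ => h p).trans (le_of_eq ?_)
  rw [Finset.prod_mul_distrib,
    Finset.prod_coe_sort P fun p => if p ∈ G then c else 1, Finset.prod_ite_mem,
    Finset.inter_eq_right.2 hGP, Finset.prod_const]

theorem card_le_of_simple_roots {k ℓ d T : ℕ} (hk : 0 < k) (hℓ : 2 ≤ ℓ) (hℓk : ℓ ∣ k)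
    (Φ : Polynomial ℤ) (hΦ : Φ.natDegree ≤ d) (P G : Finset ℕ) (hP : ∀ p ∈ P, p.Prime)
    (hGP : G ⊆ P)
    (hG : ∀ p ∈ G, ℓ ∣ p - 1 ∧ 9 * ℓ * (d + 2) ^ 3 ≤ p ∧ HasSimpleRootMod p Φ)
    (u : ℤ) (hu : ∀ p ∈ P, ¬ (p : ℤ) ∣ u) (X : Finset ℕ)
    (hX : ∀ t ∈ X, t < T ∧ ∃ (ε : Bool) (w : ℕ → ℕ) (q : ℤ), (∀ p ∈ P, w p < k) ∧
      (∀ p ∈ P, ¬ (p : ℤ) ∣ q) ∧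
      Φ.eval (t : ℤ) = (if ε then 1 else -1) * (∏ p ∈ P, (p : ℤ) ^ w p) * u * q ^ k)
    (hT : ∏ p ∈ P, p ^ k ≤ T) :
    (X.card : ℝ) ≤ 4 * T * (7 / 8) ^ G.card := by
  classical
  have hPP : ∀ p : P, (p : ℕ).Prime := fun p => hP p p.2
  let m : P → ℕ := fun p => (p : ℕ) ^ k
  let sg : Bool → ℤ := fun ε => if ε then 1 else -1
  let c : Bool → (P → Fin k) → ∀ p : P, ZMod p := fun ε w p =>
    ((sg ε * (∏ p' : P, ((p' : ℕ) : ℤ) ^ (w p' : ℕ)) * u : ℤ) : ZMod p) ^ (((p : ℕ) - 1) / ℓ)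
  let ex : P → Fin k → ℕ → Prop := fun p j r =>
    ((p : ℕ) : ℤ) ^ (j : ℕ) ∣ Φ.eval (r : ℤ) ∧ ¬ ((p : ℕ) : ℤ) ^ ((j : ℕ) + 1) ∣ Φ.eval (r : ℤ)
  let A : Bool → (P → Fin k) → P → Finset ℕ := fun ε w p =>
    (Finset.range (m p)).filter fun r => ex p (w p) r ∧ ((p : ℕ) ∈ G → (w p : ℕ) = 0 →
      ((Φ.eval (r : ℤ) : ℤ) : ZMod p) ^ (((p : ℕ) - 1) / ℓ) = c ε w p)
  let a : P → Fin k → ℕ := fun p j => if (p : ℕ) ∈ G ∧ (j : ℕ) = 0 then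
    3 * (p : ℕ) / 4 * (p : ℕ) ^ (k - 1) else ((Finset.range (m p)).filter (ex p j)).card
  have hm : Pairwise fun i j : P => (m i).Coprime (m j) := by
    intro i j hij
    exact Nat.Coprime.pow _ _ ((Nat.coprime_primes (hPP i) (hPP j)).2 fun h => hij (Subtype.ext h))
  have hA : ∀ ε w p, (A ε w p).card ≤ a p (w p) := by
    intro ε w p
    by_cases h : (p : ℕ) ∈ G ∧ (w p : ℕ) = 0
    · simp only [a, if_pos h]
      obtain ⟨h1, h2, h3⟩ := hG p h.1
      refine le_trans (Finset.card_le_card ?_)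
        (h3.card_filter_pow_le (hPP p) hk hℓ h1 h2 hΦ (c ε w p))
      intro r hr
      have hr' := Finset.mem_filter.1 hr
      exact Finset.mem_filter.2 ⟨hr'.1, hr'.2.2 h.1 h.2⟩
    · simp only [a, if_neg h]
      refine Finset.card_le_card fun r hr => ?_
      have hr' := Finset.mem_filter.1 hr
      exact Finset.mem_filter.2 ⟨hr'.1, hr'.2.1⟩
  have hmem : ∀ t ∈ X, t < T ∧ ∃ ε w, ∀ p, t % m p ∈ A ε w p := by
    intro t ht
    obtain ⟨htT, ε, w, q, hw, hq, hval⟩ := hX t ht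
    refine ⟨htT, ε, fun p => ⟨w p, hw p p.2⟩, fun p => ?_⟩
    have hpp := hPP p
    have hpi := Nat.prime_iff_prime_int.1 hpp
    have hprod : (∏ p' : P, ((p' : ℕ) : ℤ) ^ w p') = ∏ p' ∈ P, (p' : ℤ) ^ w p' :=
      Finset.prod_coe_sort P fun p' => (p' : ℤ) ^ w p'
    have hcong : ((m p : ℕ) : ℤ) ∣ Φ.eval (t : ℤ) - Φ.eval ((t % m p : ℕ) : ℤ) := by
      refine dvd_trans ?_ (Polynomial.sub_dvd_eval_sub _ _ Φ)
      push_cast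
      exact Int.dvd_self_sub_of_emod_eq rfl
    have hcong' : ((p : ℕ) : ℤ) ∣ Φ.eval (t : ℤ) - Φ.eval ((t % m p : ℕ) : ℤ) := by
      refine dvd_trans ?_ hcong
      push_cast [m]
      exact dvd_pow_self _ hk.ne'
    have hsplit : Φ.eval (t : ℤ) = ((p : ℕ) : ℤ) ^ w p *
        (sg ε * (∏ p' ∈ P.erase p, (p' : ℤ) ^ w p') * u * q ^ k) := by
      rw [hval, ← Finset.mul_prod_erase P (fun p' => (p' : ℤ) ^ w p') p.2]
      simp only [sg]
      ring
    have hnd : ¬ ((p : ℕ) : ℤ) ∣ sg ε * (∏ p' ∈ P.erase p, (p' : ℤ) ^ w p') * u * q ^ k := by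
      intro h
      rcases hpi.dvd_or_dvd h with h | h
      · rcases hpi.dvd_or_dvd h with h | h
        · rcases hpi.dvd_or_dvd h with h | h
          · have : sg ε = 1 ∨ sg ε = -1 := by cases ε <;> simp [sg]
            rcases this with h' | h' <;> rw [h'] at h
            · exact hpi.not_dvd_one h
            · exact hpi.not_dvd_one ((dvd_neg).1 h)
          · obtain ⟨p', hp', h'⟩ := (hpi.dvd_finsetProd_iff _).1 h
            have h2 := hpi.dvd_of_dvd_pow h'
            have h3 := (Nat.prime_dvd_prime_iff_eq hpp (hP p' (Finset.mem_of_mem_erase hp'))).1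
              (Int.natCast_dvd_natCast.1 h2)
            exact Finset.ne_of_mem_erase hp' h3.symm
        · exact hu p p.2 h
      · exact hq p p.2 (hpi.dvd_of_dvd_pow h)
    have hwk : ∀ e, e ≤ k → (((p : ℕ) : ℤ) ^ e ∣ Φ.eval (t : ℤ) ↔
        ((p : ℕ) : ℤ) ^ e ∣ Φ.eval ((t % m p : ℕ) : ℤ)) := by
      intro e he
      refine (dvd_iff_dvd_of_dvd_sub (dvd_trans ?_ hcong))
      push_cast [m]
      exact pow_dvd_pow _ he
    refine Finset.mem_filter.2 ⟨Finset.mem_range.2 (Nat.mod_lt _ (pow_pos hpp.pos k)),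
      ⟨?_, ?_⟩, ?_⟩
    · rw [← hwk _ (hw p p.2).le, hsplit]
      exact dvd_mul_right _ _
    · rw [← hwk _ (hw p p.2), hsplit]
      intro h
      rw [pow_succ] at h
      exact hnd ((mul_dvd_mul_iff_left (pow_ne_zero _ hpi.ne_zero)).1 h)
    · intro hpG hw0
      obtain ⟨h1, -, -⟩ := hG p hpG
      have : Fact (p : ℕ).Prime := ⟨hpp⟩
      have h2 : ((Φ.eval ((t % m p : ℕ) : ℤ) : ℤ) : ZMod p) = ((Φ.eval (t : ℤ) : ℤ) : ZMod p) :=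
        (ZMod.intCast_eq_intCast_iff_dvd_sub _ _ _).2 hcong'
      obtain ⟨k', rfl⟩ := hℓk
      have hq0 : (q : ZMod p) ≠ 0 := fun h => hq p p.2 ((ZMod.intCast_zmod_eq_zero_iff_dvd _ _).1 h)
      have h3 : ((q : ZMod p) ^ (ℓ * k')) ^ (((p : ℕ) - 1) / ℓ) = 1 := by
        rw [← pow_mul, mul_right_comm, Nat.mul_div_cancel' h1, pow_mul,
          ZMod.pow_card_sub_one_eq_one hq0, one_pow]
      rw [h2, hval]
      simp only [c, sg, hprod]
      push_cast
      rw [mul_pow, h3, mul_one]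
  have key := card_le_of_forall_exists_class m hm A a hA T X hmem
  have hsum : ∀ p : P, ((∑ j, a p j : ℕ) : ℝ) ≤ (m p : ℝ) * (if (p : ℕ) ∈ G then 7 / 8 else 1) := by
    intro p
    have hexle := sum_card_filter_exact_le (m p) p k fun r => Φ.eval (r : ℤ)
    by_cases h : (p : ℕ) ∈ G
    · obtain ⟨h1, h2, h3⟩ := hG p h
      have : Fact (p : ℕ).Prime := ⟨hPP p⟩
      have h4 := sum_card_filter_exact_succ_le p k d hk Φ hΦ h3.map_ne_zero
      have h5 : ∑ j, a p j ≤ 3 * (p : ℕ) / 4 * (p : ℕ) ^ (k - 1) + d * (p : ℕ) ^ (k - 1) := by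
        rw [← Finset.sum_filter_add_sum_filter_not _ (fun j : Fin k => (j : ℕ) = 0)]
        refine add_le_add ?_ (le_trans (le_of_eq ?_) h4)
        · have h6 : (Finset.univ.filter fun j : Fin k => (j : ℕ) = 0) = {⟨0, hk⟩} := by
            ext j
            simp [Fin.ext_iff]
          rw [h6, Finset.sum_singleton]
          simp [a, h]
        · refine Finset.sum_congr rfl fun j hj => ?_
          have hj' := (Finset.mem_filter.1 hj).2
          simp only [a, hj', and_false, if_false]
          rfl
      have h6 : 8 * d ≤ p := by
        refine le_trans ?_ h2
        have : d + 2 ≤ (d + 2) ^ 3 := Nat.le_self_pow (by norm_num) _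
        nlinarith
      have h7 : ((3 * (p : ℕ) / 4 : ℕ) : ℝ) ≤ 3 * (p : ℕ) / 4 := by
        have := @Nat.cast_div_le ℝ _ _ _ (3 * (p : ℕ)) 4
        push_cast at this
        exact this
      have h8 : (m p : ℝ) = (p : ℕ) * ((p : ℕ) : ℝ) ^ (k - 1) := by
        simp only [m]
        push_cast
        rw [← pow_succ', Nat.sub_add_cancel hk]
      have h9 : (0 : ℝ) ≤ ((p : ℕ) : ℝ) ^ (k - 1) := by positivity
      have h10 : (8 * d : ℝ) ≤ (p : ℕ) := by exact_mod_cast h6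
      have h11 : ((∑ j, a p j : ℕ) : ℝ) ≤
          ((3 * (p : ℕ) / 4 : ℕ) : ℝ) * ((p : ℕ) : ℝ) ^ (k - 1) + d * ((p : ℕ) : ℝ) ^ (k - 1) := by
        exact_mod_cast h5
      rw [if_pos h, h8]
      nlinarith
    · rw [if_neg h, mul_one]
      refine Nat.cast_le.2 (le_trans (le_of_eq ?_) hexle)
      refine Finset.sum_congr rfl fun j _ => ?_
      simp only [a, h, false_and, if_false]
      rfl
  have hM : (∏ p, m p) = ∏ p ∈ P, p ^ k := Finset.prod_coe_sort P fun p' => p' ^ k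
  have hMpos : 0 < ∏ p, m p := Finset.prod_pos fun p _ => pow_pos (hPP p).pos k
  have hprod := cast_prod_le_of_forall_le_ite hGP m (fun p => ∑ j, a p j) (7 / 8) hsum
  have hTM : ((T / (∏ p, m p) + 1 : ℕ) : ℝ) * (∏ p, m p : ℕ) ≤ 2 * T := by
    have h1 : T / (∏ p, m p) * (∏ p, m p) ≤ T := Nat.div_mul_le_self _ _
    rw [← hM] at hT
    have : (T / (∏ p, m p) + 1) * (∏ p, m p) ≤ 2 * T := by rw [add_mul]; omega
    exact_mod_cast this
  rw [Fintype.card_bool] at key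
  generalize (∏ p, ∑ j, a p j) = S at key hprod
  generalize (∏ p, m p) = M at key hprod hTM
  have key' : (X.card : ℝ) ≤ 2 * (((T / M + 1 : ℕ) : ℝ) * S) := by exact_mod_cast key
  calc (X.card : ℝ) ≤ 2 * (((T / M + 1 : ℕ) : ℝ) * (M * (7 / 8) ^ G.card)) :=
        key'.trans (by gcongr)
    _ = 2 * ((((T / M + 1 : ℕ) : ℝ) * M) * (7 / 8) ^ G.card) := by ring
    _ ≤ 2 * (2 * T * (7 / 8) ^ G.card) := by gcongr
    _ = _ := by ring

/-! ### Linear forms -/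

theorem eval_linForm {R : Type*} [CommRing R] {n : ℕ} (c x : Fin n → R) :
    MvPolynomial.eval x (linForm c) = ∑ i, c i * x i := by
  simp [linForm]

theorem map_linForm {R S : Type*} [CommRing R] [CommRing S] {n : ℕ} (φ : R →+* S)
    (c : Fin n → R) : (linForm c).map φ = linForm fun i => φ (c i) := by
  simp [linForm]

theorem coeff_linForm {R : Type*} [CommRing R] {n : ℕ} (c : Fin n → R) (i : Fin n) :
    (linForm c).coeff (Finsupp.single i 1) = c i := by
  classical
  simp only [linForm, coeff_sum, coeff_C_mul, coeff_X]
  rw [Finset.sum_eq_single i (fun j _ hj => ?_) (by simp)]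
  · simp
  · rw [if_neg, mul_zero]
    rwa [Finsupp.single_left_inj one_ne_zero]

theorem isHomogeneous_linForm {R : Type*} [CommRing R] {n : ℕ} (c : Fin n → R) :
    (linForm c).IsHomogeneous 1 := by
  refine IsHomogeneous.sum _ _ _ fun i _ => ?_
  simpa using (isHomogeneous_C (Fin n) (c i)).mul (isHomogeneous_X R i)

theorem isHomogeneous_prod_linForm {R : Type*} [CommRing R] {n : ℕ} {ι : Type*} (s : Finset ι)
    (c : ι → Fin n → R) : (∏ j ∈ s, linForm (c j)).IsHomogeneous s.card := by
  have := IsHomogeneous.prod s (fun j => linForm (c j)) (fun _ => 1)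
    fun j _ => isHomogeneous_linForm (c j)
  simpa using this

theorem linForm_ne_zero {R : Type*} [CommRing R] {n : ℕ} {c : Fin n → R} (hc : c ≠ 0) :
    linForm c ≠ 0 := by
  intro h
  refine hc (funext fun i => ?_)
  rw [← coeff_linForm c i, h, coeff_zero, Pi.zero_apply]

theorem linForm_smul {R : Type*} [CommRing R] {n : ℕ} (r : R) (c : Fin n → R) :
    linForm (r • c) = C r * linForm c := by
  simp [linForm, Finset.mul_sum, mul_assoc]

theorem irreducible_linForm {κ : Type*} [Field κ] {n : ℕ} {c : Fin n → κ} (hc : c ≠ 0) :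
    Irreducible (linForm c) := by
  refine irreducible_of_totalDegree_eq_one
    ((isHomogeneous_linForm c).totalDegree (linForm_ne_zero hc)) fun x hx => ?_
  obtain ⟨i, hi⟩ := Function.ne_iff.1 hc
  have := hx (Finsupp.single i 1)
  rw [coeff_linForm] at this
  exact isUnit_iff_ne_zero.2 (ne_zero_of_dvd_ne_zero hi this)

theorem exists_eq_smul_of_linForm_dvd_prod {κ : Type*} [Field κ] {n : ℕ} {ι : Type*}
    {s : Finset ι} {c : Fin n → κ} (hc : c ≠ 0) {M : ι → Fin n → κ} (hM : ∀ j ∈ s, M j ≠ 0)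
    (h : linForm c ∣ ∏ j ∈ s, linForm (M j)) : ∃ j ∈ s, ∃ r : κ, r ≠ 0 ∧ M j = r • c := by
  obtain ⟨j, hj, h1⟩ := ((irreducible_linForm hc).prime.dvd_finsetProd_iff _).1 h
  obtain ⟨v, hv⟩ := ((irreducible_linForm hc).associated_of_dvd (irreducible_linForm (hM j hj)) h1)
  obtain ⟨r, hr, hr'⟩ := isUnit_iff_eq_C_of_isReduced.1 v.isUnit
  refine ⟨j, hj, r, hr.ne_zero, funext fun i => ?_⟩
  rw [← coeff_linForm (M j), ← hv, hr', mul_comm, coeff_C_mul, coeff_linForm]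
  rfl

theorem exists_int_forall_sum_ne_zero {n : ℕ} {ι : Type*} (s : Finset ι) (c : ι → Fin n → ℂ)
    (hc : ∀ j ∈ s, c j ≠ 0) : ∃ z : Fin n → ℤ, ∀ j ∈ s, ∑ i, c j i * (z i : ℂ) ≠ 0 := by
  by_contra! h
  have h0 : ∏ j ∈ s, linForm (c j) = 0 := by
    refine funext_set (fun _ => Set.range ((↑) : ℤ → ℂ))
      (fun _ => Set.infinite_range_of_injective Int.cast_injective) fun x hx => ?_
    choose z hz using fun i => hx i trivial
    obtain ⟨j, hj, hj'⟩ := h z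
    rw [map_zero, map_prod, Finset.prod_eq_zero hj]
    rw [eval_linForm, ← hj']
    exact Finset.sum_congr rfl fun i _ => by rw [hz]
  obtain ⟨j, hj, hj'⟩ := Finset.prod_eq_zero_iff.1 h0
  exact linForm_ne_zero (hc j hj) hj'

/-! ### Consequences of the non-vanishing of the discriminant -/

theorem linearIndependent_of_discProd_ne_zero {n d : ℕ} {L : Fin d → Fin n → ℂ}
    (hΔ : discProd L ≠ 0) {g : Fin n → Fin d} (hg : StrictMono g) :
    (Matrix.det (Matrix.of fun i j => L (g i) j) : ℂ) ≠ 0 := by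
  have hfin : ({g : Fin n → Fin d | StrictMono g}).Finite := Set.toFinite _
  rw [discProd, finprod_mem_eq_finite_toFinset_prod _ hfin, Finset.prod_ne_zero_iff] at hΔ
  exact norm_ne_zero_iff.1 (hΔ g (hfin.mem_toFinset.2 hg))

theorem exists_strictMono_mem_range {n d : ℕ} (hn : 2 ≤ n) (hd : n ≤ d) (i j : Fin d) :
    ∃ g : Fin n → Fin d, StrictMono g ∧ i ∈ Set.range g ∧ j ∈ Set.range g := by
  classical
  obtain ⟨s, hs, hs'⟩ := Finset.exists_superset_card_eq (s := {i, j}) (n := n)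
    ((Finset.card_le_two).trans hn) (by simpa using hd)
  refine ⟨s.orderEmbOfFin hs', (s.orderEmbOfFin hs').strictMono, ?_, ?_⟩ <;>
  · rw [Finset.range_orderEmbOfFin]
    exact hs (by simp)

theorem eq_zero_of_smul_add_smul_eq_zero {n d : ℕ} (hn : 2 ≤ n) (hd : n ≤ d)
    {L : Fin d → Fin n → ℂ} (hΔ : discProd L ≠ 0) {i j : Fin d} (hij : i ≠ j) {s t : ℂ}
    (h : s • L i + t • L j = 0) : s = 0 := by
  obtain ⟨g, hg, ⟨i', rfl⟩, ⟨j', rfl⟩⟩ := exists_strictMono_mem_range hn hd i j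
  have h1 := linearIndependent_of_discProd_ne_zero hΔ hg
  have h2 := Matrix.linearIndependent_rows_of_det_ne_zero h1
  have hij' : i' ≠ j' := fun h => hij (congrArg g h)
  have h3 := Fintype.linearIndependent_iff.1 h2 (Pi.single i' s + Pi.single j' t) (by
    simp only [Pi.add_apply, add_smul, Finset.sum_add_distrib]
    rw [Finset.sum_eq_single i' (fun m _ hm => by simp [hm]) (by simp),
      Finset.sum_eq_single j' (fun m _ hm => by simp [hm]) (by simp)]
    rw [Pi.single_eq_same, Pi.single_eq_same]
    exact h) i'
  simpa [hij'] using h3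

/-- The value of a linear form with complex coefficients at an integral point. -/
def formVal {R : Type*} [CommRing R] {n : ℕ} (c : Fin n → R) (z : Fin n → ℤ) : R :=
  ∑ i, c i * (z i : R)

theorem formVal_smul {R : Type*} [CommRing R] {n : ℕ} (r : R) (c : Fin n → R) (z : Fin n → ℤ) :
    formVal (r • c) z = r * formVal c z := by
  simp [formVal, Finset.mul_sum, mul_assoc]

theorem formVal_add {R : Type*} [CommRing R] {n : ℕ} (c : Fin n → R) (y z : Fin n → ℤ) :
    formVal c (y + z) = formVal c y + formVal c z := by
  simp [formVal, mul_add, Finset.sum_add_distrib]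

theorem formVal_zsmul {R : Type*} [CommRing R] {n : ℕ} (c : Fin n → R) (t : ℤ) (z : Fin n → ℤ) :
    formVal c (t • z) = t * formVal c z := by
  simp only [formVal, Finset.mul_sum, Pi.smul_apply, smul_eq_mul, Int.cast_mul]
  exact Finset.sum_congr rfl fun i _ => by ring

theorem map_formVal {R S : Type*} [CommRing R] [CommRing S] {n : ℕ} (φ : R →+* S)
    (c : Fin n → R) (z : Fin n → ℤ) : φ (formVal c z) = formVal (fun i => φ (c i)) z := by
  simp [formVal]

theorem cast_eval_eq_prod_formVal {R : Type*} [CommRing R] {n : ℕ} {ι : Type*} {s : Finset ι}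
    {F : MvPolynomial (Fin n) ℤ} {M : ι → Fin n → R}
    (hF : F.map (Int.castRingHom R) = ∏ j ∈ s, linForm (M j)) (z : Fin n → ℤ) :
    ((MvPolynomial.eval z F : ℤ) : R) = ∏ j ∈ s, formVal (M j) z := by
  have h1 : MvPolynomial.eval (fun i => (z i : R)) (F.map (Int.castRingHom R)) =
      ((MvPolynomial.eval z F : ℤ) : R) := by
    have := MvPolynomial.map_eval (Int.castRingHom R) z F
    simpa [Function.comp_def] using this.symm
  rw [← h1, hF, map_prod]
  exact Finset.prod_congr rfl fun j _ => eval_linForm _ _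

/-- Auxiliary integral points: at `b` no linear factor vanishes, and `a` separates the ratios. -/
theorem exists_separating_points {n d : ℕ} (hn : 2 ≤ n) (hd : n < d)
    {L : Fin d → Fin n → ℂ} (hΔ : discProd L ≠ 0) :
    ∃ a b : Fin n → ℤ, (∀ j, formVal (L j) b ≠ 0) ∧
      ∀ i j, i ≠ j → formVal (L i) a * formVal (L j) b ≠ formVal (L j) a * formVal (L i) b := by
  classical
  obtain ⟨b, hb⟩ := exists_int_forall_sum_ne_zero Finset.univ L (fun i _ h0 => by
    obtain ⟨j, hj⟩ : ∃ j : Fin d, i ≠ j := by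
      have : Nontrivial (Fin d) := Fin.nontrivial_iff_two_le.2 (by omega)
      obtain ⟨j, hj⟩ := exists_ne i
      exact ⟨j, hj.symm⟩
    have := eq_zero_of_smul_add_smul_eq_zero hn hd.le hΔ hj (s := 1) (t := 0) (by simp [h0])
    exact one_ne_zero this)
  have hb' : ∀ j, formVal (L j) b ≠ 0 := fun j => hb j (Finset.mem_univ j)
  obtain ⟨a, ha⟩ := exists_int_forall_sum_ne_zero
    (Finset.univ.filter fun x : Fin d × Fin d => x.1 ≠ x.2)
    (fun x => formVal (L x.2) b • L x.1 + (-formVal (L x.1) b) • L x.2) (fun x hx h0 => by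
      exact hb' _ (eq_zero_of_smul_add_smul_eq_zero hn hd.le hΔ (Finset.mem_filter.1 hx).2 h0))
  refine ⟨a, b, hb', fun i j hij h => ha (i, j) (by simpa using hij) ?_⟩
  simp only [Pi.add_apply, Pi.smul_apply, smul_eq_mul, add_mul, Finset.sum_add_distrib, mul_assoc,
    ← Finset.mul_sum]
  change formVal (L j) b * formVal (L i) a + -formVal (L i) b * formVal (L j) a = 0
  linear_combination h

/-! ### Galois action on the linear factors -/

theorem map_map_intCast {R S : Type*} [CommRing R] [CommRing S] {σ : Type*} (φ : R →+* S)
    (F : MvPolynomial σ ℤ) :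
    (F.map (Int.castRingHom R)).map φ = F.map (Int.castRingHom S) := by
  rw [MvPolynomial.map_map, RingHom.ext_int (φ.comp (Int.castRingHom R)) (Int.castRingHom S)]

theorem exists_map_eq_of_fixed {Ω : Type*} [Field Ω] [Algebra ℚ Ω] [IsGalois ℚ Ω] {n : ℕ}
    (P : MvPolynomial (Fin n) Ω) (hP : ∀ σ : Gal(Ω/ℚ), P.map (σ : Ω →+* Ω) = P) :
    ∃ P₀ : MvPolynomial (Fin n) ℚ, P₀.map (algebraMap ℚ Ω) = P := by
  have h : P ∈ Set.range (MvPolynomial.map (σ := Fin n) (algebraMap ℚ Ω)) := by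
    rw [MvPolynomial.mem_range_map_iff_coeffs_subset]
    intro x hx
    obtain ⟨m, hm, rfl⟩ := MvPolynomial.mem_coeffs_iff.1 hx
    refine (InfiniteGalois.mem_range_algebraMap_iff_fixed _).2 fun σ => ?_
    conv_rhs => rw [← hP σ, coeff_map]
    rfl
  exact h

theorem eq_univ_of_prod_fixed {Ω : Type*} [Field Ω] [Algebra ℚ Ω] [IsGalois ℚ Ω] {n d : ℕ}
    {F : MvPolynomial (Fin n) ℤ} (hirr : Irreducible (F.map (Int.castRingHom ℚ)))
    (M : Fin d → Fin n → Ω) (hM : ∀ j, M j ≠ 0) (c₀ : ℤ)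
    (hF : F.map (Int.castRingHom Ω) = C (c₀ : Ω) * ∏ j, linForm (M j)) (S : Finset (Fin d))
    (hne : S.Nonempty)
    (hS : ∀ σ : Gal(Ω/ℚ), (∏ j ∈ S, linForm (M j)).map (σ : Ω →+* Ω) = ∏ j ∈ S, linForm (M j)) :
    S = Finset.univ := by
  classical
  have hne0 : ∀ s : Finset (Fin d), ∏ j ∈ s, linForm (M j) ≠ 0 := fun s =>
    Finset.prod_ne_zero_iff.2 fun j _ => linForm_ne_zero (hM j)
  have hmapF : ∀ σ : Gal(Ω/ℚ), (F.map (Int.castRingHom Ω)).map (σ : Ω →+* Ω) =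
      F.map (Int.castRingHom Ω) := fun σ => map_map_intCast _ F
  have hF0 : F.map (Int.castRingHom Ω) ≠ 0 := by
    intro h
    refine hirr.ne_zero (MvPolynomial.map_injective _ (algebraMap ℚ Ω).injective ?_)
    rw [map_map_intCast, map_zero, h]
  have hc₀ : C (c₀ : Ω) ≠ (0 : MvPolynomial (Fin n) Ω) := by
    intro h
    rw [h, zero_mul] at hF
    exact hF0 hF
  have hSc : ∀ σ : Gal(Ω/ℚ), (∏ j ∈ Sᶜ, linForm (M j)).map (σ : Ω →+* Ω) =
      ∏ j ∈ Sᶜ, linForm (M j) := by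
    intro σ
    have h1 := hmapF σ
    rw [hF, ← Finset.prod_mul_prod_compl S, map_mul, map_mul, hS σ, MvPolynomial.map_C] at h1
    have h2 : (σ : Ω →+* Ω) (c₀ : Ω) = c₀ := map_intCast _ _
    rw [h2] at h1
    exact mul_left_cancel₀ (hne0 S) (mul_left_cancel₀ hc₀ h1)
  obtain ⟨P, hP⟩ := exists_map_eq_of_fixed _ hS
  obtain ⟨P', hP'⟩ := exists_map_eq_of_fixed _ hSc
  have hfac : F.map (Int.castRingHom ℚ) = C (c₀ : ℚ) * P * P' := by
    refine MvPolynomial.map_injective _ (algebraMap ℚ Ω).injective ?_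
    rw [map_mul, map_mul, hP, hP', map_map_intCast, mul_assoc, Finset.prod_mul_prod_compl,
      MvPolynomial.map_C, map_intCast, ← hF]
  have hdeg : ∀ (s : Finset (Fin d)) (Q : MvPolynomial (Fin n) ℚ),
      Q.map (algebraMap ℚ Ω) = ∏ j ∈ s, linForm (M j) → IsUnit Q → s = ∅ := by
    intro s Q hQ hu
    have h1 : IsUnit (∏ j ∈ s, linForm (M j)) := hQ ▸ hu.map (MvPolynomial.map (algebraMap ℚ Ω))
    have h2 := (MvPolynomial.isUnit_iff_totalDegree_of_isReduced.1 h1).2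
    rw [(isHomogeneous_prod_linForm s M).totalDegree (hne0 s)] at h2
    exact Finset.card_eq_zero.1 h2
  rcases hirr.isUnit_or_isUnit hfac with h | h
  · exact absurd (hdeg S P hP (isUnit_of_mul_isUnit_right h)) hne.ne_empty
  · exact Finset.compl_eq_empty_iff S |>.1 (hdeg Sᶜ P' hP' h)

theorem forall_of_galois_stable {Ω : Type*} [Field Ω] [Algebra ℚ Ω] [IsGalois ℚ Ω] {n d : ℕ}
    {F : MvPolynomial (Fin n) ℤ} (hirr : Irreducible (F.map (Int.castRingHom ℚ)))
    (M : Fin d → Fin n → Ω) (hMinj : Function.Injective M) (b : Fin n → ℤ)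
    (hb : ∀ j, formVal (M j) b = 1) (c₀ : ℤ)
    (hF : F.map (Int.castRingHom Ω) = C (c₀ : Ω) * ∏ j, linForm (M j))
    (Q : (Fin n → Ω) → Prop) (hQ : ∀ (σ : Gal(Ω/ℚ)) c, Q c → Q fun i => σ (c i)) {j₀ : Fin d}
    (h₀ : Q (M j₀)) (j : Fin d) : Q (M j) := by
  classical
  have hM : ∀ j, M j ≠ 0 := by
    intro j h
    have := hb j
    simp [formVal, h] at this
  have hF0 : F.map (Int.castRingHom Ω) ≠ 0 := by
    intro h
    refine hirr.ne_zero (MvPolynomial.map_injective _ (algebraMap ℚ Ω).injective ?_)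
    rw [map_map_intCast, map_zero, h]
  have hc₀ : (c₀ : Ω) ≠ 0 := by
    intro h
    rw [h, C_0, zero_mul] at hF
    exact hF0 hF
  have hmapF : ∀ σ : Gal(Ω/ℚ), ∏ j, linForm (fun i => σ (M j i)) = ∏ j, linForm (M j) := by
    intro σ
    have h1 : (F.map (Int.castRingHom Ω)).map (σ : Ω →+* Ω) = F.map (Int.castRingHom Ω) :=
      map_map_intCast _ F
    rw [hF, map_mul, MvPolynomial.map_C, map_intCast, map_prod] at h1
    have h2 := mul_left_cancel₀ (fun h => hc₀ (C_injective _ _ (h.trans C_0.symm))) h1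
    rw [← h2]
    exact Finset.prod_congr rfl fun j _ => by rw [map_linForm]; rfl
  have hσb : ∀ (σ : Gal(Ω/ℚ)) j, formVal (fun i => σ (M j i)) b = 1 := by
    intro σ j
    have := map_formVal (σ : Ω →+* Ω) (M j) b
    rw [hb, map_one] at this
    exact this.symm
  have hperm : ∀ (σ : Gal(Ω/ℚ)) j, ∃ j', M j' = fun i => σ (M j i) := by
    intro σ j
    have hne : (fun i => σ (M j i)) ≠ 0 := by
      intro h
      have h1 := hσb σ j
      rw [h] at h1
      simp [formVal] at h1
    obtain ⟨j', -, r, hr, hj'⟩ := exists_eq_smul_of_linForm_dvd_prod (s := Finset.univ) hne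
      (fun j _ => hM j) (by
        rw [← hmapF σ]
        exact Finset.dvd_prod_of_mem (fun j => linForm (fun i => σ (M j i))) (Finset.mem_univ j))
    refine ⟨j', ?_⟩
    have h1 := hb j'
    rw [hj', formVal_smul, hσb, mul_one] at h1
    rw [hj', h1, one_smul]
  choose π hπ using hperm
  have hπinj : ∀ σ, Function.Injective (π σ) := by
    intro σ j j' h
    refine hMinj (funext fun i => σ.injective ?_)
    have h1 := congrFun (hπ σ j) i
    rw [h, hπ σ j'] at h1
    exact h1.symm
  have huniv := eq_univ_of_prod_fixed hirr M hM c₀ hF (Finset.univ.filter fun j => Q (M j))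
    ⟨j₀, by simpa using h₀⟩ (by
      intro σ
      have hmaps : ∀ j ∈ Finset.univ.filter (fun j => Q (M j)),
          π σ j ∈ Finset.univ.filter (fun j => Q (M j)) := by
        intro j hj
        have hj' := (Finset.mem_filter.1 hj).2
        refine Finset.mem_filter.2 ⟨Finset.mem_univ _, ?_⟩
        rw [hπ]
        exact hQ σ _ hj'
      rw [map_prod]
      refine Finset.prod_nbij (π σ) hmaps (hπinj σ).injOn
        (Finset.surjOn_of_injOn_of_card_le _ hmaps (hπinj σ).injOn le_rfl) fun j _ => ?_
      rw [map_linForm, hπ]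
      rfl)
  have := Finset.mem_univ j
  rw [← huniv] at this
  exact (Finset.mem_filter.1 this).2

theorem isIntegral_formVal {n : ℕ} {c : Fin n → ℂ} (hc : ∀ i, IsIntegral ℤ (c i))
    (z : Fin n → ℤ) : IsIntegral ℤ (formVal c z) :=
  IsIntegral.sum _ fun i _ => (hc i).mul (isIntegral_algebraMap (R := ℤ) (x := z i))

/-- The algebraic integer `F(b) Lⱼ(a) / Lⱼ(b)`. -/
def ratioVal {n d : ℕ} (L : Fin d → Fin n → ℂ) (a b : Fin n → ℤ) (j : Fin d) : ℂ :=
  formVal (L j) a * ∏ i ∈ Finset.univ.erase j, formVal (L i) b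

theorem isIntegral_ratioVal {n d : ℕ} {L : Fin d → Fin n → ℂ}
    (hL : ∀ j i, IsIntegral ℤ (L j i)) (a b : Fin n → ℤ) (j : Fin d) :
    IsIntegral ℤ (ratioVal L a b j) :=
  (isIntegral_formVal (hL j) a).mul (IsIntegral.prod _ fun i _ => isIntegral_formVal (hL i) b)

theorem forall_of_galois_stable_normalized {n d : ℕ} {F : MvPolynomial (Fin n) ℤ}
    {L : Fin d → Fin n → ℂ} (hF : IsDecomp F L)
    (hirr : Irreducible (F.map (Int.castRingHom ℚ))) {a b : Fin n → ℤ}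
    (hb : ∀ j, formVal (L j) b ≠ 0)
    (ha : ∀ i j, i ≠ j → formVal (L i) a * formVal (L j) b ≠ formVal (L j) a * formVal (L i) b)
    (Q : (Fin n → algebraicClosure ℚ ℂ) → Prop)
    (hQ : ∀ (σ : Gal(algebraicClosure ℚ ℂ/ℚ)) c, Q c → Q fun i => σ (c i))
    {M : Fin d → Fin n → algebraicClosure ℚ ℂ}
    (hM : ∀ j i, (M j i : ℂ) = (formVal (L j) b)⁻¹ * L j i) {j₀ : Fin d}
    (h₀ : Q (M j₀)) (j : Fin d) : Q (M j) := by
  have hval : ∀ j z, ((formVal (M j) z : algebraicClosure ℚ ℂ) : ℂ) =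
      (formVal (L j) b)⁻¹ * formVal (L j) z := by
    intro j z
    rw [← formVal_smul]
    have := map_formVal (algebraMap (algebraicClosure ℚ ℂ) ℂ) (M j) z
    refine this.trans ?_
    congr 1
    exact funext fun i => hM j i
  have hGal : IsGalois ℚ (algebraicClosure ℚ ℂ) := by
    have : IsAlgClosure ℚ (algebraicClosure ℚ ℂ) := algebraicClosure.isAlgClosure ℚ ℂ
    have := IsAlgClosure.normal ℚ (algebraicClosure ℚ ℂ)
    exact ⟨⟩
  refine forall_of_galois_stable hirr M ?_ b ?_ (MvPolynomial.eval b F) ?_ Q hQ h₀ j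
  · intro i j h
    by_contra hij
    have h1 := hval i a
    rw [h, hval j a] at h1
    refine ha i j hij ?_
    have := hb i
    have := hb j
    field_simp at h1
    linear_combination -h1
  · intro j
    refine Subtype.ext ?_
    rw [hval, inv_mul_cancel₀ (hb j)]
    rfl
  · refine MvPolynomial.map_injective _ (algebraMap (algebraicClosure ℚ ℂ) ℂ).injective ?_
    rw [map_map_intCast, hF.2, map_mul, map_prod, MvPolynomial.map_C, map_intCast,
      cast_eval_eq_prod_formVal hF.2, map_prod, ← Finset.prod_mul_distrib]
    refine Finset.prod_congr rfl fun j _ => ?_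
    rw [map_linForm, ← linForm_smul]
    congr 1
    refine funext fun i => ?_
    have : algebraMap (algebraicClosure ℚ ℂ) ℂ (M j i) = _ := hM j i
    rw [Pi.smul_apply, this, smul_eq_mul, mul_inv_cancel_left₀ (hb j)]

theorem exists_normalized_factors {n d : ℕ} {L : Fin d → Fin n → ℂ}
    (hL : ∀ j i, IsIntegral ℤ (L j i)) (b : Fin n → ℤ) :
    ∃ M : Fin d → Fin n → algebraicClosure ℚ ℂ,
      ∀ j i, (M j i : ℂ) = (formVal (L j) b)⁻¹ * L j i := by
  have halg : ∀ {z : ℂ}, IsIntegral ℤ z → IsAlgebraic ℚ z := fun hz =>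
    (hz.tower_top (A := ℚ)).isAlgebraic
  refine ⟨fun j i => ⟨(formVal (L j) b)⁻¹ * L j i, ?_⟩, fun _ _ => rfl⟩
  exact mem_algebraicClosure_iff'.2 ((halg (isIntegral_formVal (hL j) b)).inv.mul (halg (hL j i))).isIntegral

theorem eval_ne_zero_of_irreducible {n d : ℕ} (hd : n ≤ d) {F : MvPolynomial (Fin n) ℤ}
    {L : Fin d → Fin n → ℂ} (hF : IsDecomp F L)
    (hirr : Irreducible (F.map (Int.castRingHom ℚ))) (hΔ : discProd L ≠ 0) {a b : Fin n → ℤ}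
    (hb : ∀ j, formVal (L j) b ≠ 0)
    (ha : ∀ i j, i ≠ j → formVal (L i) a * formVal (L j) b ≠ formVal (L j) a * formVal (L i) b)
    {v : Fin n → ℤ} (hv : v ≠ 0) : MvPolynomial.eval v F ≠ 0 := by
  intro h0
  have h1 := cast_eval_eq_prod_formVal hF.2 v
  rw [h0, Int.cast_zero] at h1
  obtain ⟨j₀, -, hj₀⟩ := Finset.prod_eq_zero_iff.1 h1.symm
  obtain ⟨M, hM⟩ := exists_normalized_factors hF.1 b
  have hval : ∀ j z, ((formVal (M j) z : algebraicClosure ℚ ℂ) : ℂ) =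
      (formVal (L j) b)⁻¹ * formVal (L j) z := by
    intro j z
    rw [← formVal_smul]
    refine (map_formVal (algebraMap (algebraicClosure ℚ ℂ) ℂ) (M j) z).trans ?_
    congr 1
    exact funext fun i => hM j i
  have hall : ∀ j, formVal (L j) v = 0 := by
    intro j
    have h2 := forall_of_galois_stable_normalized hF hirr hb ha (fun c => formVal c v = 0)
      (fun σ c hc => by
        have := map_formVal (σ : algebraicClosure ℚ ℂ →+* algebraicClosure ℚ ℂ) c v
        rw [hc, map_zero] at this
        exact this.symm) hM (j₀ := j₀)
      (Subtype.ext (by rw [hval, hj₀, mul_zero]; rfl)) j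
    have h3 := hval j v
    rw [h2] at h3
    exact (mul_eq_zero.1 h3.symm).resolve_left (inv_ne_zero (hb j))
  have hdet := linearIndependent_of_discProd_ne_zero hΔ
    (g := Fin.castLE hd) (Fin.strictMono_castLE hd)
  have h4 := Matrix.eq_zero_of_mulVec_eq_zero hdet (v := fun i => (v i : ℂ))
    (funext fun i => hall (Fin.castLE hd i))
  refine hv (funext fun i => ?_)
  have h5 : (v i : ℂ) = 0 := congrFun h4 i
  exact_mod_cast h5

theorem aeval_minpoly_ratioVal {n d : ℕ} {F : MvPolynomial (Fin n) ℤ}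
    {L : Fin d → Fin n → ℂ} (hF : IsDecomp F L)
    (hirr : Irreducible (F.map (Int.castRingHom ℚ))) {a b : Fin n → ℤ}
    (hb : ∀ j, formVal (L j) b ≠ 0)
    (ha : ∀ i j, i ≠ j → formVal (L i) a * formVal (L j) b ≠ formVal (L j) a * formVal (L i) b)
    (j₀ j : Fin d) :
    Polynomial.aeval (ratioVal L a b j) (minpoly ℤ (ratioVal L a b j₀)) = 0 := by
  obtain ⟨M, hM⟩ := exists_normalized_factors hF.1 b
  have hval : ∀ j, (((MvPolynomial.eval b F : ℤ) * formVal (M j) a : algebraicClosure ℚ ℂ) : ℂ) =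
      ratioVal L a b j := by
    intro j
    have h1 : ((formVal (M j) a : algebraicClosure ℚ ℂ) : ℂ) =
        (formVal (L j) b)⁻¹ * formVal (L j) a := by
      rw [← formVal_smul]
      refine (map_formVal (algebraMap (algebraicClosure ℚ ℂ) ℂ) (M j) a).trans ?_
      congr 1
      exact funext fun i => hM j i
    push_cast
    rw [h1, cast_eval_eq_prod_formVal hF.2 b, ratioVal, ← Finset.mul_prod_erase _ _ (Finset.mem_univ j)]
    have := hb j
    field_simp
  set g := minpoly ℤ (ratioVal L a b j₀)
  have hcoe : ∀ x : algebraicClosure ℚ ℂ,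
      ((Polynomial.aeval x g : algebraicClosure ℚ ℂ) : ℂ) = Polynomial.aeval (x : ℂ) g := fun x =>
    (Polynomial.aeval_algebraMap_apply ℂ x g).symm
  have h2 := forall_of_galois_stable_normalized hF hirr hb ha
    (fun c => Polynomial.aeval ((MvPolynomial.eval b F : ℤ) * formVal c a : algebraicClosure ℚ ℂ) g = 0)
    (fun σ c hc => by
      have h3 := congrArg σ hc
      rw [map_zero] at h3
      rw [← h3]
      have h4 := map_formVal (σ : algebraicClosure ℚ ℂ →+* algebraicClosure ℚ ℂ) c a
      have h5 : (σ (formVal c a) : algebraicClosure ℚ ℂ) = formVal (fun i => σ (c i)) a := h4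
      rw [← h5]
      have h6 : ((MvPolynomial.eval b F : ℤ) : algebraicClosure ℚ ℂ) * σ (formVal c a) =
          σ ((MvPolynomial.eval b F : ℤ) * formVal c a) := by rw [map_mul, map_intCast]
      rw [h6]
      exact Polynomial.aeval_algHom_apply (σ.toAlgHom.restrictScalars ℤ) _ g) hM (j₀ := j₀)
    (Subtype.ext (by
      rw [hcoe, hval]
      exact minpoly.aeval ℤ _)) j
  have h3 := hcoe ((MvPolynomial.eval b F : ℤ) * formVal (M j) a)
  rw [h2, hval] at h3
  exact h3.symm

/-! ### Roots of a polynomial modulo integers and ideals of bounded norm -/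

theorem card_quotient_le_of_conductor {O : Type*} [CommRing O] {t : O} {m : ℤ}
    (hm : ∀ x : O, ∃ P : Polynomial ℤ, (m : O) * x = Polynomial.aeval t P) {u : ℕ} {r : ℤ}
    (hu : 0 < u) (hum : IsCoprime (u : ℤ) m) :
    Nat.card (O ⧸ Ideal.span {(u : O), t - (r : O)}) ≤ u := by
  set I := Ideal.span {(u : O), t - (r : O)}
  have : NeZero u := ⟨hu.ne'⟩
  have huI : (u : O) ∈ I := Ideal.subset_span (by simp)
  have htI : t - (r : O) ∈ I := Ideal.subset_span (by simp)
  have hz : ∀ z : ℤ, ((((z : ZMod u).val : ℕ) : O) - (z : O)) ∈ I := by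
    intro z
    have h1 : (((z : ZMod u).val : ℕ) : ZMod u) = z := by simp
    have h2 : (u : ℤ) ∣ ((z : ZMod u).val : ℤ) - z := by
      rw [← ZMod.intCast_zmod_eq_zero_iff_dvd]
      push_cast
      rw [h1, sub_self]
    obtain ⟨e, he⟩ := h2
    have h3 : ((((z : ZMod u).val : ℕ) : O) - (z : O)) = (u : O) * (e : O) := by
      exact_mod_cast congrArg (Int.cast : ℤ → O) he
    rw [h3]
    exact I.mul_mem_right _ huI
  have hsurj : Function.Surjective fun z : ZMod u => Ideal.Quotient.mk I ((z.val : ℕ) : O) := by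
    intro y
    obtain ⟨x, rfl⟩ := Ideal.Quotient.mk_surjective y
    obtain ⟨P, hP⟩ := hm x
    obtain ⟨e, s, hes⟩ := hum
    refine ⟨((s * P.eval r : ℤ) : ZMod u), Ideal.Quotient.eq.2 ?_⟩
    have h1 : Polynomial.aeval t P - ((P.eval r : ℤ) : O) ∈ I := by
      have h2 : t - (r : O) ∣ Polynomial.aeval t P - Polynomial.aeval (r : O) P := by
        simpa [Polynomial.aeval_def, Polynomial.eval₂_eq_eval_map] using
          Polynomial.sub_dvd_eval_sub t (r : O) (P.map (algebraMap ℤ O))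
      have h3 : Polynomial.aeval (r : O) P = ((P.eval r : ℤ) : O) := by
        simpa using Polynomial.aeval_algebraMap_apply O r P
      rw [← h3]
      exact I.mem_of_dvd h2 htI
    have h4 : (e : O) * u + s * m = 1 := by exact_mod_cast congrArg (Int.cast : ℤ → O) hes
    have h5 : (((((s * P.eval r : ℤ) : ZMod u)).val : ℕ) : O) - x =
        ((((((s * P.eval r : ℤ) : ZMod u)).val : ℕ) : O) - ((s * P.eval r : ℤ) : O)) -
        ((s : O) * (Polynomial.aeval t P - ((P.eval r : ℤ) : O)) + (u : O) * (e * x)) := by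
      rw [← hP]
      push_cast
      linear_combination x * h4
    rw [h5]
    exact I.sub_mem (hz _) (I.add_mem (I.mul_mem_left _ h1) (I.mul_mem_right _ huI))
  have := Nat.card_le_card_of_surjective _ hsurj
  rwa [Nat.card_zmod] at this

theorem dvd_of_intCast_mem_span_of_conductor {O : Type*} [CommRing O] {t : O} {m : ℤ}
    (hm : ∀ x : O, ∃ P : Polynomial ℤ, (m : O) * x = Polynomial.aeval t P) {g : Polynomial ℤ}
    (hg : ∀ P : Polynomial ℤ, Polynomial.aeval t P = 0 → g ∣ P) {u : ℕ} {r z : ℤ}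
    (hum : IsCoprime (u : ℤ) m) (hr : (u : ℤ) ∣ g.eval r)
    (hz : (z : O) ∈ Ideal.span {(u : O), t - (r : O)}) : (u : ℤ) ∣ z := by
  obtain ⟨x, y, hxy⟩ := Ideal.mem_span_pair.1 hz
  obtain ⟨P, hP⟩ := hm x
  obtain ⟨Q, hQ⟩ := hm y
  have h1 : Polynomial.aeval t (Polynomial.C (m * z) - Polynomial.C (u : ℤ) * P -
      (Polynomial.X - Polynomial.C r) * Q) = 0 := by
    simp only [map_sub, map_mul, Polynomial.aeval_C, Polynomial.aeval_X, ← hP, ← hQ]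
    simp only [algebraMap_int_eq, eq_intCast]
    push_cast
    linear_combination (-(m : O)) * hxy
  obtain ⟨R, hR⟩ := hg _ h1
  have h2 := congrArg (Polynomial.eval r) hR
  simp only [Polynomial.eval_sub, Polynomial.eval_mul, Polynomial.eval_C, Polynomial.eval_X,
    sub_self, zero_mul, sub_zero] at h2
  have h3 : (u : ℤ) ∣ m * z := by
    have h4 : m * z = u * P.eval r + g.eval r * R.eval r := by linear_combination h2
    rw [h4]
    exact dvd_add (dvd_mul_right _ _) (hr.mul_right _)
  exact hum.dvd_of_dvd_mul_left h3

open NumberField in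
theorem exists_card_ideal_le (K : Type*) [Field K] [NumberField K] :
    ∃ C : ℕ, ∀ U : ℕ, 1 ≤ U →
      Nat.card {I : Ideal (𝓞 K) // Ideal.absNorm I ≤ U} ≤ C * U := by
  have h := NumberField.Ideal.tendsto_norm_le_div_atTop K
  set l := (2 ^ InfinitePlace.nrRealPlaces K * (2 * Real.pi) ^ InfinitePlace.nrComplexPlaces K *
    Units.regulator K * classNumber K) / (Units.torsionOrder K * Real.sqrt |discr K|)
  obtain ⟨s₀, hs₀⟩ := eventually_atTop.1 (h.eventually_lt_const (lt_add_one l))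
  have hmono : ∀ U V : ℕ, U ≤ V → Nat.card {I : Ideal (𝓞 K) // Ideal.absNorm I ≤ U} ≤
      Nat.card {I : Ideal (𝓞 K) // Ideal.absNorm I ≤ V} := by
    intro U V hUV
    exact Nat.card_mono (Ideal.finite_setOfPred_absNorm_le V) fun I hI => le_trans hI hUV
  refine ⟨max ⌈l + 1⌉₊ (Nat.card {I : Ideal (𝓞 K) // Ideal.absNorm I ≤ ⌈s₀⌉₊}), fun U hU => ?_⟩
  by_cases hUs : s₀ ≤ U
  · refine le_trans ?_ (Nat.mul_le_mul_right U (le_max_left _ _))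
    have h1 := hs₀ U hUs
    have hU' : (0 : ℝ) < U := by exact_mod_cast hU
    rw [div_lt_iff₀ hU'] at h1
    have h2 : (Nat.card {I : Ideal (𝓞 K) // (Ideal.absNorm I : ℝ) ≤ (U : ℝ)} : ℝ) ≤
        (⌈l + 1⌉₊ * U : ℕ) := by
      push_cast
      exact h1.le.trans (mul_le_mul_of_nonneg_right (Nat.le_ceil _) hU'.le)
    simp only [Nat.cast_le] at h2
    exact h2
  · refine le_trans ?_ (Nat.mul_le_mul_right U (le_max_right _ _))
    refine (hmono U ⌈s₀⌉₊ ?_).trans (Nat.le_mul_of_pos_right _ hU)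
    exact_mod_cast (not_le.1 hUs).le.trans (Nat.le_ceil s₀)

open NumberField in
theorem exists_card_root_pairs_le_of_powerBasis {K : Type*} [Field K] [NumberField K]
    (B : PowerBasis ℚ K) (hBint : IsIntegral ℤ B.gen) :
    ∃ N C : ℕ, 0 < N ∧ ∀ U : ℕ, 1 ≤ U → ∀ T : Finset (ℕ × ℕ),
      (∀ x ∈ T, 0 < x.1 ∧ x.1 ≤ U ∧ x.2 < x.1 ∧ x.1.Coprime N ∧
        (x.1 : ℤ) ∣ (minpoly ℤ B.gen).eval (x.2 : ℤ)) → T.card ≤ C * U := by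
  let t : 𝓞 K := ⟨B.gen, hBint⟩
  have htθ : minpoly ℤ t = minpoly ℤ B.gen := by
    rw [show B.gen = algebraMap (𝓞 K) K t from rfl,
      minpoly.algebraMap_eq (RingOfIntegers.coe_injective)]
  obtain ⟨m, hm⟩ : ∃ m : ℤ, algebraMap ℤ ℚ m = Algebra.discr ℚ B.basis :=
    IsIntegrallyClosed.isIntegral_iff.1 (Algebra.discr_isIntegral ℚ fun i => by
      rw [B.basis_eq_pow]
      exact hBint.pow _)
  have hm0 : m ≠ 0 := by
    rintro rfl
    exact Algebra.discr_not_zero_of_basis ℚ B.basis (by rw [← hm, map_zero])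
  have hcond : ∀ x : 𝓞 K, ∃ P : Polynomial ℤ, (m : 𝓞 K) * x = Polynomial.aeval t P := by
    intro x
    have h1 := Algebra.discr_mul_isIntegral_mem_adjoin (R := ℤ) ℚ hBint
      (RingOfIntegers.isIntegral_coe x)
    rw [← hm, Algebra.adjoin_singleton_eq_range_aeval] at h1
    obtain ⟨P, hP⟩ := h1
    refine ⟨P, RingOfIntegers.coe_injective ?_⟩
    have h2 : algebraMap (𝓞 K) K (Polynomial.aeval t P) = Polynomial.aeval B.gen P :=
      (Polynomial.aeval_algebraMap_apply K t P).symm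
    rw [h2]
    refine Eq.trans ?_ hP.symm
    rw [Algebra.smul_def]
    simp
  have hdvd : ∀ P : Polynomial ℤ, Polynomial.aeval t P = 0 → minpoly ℤ B.gen ∣ P := fun P hP =>
    htθ ▸ minpoly.isIntegrallyClosed_dvd (RingOfIntegers.isIntegral t) hP
  obtain ⟨C, hC⟩ := exists_card_ideal_le K
  refine ⟨m.natAbs, C, Int.natAbs_pos.2 hm0, fun U hU T hT => le_trans ?_ (hC U hU)⟩
  have hcop : ∀ x ∈ T, IsCoprime (x.1 : ℤ) m := fun x hx => by
    rw [Int.isCoprime_iff_gcd_eq_one, Int.gcd_def]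
    exact (hT x hx).2.2.2.1
  have hnorm : ∀ x : T, Ideal.absNorm (Ideal.span {((x.1.1 : ℕ) : 𝓞 K), t - ((x.1.2 : ℤ) : 𝓞 K)}) ≤
      U := fun x => by
    rw [Ideal.absNorm_apply, Submodule.cardQuot_apply]
    exact (card_quotient_le_of_conductor hcond (hT _ x.2).1 (hcop _ x.2)).trans (hT _ x.2).2.1
  have hfin : Finite {I : Ideal (𝓞 K) // Ideal.absNorm I ≤ U} :=
    (Ideal.finite_setOfPred_absNorm_le U).to_subtype
  rw [← Fintype.card_coe T, ← Nat.card_eq_fintype_card]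
  refine Nat.card_le_card_of_injective (fun x : T =>
    (⟨_, hnorm x⟩ : {I : Ideal (𝓞 K) // Ideal.absNorm I ≤ U})) fun x y hxy => ?_
  have hI : Ideal.span {((x.1.1 : ℕ) : 𝓞 K), t - ((x.1.2 : ℤ) : 𝓞 K)} =
    Ideal.span {((y.1.1 : ℕ) : 𝓞 K), t - ((y.1.2 : ℤ) : 𝓞 K)} := congrArg Subtype.val hxy
  have hdx : ∀ z : ℤ, (z : 𝓞 K) ∈ Ideal.span {((x.1.1 : ℕ) : 𝓞 K), t - ((x.1.2 : ℤ) : 𝓞 K)} →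
      (x.1.1 : ℤ) ∣ z := fun z =>
    dvd_of_intCast_mem_span_of_conductor hcond hdvd (hcop _ x.2) (hT _ x.2).2.2.2.2
  have hdy : ∀ z : ℤ, (z : 𝓞 K) ∈ Ideal.span {((y.1.1 : ℕ) : 𝓞 K), t - ((y.1.2 : ℤ) : 𝓞 K)} →
      (y.1.1 : ℤ) ∣ z := fun z =>
    dvd_of_intCast_mem_span_of_conductor hcond hdvd (hcop _ y.2) (hT _ y.2).2.2.2.2
  have h1 : (x.1.1 : ℤ) ∣ (y.1.1 : ℤ) := hdx _ (hI ▸ Ideal.subset_span (by simp))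
  have h2 : (y.1.1 : ℤ) ∣ (x.1.1 : ℤ) := hdy _ (hI ▸ Ideal.subset_span (by simp))
  have h3 : x.1.1 = y.1.1 := Nat.dvd_antisymm (Int.natCast_dvd_natCast.1 h1)
    (Int.natCast_dvd_natCast.1 h2)
  have h4 : (x.1.1 : ℤ) ∣ (y.1.2 : ℤ) - x.1.2 := by
    refine hdx _ ?_
    have h5 : (((y.1.2 : ℤ) - (x.1.2 : ℤ) : ℤ) : 𝓞 K) =
        (t - ((x.1.2 : ℤ) : 𝓞 K)) - (t - ((y.1.2 : ℤ) : 𝓞 K)) := by push_cast; ring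
    rw [h5]
    exact Ideal.sub_mem _ (Ideal.subset_span (by simp)) (hI ▸ Ideal.subset_span (by simp))
  have h5 : x.1.2 = y.1.2 := by
    have h6 := (Nat.modEq_iff_dvd.2 h4 : x.1.2 ≡ y.1.2 [MOD x.1.1])
    exact Nat.ModEq.eq_of_lt_of_lt h6 (hT _ x.2).2.2.1 (h3 ▸ (hT _ y.2).2.2.1)
  exact Subtype.ext (Prod.ext h3 h5)

theorem exists_card_root_pairs_le {θ : ℂ} (hθ : IsIntegral ℤ θ) :
    ∃ N C : ℕ, 0 < N ∧ ∀ U : ℕ, 1 ≤ U → ∀ T : Finset (ℕ × ℕ),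
      (∀ x ∈ T, 0 < x.1 ∧ x.1 ≤ U ∧ x.2 < x.1 ∧ x.1.Coprime N ∧
        (x.1 : ℤ) ∣ (minpoly ℤ θ).eval (x.2 : ℤ)) → T.card ≤ C * U := by
  have hθQ : IsIntegral ℚ θ := hθ.tower_top
  have : FiniteDimensional ℚ (IntermediateField.adjoin ℚ ({θ} : Set ℂ)) :=
    IntermediateField.adjoin.finiteDimensional hθQ
  have : NumberField (IntermediateField.adjoin ℚ ({θ} : Set ℂ)) := ⟨⟩
  have hgen : algebraMap (IntermediateField.adjoin ℚ ({θ} : Set ℂ)) ℂ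
      (IntermediateField.adjoin.powerBasis hθQ).gen = θ := by
    rw [IntermediateField.adjoin.powerBasis_gen]
    rfl
  have hθint : IsIntegral ℤ (IntermediateField.adjoin.powerBasis hθQ).gen :=
    (isIntegral_algebraMap_iff
      (algebraMap (IntermediateField.adjoin ℚ ({θ} : Set ℂ)) ℂ).injective).1 (by
        rw [hgen]; exact hθ)
  have hmin : minpoly ℤ (IntermediateField.adjoin.powerBasis hθQ).gen = minpoly ℤ θ := by
    conv_rhs => rw [← hgen]
    rw [minpoly.algebraMap_eq
      (algebraMap (IntermediateField.adjoin ℚ ({θ} : Set ℂ)) ℂ).injective]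
  rw [← hmin]
  exact exists_card_root_pairs_le_of_powerBasis _ hθint

/-! ### Reduction of the linear factors modulo primes -/

theorem exists_residue_field (p : ℕ) (hp : p.Prime) :
    ∃ (κ : Type) (_ : Field κ) (_ : CharP κ p), Nonempty (integralClosure ℤ ℂ →+* κ) := by
  have hne : Ideal.span {(p : integralClosure ℤ ℂ)} ≠ ⊤ := by
    intro h
    obtain ⟨x, hx⟩ := isUnit_iff_exists_inv.1 (Ideal.span_singleton_eq_top.1 h)
    have h1 : (p : ℂ) * (x : ℂ) = 1 := by exact_mod_cast congrArg Subtype.val hx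
    have hp0 : (p : ℚ) ≠ 0 := by exact_mod_cast hp.ne_zero
    have h2 : (x : ℂ) = algebraMap ℚ ℂ ((p : ℚ)⁻¹) := by
      rw [map_inv₀, map_natCast]
      exact eq_inv_of_mul_eq_one_right h1
    have h3 : IsIntegral ℤ ((p : ℚ)⁻¹) :=
      (isIntegral_algebraMap_iff (algebraMap ℚ ℂ).injective).1 (h2 ▸ x.2)
    obtain ⟨m, hm⟩ := IsIntegrallyClosed.isIntegral_iff.1 h3
    have h4 : (p : ℤ) * m = 1 := by
      have : (p : ℚ) * (m : ℚ) = 1 := by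
        rw [show (m : ℚ) = (p : ℚ)⁻¹ from hm, mul_inv_cancel₀ hp0]
      exact_mod_cast this
    exact hp.one_lt.ne' (by exact_mod_cast Int.eq_one_of_mul_eq_one_right (by positivity) h4)
  obtain ⟨I, hI, hle⟩ := Ideal.exists_le_maximal _ hne
  refine ⟨integralClosure ℤ ℂ ⧸ I, Ideal.Quotient.field I, ?_, ⟨Ideal.Quotient.mk I⟩⟩
  refine (CharP.charP_iff_prime_eq_zero hp).2 ?_
  have : Ideal.Quotient.mk I (p : integralClosure ℤ ℂ) = 0 :=
    Ideal.Quotient.eq_zero_iff_mem.2 (hle (Ideal.subset_span rfl))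
  simpa using this

theorem exists_forall_prime_map_ne_zero {x : integralClosure ℤ ℂ} (hx : x ≠ 0) :
    ∃ N : ℕ, ∀ p : ℕ, N < p → ∀ (κ : Type) [Field κ] [CharP κ p]
      (φ : integralClosure ℤ ℂ →+* κ), φ x ≠ 0 := by
  obtain ⟨g, hc, hg⟩ := (Algebra.IsAlgebraic.isAlgebraic (R := ℤ)
    x).exists_nonzero_coeff_and_aeval_eq_zero (mem_nonZeroDivisors_of_ne_zero hx)
  refine ⟨(g.coeff 0).natAbs, fun p hp κ _ _ φ h0 => ?_⟩
  have h1 : Polynomial.eval₂ (Int.castRingHom κ) (φ x) g = 0 := by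
    have h2 := congrArg φ hg
    rw [map_zero, Polynomial.aeval_def, Polynomial.hom_eval₂] at h2
    rw [← h2]
    congr 1
    exact RingHom.ext_int _ _
  rw [h0, Polynomial.eval₂_at_zero] at h1
  have h2 : (p : ℤ) ∣ g.coeff 0 := (CharP.intCast_eq_zero_iff κ p _).1 (by simpa using h1)
  exact absurd (Nat.le_of_dvd (Int.natAbs_pos.2 hc) (Int.natCast_dvd.1 h2)) (by omega)

/-- A splitting of `F` into linear factors over a field of characteristic `p`, for which the
auxiliary points `a` and `b` keep their separating properties. -/
structure GoodReduction {n : ℕ} (d : ℕ) (F : MvPolynomial (Fin n) ℤ) (a b : Fin n → ℤ)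
    (g : Polynomial ℤ) (p : ℕ) where
  /-- the coefficient field -/
  κ : Type
  [field : Field κ]
  [charP : CharP κ p]
  /-- the linear factors -/
  M : Fin d → Fin n → κ
  map_eq : F.map (Int.castRingHom κ) = ∏ j, linForm (M j)
  ne_zero : ∀ j, formVal (M j) b ≠ 0
  separated : ∀ i j, i ≠ j → formVal (M i) a * formVal (M j) b ≠ formVal (M j) a * formVal (M i) b
  eq_zero : ∀ v : Fin n → ℤ, (∀ j, formVal (M j) v = 0) → ∀ i, (p : ℤ) ∣ v i
  eval_eq_zero : ∀ j, g.eval₂ (Int.castRingHom κ)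
    (formVal (M j) a * ∏ i ∈ Finset.univ.erase j, formVal (M i) b) = 0

attribute [instance] GoodReduction.field GoodReduction.charP

theorem exists_goodReduction {n d : ℕ} (hd : n ≤ d) {F : MvPolynomial (Fin n) ℤ}
    {L : Fin d → Fin n → ℂ} (hF : IsDecomp F L)
    (hirr : Irreducible (F.map (Int.castRingHom ℚ))) (hΔ : discProd L ≠ 0) {a b : Fin n → ℤ}
    (hb : ∀ j, formVal (L j) b ≠ 0)
    (ha : ∀ i j, i ≠ j → formVal (L i) a * formVal (L j) b ≠ formVal (L j) a * formVal (L i) b)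
    (j₀ : Fin d) :
    ∃ N : ℕ, ∀ p : ℕ, p.Prime → N < p →
      Nonempty (GoodReduction d F a b (minpoly ℤ (ratioVal L a b j₀)) p) := by
  classical
  let l : Fin d → Fin n → integralClosure ℤ ℂ := fun j i => ⟨L j i, hF.1 j i⟩
  let ι : integralClosure ℤ ℂ →+* ℂ := algebraMap (integralClosure ℤ ℂ) ℂ
  have hι : Function.Injective ι := Subtype.val_injective
  have hιl : ∀ j z, ι (formVal (l j) z) = formVal (L j) z := fun j z => map_formVal ι (l j) z
  let x : integralClosure ℤ ℂ := (∏ j, formVal (l j) b) *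
    (∏ y ∈ Finset.univ.filter fun y : Fin d × Fin d => y.1 ≠ y.2,
      (formVal (l y.1) a * formVal (l y.2) b - formVal (l y.2) a * formVal (l y.1) b)) *
    Matrix.det (Matrix.of fun i j : Fin n => l (Fin.castLE hd i) j)
  have hx : x ≠ 0 := by
    refine mul_ne_zero (mul_ne_zero ?_ ?_) ?_
    · refine Finset.prod_ne_zero_iff.2 fun j _ h => hb j ?_
      rw [← hιl, h, map_zero]
    · refine Finset.prod_ne_zero_iff.2 fun y hy h => ha _ _ (Finset.mem_filter.1 hy).2 ?_
      rw [← hιl, ← hιl, ← hιl, ← hιl, ← map_mul, ← map_mul, sub_eq_zero.1 h]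
    · intro h
      have hdet := linearIndependent_of_discProd_ne_zero hΔ
        (g := Fin.castLE hd) (Fin.strictMono_castLE hd)
      have h2 := congrArg ι h
      rw [map_zero, RingHom.map_det] at h2
      exact hdet h2
  obtain ⟨N, hN⟩ := exists_forall_prime_map_ne_zero hx
  refine ⟨N, fun p hp hNp => ?_⟩
  obtain ⟨κ, _, _, ⟨φ⟩⟩ := exists_residue_field p hp
  have hφx := hN p hNp κ φ
  simp only [x, map_mul, map_prod] at hφx
  obtain ⟨h12, h3⟩ := mul_ne_zero_iff.1 hφx
  obtain ⟨h1, h2⟩ := mul_ne_zero_iff.1 h12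
  rw [Finset.prod_ne_zero_iff] at h1 h2
  have hφl : ∀ j z, φ (formVal (l j) z) = formVal (fun i => φ (l j i)) z :=
    fun j z => map_formVal φ (l j) z
  refine ⟨⟨κ, fun j i => φ (l j i), ?_, fun j => ?_, fun i j hij => ?_, fun v hv i => ?_,
    fun j => ?_⟩⟩
  · have hl : F.map (Int.castRingHom (integralClosure ℤ ℂ)) = ∏ j, linForm (l j) := by
      apply MvPolynomial.map_injective ι hι
      rw [map_map_intCast, hF.2, map_prod]
      exact Finset.prod_congr rfl fun j _ => (map_linForm ι (l j)).symm
    rw [← map_map_intCast φ, hl, map_prod]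
    exact Finset.prod_congr rfl fun j _ => map_linForm φ (l j)
  · rw [← hφl]
    exact h1 j (Finset.mem_univ j)
  · have := h2 (i, j) (by simpa using hij)
    rw [map_sub, map_mul, map_mul, hφl, hφl, hφl, hφl] at this
    exact sub_ne_zero.1 this
  · rw [RingHom.map_det] at h3
    have h4 := Matrix.eq_zero_of_mulVec_eq_zero h3 (v := fun i => (v i : κ))
      (funext fun i => hv (Fin.castLE hd i))
    exact (CharP.intCast_eq_zero_iff κ p _).1 (congrFun h4 i)
  · have h4 := aeval_minpoly_ratioVal hF hirr hb ha j₀ j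
    set g := minpoly ℤ (ratioVal L a b j₀)
    have h5 : ι (formVal (l j) a * ∏ i ∈ Finset.univ.erase j, formVal (l i) b) =
        ratioVal L a b j := by
      rw [map_mul, map_prod, ratioVal, hιl]
      simp only [hιl]
    have h6 : Polynomial.eval₂ (Int.castRingHom (integralClosure ℤ ℂ))
        (formVal (l j) a * ∏ i ∈ Finset.univ.erase j, formVal (l i) b) g = 0 := by
      apply hι
      rw [map_zero, Polynomial.hom_eval₂, h5, ← h4, Polynomial.aeval_def]
      congr 1
    have h7 := congrArg φ h6
    rw [map_zero, Polynomial.hom_eval₂, map_mul, map_prod, hφl] at h7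
    simp only [hφl] at h7
    rw [← h7]
    congr 1
    exact RingHom.ext_int _ _

namespace GoodReduction

variable {n d : ℕ} {F : MvPolynomial (Fin n) ℤ} {a b : Fin n → ℤ} {g : Polynomial ℤ} {p : ℕ}
  (G : GoodReduction d F a b g p)

/-- The linear factors that are defined over the prime field, normalized to be `1` at `b`. -/
def forms : Set (Fin n → ZMod p) :=
  {c | ∃ j, ∀ i, formVal (G.M j) b * ZMod.castHom (dvd_refl p) G.κ (c i) = G.M j i}

theorem castHom_formVal {c : Fin n → ZMod p} {j : Fin d}
    (hc : ∀ i, formVal (G.M j) b * ZMod.castHom (dvd_refl p) G.κ (c i) = G.M j i)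
    (z : Fin n → ℤ) :
    formVal (G.M j) b * ZMod.castHom (dvd_refl p) G.κ (formVal c z) = formVal (G.M j) z := by
  rw [map_formVal, ← formVal_smul]
  congr 1
  exact funext fun i => hc i

theorem formVal_base [Fact p.Prime] {c : Fin n → ZMod p} (hc : c ∈ G.forms) :
    formVal c b = 1 := by
  obtain ⟨j, hj⟩ := hc
  have h1 := G.castHom_formVal hj b
  apply (ZMod.castHom (dvd_refl p) G.κ).injective
  rw [map_one]
  exact mul_left_cancel₀ (G.ne_zero j) (by rw [h1, mul_one])

theorem dvd_eval_of_formVal_eq_zero {c : Fin n → ZMod p} (hc : c ∈ G.forms) {z : Fin n → ℤ}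
    (hz : formVal c z = 0) : (p : ℤ) ∣ MvPolynomial.eval z F := by
  obtain ⟨j, hj⟩ := hc
  have h1 := G.castHom_formVal hj z
  rw [hz, map_zero, mul_zero] at h1
  refine (CharP.intCast_eq_zero_iff G.κ p _).1 ?_
  rw [cast_eval_eq_prod_formVal G.map_eq z]
  exact Finset.prod_eq_zero (Finset.mem_univ j) h1.symm

theorem finite_forms [Fact p.Prime] : G.forms.Finite := Set.toFinite _

theorem ncard_forms_le [Fact p.Prime] : G.forms.ncard ≤ d := by
  have hex : ∀ c : G.forms, ∃ j, ∀ i,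
    formVal (G.M j) b * ZMod.castHom (dvd_refl p) G.κ (c.1 i) = G.M j i := fun c => c.2
  choose f hf using hex
  rw [← Nat.card_coe_set_eq]
  refine (Nat.card_le_card_of_injective f fun c c' h => ?_).trans (by simp)
  refine Subtype.ext (funext fun i => (ZMod.castHom (dvd_refl p) G.κ).injective ?_)
  refine mul_left_cancel₀ (G.ne_zero (f c)) ?_
  rw [hf c i, h, hf c' i]

theorem exists_mem_forms [Fact p.Prime] {c : Fin n → ZMod p} (hc : c ≠ 0)
    (hdvd : linForm c ∣ F.map (Int.castRingHom (ZMod p))) :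
    ∃ c' ∈ G.forms, ∀ x : Fin n → ℤ, formVal c x = 0 → formVal c' x = 0 := by
  let ψ := ZMod.castHom (dvd_refl p) G.κ
  have h1 : linForm (fun i => ψ (c i)) ∣ ∏ j, linForm (G.M j) := by
    rw [← G.map_eq, ← map_map_intCast ψ, ← map_linForm ψ c]
    exact _root_.map_dvd _ hdvd
  have hc' : (fun i => ψ (c i)) ≠ 0 := fun h => hc (funext fun i => ψ.injective (by
    rw [Pi.zero_apply, map_zero]
    exact congrFun h i))
  obtain ⟨j, -, r, hr, hj⟩ := exists_eq_smul_of_linForm_dvd_prod hc' (fun j _ h0 => by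
    apply G.ne_zero j
    simp [formVal, h0]) h1
  have h2 : formVal (G.M j) b = r * ψ (formVal c b) := by
    rw [map_formVal ψ, ← formVal_smul, ← hj]
  have h3 : formVal c b ≠ 0 := fun h => G.ne_zero j (by rw [h2, h, map_zero, mul_zero])
  refine ⟨(formVal c b)⁻¹ • c, ⟨j, fun i => ?_⟩, fun x hx => by rw [formVal_smul, hx, mul_zero]⟩
  have h4 : ψ (formVal c b) ≠ 0 := fun h => h3 (ψ.injective (h.trans (map_zero ψ).symm))
  have h5 := congrFun hj i
  simp only [Pi.smul_apply, smul_eq_mul] at h5 ⊢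
  rw [h2, map_mul, map_inv₀, h5]
  change r * ψ (formVal c b) * ((ψ (formVal c b))⁻¹ * ψ (c i)) = _
  rw [mul_assoc, mul_inv_cancel_left₀ h4]

theorem castHom_eval_mul_formVal {c : Fin n → ZMod p} {j : Fin d}
    (hc : ∀ i, formVal (G.M j) b * ZMod.castHom (dvd_refl p) G.κ (c i) = G.M j i) :
    ZMod.castHom (dvd_refl p) G.κ (((MvPolynomial.eval b F : ℤ) : ZMod p) * formVal c a) =
      formVal (G.M j) a * ∏ i ∈ Finset.univ.erase j, formVal (G.M i) b := by
  rw [map_mul, map_intCast, cast_eval_eq_prod_formVal G.map_eq b,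
    ← Finset.mul_prod_erase _ _ (Finset.mem_univ j), ← G.castHom_formVal hc a]
  ring

theorem eval₂_eq_zero [Fact p.Prime] {c : Fin n → ZMod p} (hc : c ∈ G.forms) :
    g.eval₂ (Int.castRingHom (ZMod p))
      (((MvPolynomial.eval b F : ℤ) : ZMod p) * formVal c a) = 0 := by
  obtain ⟨j, hj⟩ := hc
  apply (ZMod.castHom (dvd_refl p) G.κ).injective
  rw [Polynomial.hom_eval₂, G.castHom_eval_mul_formVal hj, map_zero, ← G.eval_eq_zero j]
  congr 1
  exact RingHom.ext_int _ _

theorem forms_injOn [Fact p.Prime] {c c' : Fin n → ZMod p} (hc : c ∈ G.forms)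
    (hc' : c' ∈ G.forms)
    (h : ((MvPolynomial.eval b F : ℤ) : ZMod p) * formVal c a =
      ((MvPolynomial.eval b F : ℤ) : ZMod p) * formVal c' a) : c = c' := by
  obtain ⟨j, hj⟩ := hc
  obtain ⟨j', hj'⟩ := hc'
  have hFb : ((MvPolynomial.eval b F : ℤ) : ZMod p) ≠ 0 := fun h0 => by
    have h1 := congrArg (ZMod.castHom (dvd_refl p) G.κ) h0
    rw [map_intCast, map_zero, cast_eval_eq_prod_formVal G.map_eq b] at h1
    exact Finset.prod_ne_zero_iff.2 (fun j _ => G.ne_zero j) h1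
  have h1 : formVal c a = formVal c' a := mul_left_cancel₀ hFb h
  have hjj : j = j' := by
    by_contra hne
    apply G.separated j j' hne
    rw [← G.castHom_formVal hj a, ← G.castHom_formVal hj' a, h1]
    ring
  subst hjj
  refine funext fun i => (ZMod.castHom (dvd_refl p) G.κ).injective ?_
  exact mul_left_cancel₀ (G.ne_zero j) (by rw [hj, hj'])

end GoodReduction

/-- The restriction of `F` to the line `y + t v`. -/
def linePoly {n : ℕ} (F : MvPolynomial (Fin n) ℤ) (y v : Fin n → ℤ) : Polynomial ℤ :=
  MvPolynomial.aeval (fun i => Polynomial.C (y i) + Polynomial.C (v i) * Polynomial.X) F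

theorem eval_linePoly {n : ℕ} (F : MvPolynomial (Fin n) ℤ) (y v : Fin n → ℤ) (t : ℤ) :
    (linePoly F y v).eval t = MvPolynomial.eval (y + t • v) F := by
  have h := MvPolynomial.map_aeval
    (fun i => Polynomial.C (y i) + Polynomial.C (v i) * Polynomial.X)
    (Polynomial.evalRingHom t) F
  refine h.trans ?_
  rw [MvPolynomial.eval, MvPolynomial.coe_eval₂Hom, MvPolynomial.coe_eval₂Hom]
  congr 1
  · exact RingHom.ext_int _ _
  · funext i
    simp [mul_comm]

theorem map_linePoly {n d : ℕ} {R : Type*} [CommRing R] {F : MvPolynomial (Fin n) ℤ}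
    {M : Fin d → Fin n → R} (hF : F.map (Int.castRingHom R) = ∏ j, linForm (M j))
    (y v : Fin n → ℤ) :
    (linePoly F y v).map (Int.castRingHom R) =
      ∏ j, (Polynomial.C (formVal (M j) y) + Polynomial.C (formVal (M j) v) * Polynomial.X) := by
  have h := MvPolynomial.map_aeval
    (fun i => Polynomial.C (y i) + Polynomial.C (v i) * Polynomial.X)
    (Polynomial.mapRingHom (Int.castRingHom R)) F
  refine h.trans ?_
  have h2 : MvPolynomial.eval₂Hom Polynomial.C
      (fun i => Polynomial.C ((y i : ℤ) : R) + Polynomial.C ((v i : ℤ) : R) * Polynomial.X)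
      (F.map (Int.castRingHom R)) = ∏ j, (Polynomial.C (formVal (M j) y) +
        Polynomial.C (formVal (M j) v) * Polynomial.X) := by
    rw [hF, map_prod]
    refine Finset.prod_congr rfl fun j _ => ?_
    simp only [linForm, formVal, map_sum, map_mul, MvPolynomial.coe_eval₂Hom,
      MvPolynomial.eval₂_C, MvPolynomial.eval₂_X, Finset.sum_mul, ← Finset.sum_add_distrib]
    exact Finset.sum_congr rfl fun i _ => by ring
  rw [← h2, MvPolynomial.coe_eval₂Hom, MvPolynomial.coe_eval₂Hom, MvPolynomial.eval₂_map]
  congr 1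
  · exact RingHom.ext_int _ _
  · funext i
    simp

theorem natDegree_linePoly_le {n d : ℕ} {F : MvPolynomial (Fin n) ℤ} {M : Fin d → Fin n → ℂ}
    (hF : F.map (Int.castRingHom ℂ) = ∏ j, linForm (M j)) (y v : Fin n → ℤ) :
    (linePoly F y v).natDegree ≤ d := by
  rw [← Polynomial.natDegree_map_eq_of_injective (Int.castRingHom ℂ).injective_int,
    map_linePoly hF]
  refine (Polynomial.natDegree_prod_le _ _).trans ?_
  calc ∑ j, (Polynomial.C (formVal (M j) y) +
        Polynomial.C (formVal (M j) v) * Polynomial.X).natDegree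
      ≤ ∑ _j : Fin d, 1 := by
        refine Finset.sum_le_sum fun j _ => ?_
        rw [add_comm]
        exact Polynomial.natDegree_linear_le
    _ = d := by simp

theorem rootMultiplicity_prod_linear {κ : Type*} [Field κ] {d : ℕ} (y v : Fin d → κ) (j₀ : Fin d)
    (h₀ : v j₀ ≠ 0) (h : ∀ j, j ≠ j₀ → v j₀ * y j ≠ v j * y j₀) :
    (∏ j, (Polynomial.C (y j) + Polynomial.C (v j) * Polynomial.X)).rootMultiplicity
      (-(y j₀ / v j₀)) = 1 := by
  classical
  set s := -(y j₀ / v j₀) with hs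
  have hval : ∀ j, j ≠ j₀ → (Polynomial.C (y j) + Polynomial.C (v j) * Polynomial.X).eval s ≠ 0 := by
    intro j hj h1
    apply h j hj
    simp only [Polynomial.eval_add, Polynomial.eval_C, Polynomial.eval_mul,
      Polynomial.eval_X] at h1
    have h2 : s * v j₀ = -y j₀ := by rw [hs]; field_simp
    linear_combination v j₀ * h1 - v j * h2
  have hfac : Polynomial.C (y j₀) + Polynomial.C (v j₀) * Polynomial.X =
      Polynomial.C (v j₀) * (Polynomial.X - Polynomial.C s) := by
    rw [mul_sub, ← Polynomial.C_mul, show v j₀ * s = -y j₀ by rw [hs]; field_simp, Polynomial.C_neg]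
    ring
  rw [← Finset.mul_prod_erase _ _ (Finset.mem_univ j₀), hfac]
  have hne : (∏ j ∈ Finset.univ.erase j₀,
      (Polynomial.C (y j) + Polynomial.C (v j) * Polynomial.X)).eval s ≠ 0 := by
    rw [Polynomial.eval_prod]
    exact Finset.prod_ne_zero_iff.2 fun j hj => hval j (Finset.ne_of_mem_erase hj)
  have hne' : (∏ j ∈ Finset.univ.erase j₀,
      (Polynomial.C (y j) + Polynomial.C (v j) * Polynomial.X)) ≠ 0 := by
    rintro h0
    rw [h0, Polynomial.eval_zero] at hne
    exact hne rfl
  have hC : Polynomial.C (v j₀) ≠ 0 := Polynomial.C_ne_zero.2 h₀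
  have hX := Polynomial.X_sub_C_ne_zero s
  rw [Polynomial.rootMultiplicity_mul (mul_ne_zero (mul_ne_zero hC hX) hne'),
    Polynomial.rootMultiplicity_mul (mul_ne_zero hC hX),
    Polynomial.rootMultiplicity_X_sub_C_self, Polynomial.rootMultiplicity_C,
    Polynomial.rootMultiplicity_eq_zero hne]

theorem prime_dvd_index {A : Type*} [AddCommGroup A] {p : ℕ} (hp : p.Prime) (H : AddSubgroup A)
    (hH : ∀ x : A, p • x ∈ H) {x : A} (hx : x ∉ H) : p ∣ H.index := by
  have h1 : addOrderOf (QuotientAddGroup.mk x : A ⧸ H) = p := by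
    have : Fact p.Prime := ⟨hp⟩
    refine addOrderOf_eq_prime ?_ ?_
    · rw [← QuotientAddGroup.mk_nsmul]
      exact (QuotientAddGroup.eq_zero_iff _).2 (hH x)
    · rwa [Ne, QuotientAddGroup.eq_zero_iff]
  rw [← h1]
  exact addOrderOf_dvd_natCard _

/-- Off few proper subgroups containing `v`, the restriction of `F` to a line with direction `v`
has a simple root. -/
theorem GoodReduction.exists_subgroups {n d : ℕ} {F : MvPolynomial (Fin n) ℤ}
    {a b : Fin n → ℤ} {g : Polynomial ℤ} {p : ℕ} (G : GoodReduction d F a b g p) (hp : p.Prime)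
    (hd : 2 ≤ d)
    {v : Fin n → ℤ} (hv : ∃ i, ¬ (p : ℤ) ∣ v i) :
    ∃ H : Fin d → AddSubgroup (Fin n → ℤ), (∀ j, v ∈ H j ∧ (p ∣ (H j).index)) ∧
      ∀ y, (∀ j, y ∉ H j) → HasSimpleRootMod p (linePoly F y v) := by
  classical
  obtain ⟨j₀, hj₀⟩ : ∃ j₀, formVal (G.M j₀) v ≠ 0 := by
    by_contra! h
    obtain ⟨i, hi⟩ := hv
    exact hi (G.eq_zero v h i)
  have : Nontrivial (Fin d) := Fin.nontrivial_iff_two_le.2 hd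
  obtain ⟨j₁, hj₁⟩ := exists_ne j₀
  let σ : Fin d → Fin d := fun j => if j = j₀ then j₁ else j
  have hσ : ∀ j, σ j ≠ j₀ := fun j => by
    by_cases hj : j = j₀ <;> simp [σ, hj, hj₁]
  let ev : (Fin n → G.κ) → (Fin n → ℤ) →+ G.κ := fun c =>
    AddMonoidHom.mk' (formVal c) (formVal_add c)
  let f : Fin d → (Fin n → ℤ) →+ G.κ := fun j =>
    (AddMonoidHom.mulLeft (formVal (G.M j₀) v)).comp (ev (G.M j)) -
      (AddMonoidHom.mulLeft (formVal (G.M j) v)).comp (ev (G.M j₀))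
  have hf : ∀ j y, f j y = formVal (G.M j₀) v * formVal (G.M j) y -
    formVal (G.M j) v * formVal (G.M j₀) y := fun j y => rfl
  refine ⟨fun j => (f (σ j)).ker, fun j => ⟨?_, ?_⟩, fun y hy => ?_⟩
  · rw [AddMonoidHom.mem_ker, hf]
    ring
  · have hne : ∃ y, y ∉ (f (σ j)).ker := by
      by_contra! h
      have ha := h a
      have hb := h b
      rw [AddMonoidHom.mem_ker, hf] at ha hb
      refine G.separated _ _ (hσ j) (mul_left_cancel₀ hj₀ ?_)
      linear_combination formVal (G.M j₀) b * ha - formVal (G.M j₀) a * hb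
    obtain ⟨y, hy⟩ := hne
    refine prime_dvd_index hp _ (fun x => ?_) hy
    rw [AddMonoidHom.mem_ker, map_nsmul, nsmul_eq_mul, CharP.cast_eq_zero, zero_mul]
  · refine ⟨G.κ, G.field, G.charP, -(formVal (G.M j₀) y / formVal (G.M j₀) v), ?_⟩
    rw [map_linePoly G.map_eq]
    refine rootMultiplicity_prod_linear _ _ j₀ hj₀ fun j hj h => ?_
    refine hy j ?_
    rw [AddMonoidHom.mem_ker, hf]
    simp only [σ, if_neg hj]
    exact sub_eq_zero.2 h

/-! ### Lattices attached to the linear factors -/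

/-- A square-free modulus together with a compatible choice of linear factors modulo its prime
divisors. -/
structure IsKey {n : ℕ} (N₀ : ℕ) (forms : ∀ p : ℕ, Set (Fin n → ZMod p))
    (x : ℕ × (Fin n → ℕ)) : Prop where
  squarefree : Squarefree x.1
  lt : ∀ i, x.2 i < x.1
  lt_prime : ∀ p : ℕ, p.Prime → p ∣ x.1 → N₀ < p
  mem_forms : ∀ p : ℕ, p.Prime → p ∣ x.1 → (fun i => ((x.2 i : ℕ) : ZMod p)) ∈ forms p

/-- The lattice of points at which all the linear forms of a key vanish. -/
def keyLattice {n : ℕ} (x : ℕ × (Fin n → ℕ)) : AddSubgroup (Fin n → ℤ) :=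
  (AddMonoidHom.mk' (formVal fun i => ((x.2 i : ℕ) : ZMod x.1)) (formVal_add _)).ker

theorem mem_keyLattice {n : ℕ} {x : ℕ × (Fin n → ℕ)} {z : Fin n → ℤ} :
    z ∈ keyLattice x ↔ (x.1 : ℤ) ∣ ∑ i, (x.2 i : ℤ) * z i := by
  rw [← ZMod.intCast_zmod_eq_zero_iff_dvd]
  refine AddMonoidHom.mem_ker.trans ?_
  simp [formVal]

theorem formVal_natCast_eq_zero_iff {n p : ℕ} {c : Fin n → ℕ} {z : Fin n → ℤ} :
    formVal (fun i => ((c i : ℕ) : ZMod p)) z = 0 ↔ (p : ℤ) ∣ ∑ i, (c i : ℤ) * z i := by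
  rw [← ZMod.intCast_zmod_eq_zero_iff_dvd]
  simp [formVal]

theorem natCast_dvd_of_squarefree {u : ℕ} (hu : Squarefree u) {z : ℤ}
    (h : ∀ p : ℕ, p.Prime → p ∣ u → (p : ℤ) ∣ z) : (u : ℤ) ∣ z := by
  rw [Int.natCast_dvd, ← Nat.prod_primeFactors_of_squarefree hu]
  refine Finset.prod_primes_dvd _ (fun p hp => (Nat.prime_of_mem_primeFactors hp).prime)
    fun p hp => ?_
  exact Int.natCast_dvd.1 (h p (Nat.prime_of_mem_primeFactors hp) (Nat.dvd_of_mem_primeFactors hp))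

theorem IsKey.pos {n N₀ : ℕ} {forms : ∀ p : ℕ, Set (Fin n → ZMod p)} {x : ℕ × (Fin n → ℕ)}
    (h : IsKey N₀ forms x) : 0 < x.1 := Nat.pos_of_ne_zero h.squarefree.ne_zero

theorem IsKey.index_keyLattice {n N₀ : ℕ} {forms : ∀ p : ℕ, Set (Fin n → ZMod p)}
    {x : ℕ × (Fin n → ℕ)} (h : IsKey N₀ forms x) {b : Fin n → ℤ}
    (hb : ∀ p : ℕ, p.Prime → N₀ < p → ∀ c ∈ forms p, formVal c b = 1) :
    (keyLattice x).index = x.1 := by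
  have : NeZero x.1 := ⟨h.pos.ne'⟩
  have h1 : (formVal fun i => ((x.2 i : ℕ) : ZMod x.1)) b = 1 := by
    have h2 : (x.1 : ℤ) ∣ (∑ i, (x.2 i : ℤ) * b i) - 1 := by
      refine natCast_dvd_of_squarefree h.squarefree fun p hp hpx => ?_
      rw [← ZMod.intCast_zmod_eq_zero_iff_dvd]
      have h3 := hb p hp (h.lt_prime p hp hpx) _ (h.mem_forms p hp hpx)
      push_cast
      rw [sub_eq_zero, ← h3]
      simp [formVal]
    rw [← ZMod.intCast_zmod_eq_zero_iff_dvd] at h2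
    push_cast at h2
    rw [← sub_eq_zero.1 h2]
    simp [formVal]
  have hsurj : Function.Surjective
      (AddMonoidHom.mk' (formVal fun i => ((x.2 i : ℕ) : ZMod x.1)) (formVal_add _)) := by
    intro y
    refine ⟨(y.val : ℤ) • b, ?_⟩
    change formVal _ _ = y
    rw [formVal_zsmul, h1]
    simp
  rw [keyLattice, AddSubgroup.index_ker, AddMonoidHom.range_eq_top.2 hsurj]
  simp

theorem IsKey.dvd_eval {n N₀ : ℕ} {forms : ∀ p : ℕ, Set (Fin n → ZMod p)}
    {F : MvPolynomial (Fin n) ℤ} {x : ℕ × (Fin n → ℕ)} (h : IsKey N₀ forms x)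
    (hdvd : ∀ p : ℕ, p.Prime → N₀ < p → ∀ c ∈ forms p, ∀ z : Fin n → ℤ, formVal c z = 0 →
      (p : ℤ) ∣ MvPolynomial.eval z F) {z : Fin n → ℤ} (hz : z ∈ keyLattice x) :
    (x.1 : ℤ) ∣ MvPolynomial.eval z F :=
  natCast_dvd_of_squarefree h.squarefree fun p hp hpx =>
    hdvd p hp (h.lt_prime p hp hpx) _ (h.mem_forms p hp hpx) z (formVal_natCast_eq_zero_iff.2
      ((Int.natCast_dvd_natCast.2 hpx).trans (mem_keyLattice.1 hz)))

theorem exists_isKey {n N₀ u : ℕ} {forms : ∀ p : ℕ, Set (Fin n → ZMod p)} (hu : Squarefree u)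
    {z : Fin n → ℤ} (h : ∀ p : ℕ, p.Prime → p ∣ u → N₀ < p ∧ ∃ c ∈ forms p, formVal c z = 0) :
    ∃ c : Fin n → ℕ, IsKey N₀ forms (u, c) ∧ z ∈ keyLattice (u, c) := by
  classical
  have hu0 : 0 < u := Nat.pos_of_ne_zero hu.ne_zero
  have hch : ∀ p : ℕ, ∃ c : Fin n → ℕ, p.Prime → p ∣ u →
      (fun i => ((c i : ℕ) : ZMod p)) ∈ forms p ∧
        formVal (fun i => ((c i : ℕ) : ZMod p)) z = 0 := by
    intro p
    by_cases hp : p.Prime ∧ p ∣ u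
    · obtain ⟨-, c, hc, hz⟩ := h p hp.1 hp.2
      have : NeZero p := ⟨hp.1.ne_zero⟩
      refine ⟨fun i => (c i).val, fun _ _ => ?_⟩
      simp only [ZMod.natCast_zmod_val]
      exact ⟨hc, hz⟩
    · exact ⟨0, fun h1 h2 => absurd ⟨h1, h2⟩ hp⟩
  choose c hc using hch
  have hcop : Set.Pairwise (u.primeFactors : Set ℕ) (Function.onFun Nat.Coprime id) :=
    fun p hp q hq hpq => (Nat.coprime_primes (Nat.prime_of_mem_primeFactors hp)
      (Nat.prime_of_mem_primeFactors hq)).2 hpq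
  let e : Fin n → ℕ := fun i => (Nat.chineseRemainderOfFinset (fun p => c p i) id u.primeFactors
    (fun p hp => (Nat.prime_of_mem_primeFactors hp).ne_zero) hcop).1 % u
  have he : ∀ p : ℕ, p.Prime → p ∣ u → ∀ i, ((e i : ℕ) : ZMod p) = ((c p i : ℕ) : ZMod p) := by
    intro p hp hpu i
    rw [ZMod.natCast_eq_natCast_iff]
    refine ((Nat.mod_modEq _ u).of_dvd hpu).trans ?_
    exact (Nat.chineseRemainderOfFinset (fun p => c p i) id u.primeFactors
      (fun p hp => (Nat.prime_of_mem_primeFactors hp).ne_zero) hcop).2 p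
      (Nat.mem_primeFactors.2 ⟨hp, hpu, hu0.ne'⟩)
  refine ⟨e, ⟨hu, fun i => Nat.mod_lt _ hu0, fun p hp hpu => (h p hp hpu).1,
    fun p hp hpu => ?_⟩, mem_keyLattice.2 (natCast_dvd_of_squarefree hu fun p hp hpu => ?_)⟩
  · simp only [he p hp hpu]
    exact (hc p hp hpu).1
  · rw [← formVal_natCast_eq_zero_iff]
    simp only [he p hp hpu]
    exact (hc p hp hpu).2

theorem IsKey.ext_of_forall {n N₀ : ℕ} {forms : ∀ p : ℕ, Set (Fin n → ZMod p)}
    {x y : ℕ × (Fin n → ℕ)} (hx : IsKey N₀ forms x) (hy : IsKey N₀ forms y) (h : x.1 = y.1)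
    (hp : ∀ p : ℕ, p.Prime → p ∣ x.1 → ∀ i, ((x.2 i : ℕ) : ZMod p) = ((y.2 i : ℕ) : ZMod p)) :
    x = y := by
  refine Prod.ext h (funext fun i => ?_)
  have h1 : (x.1 : ℤ) ∣ (y.2 i : ℤ) - (x.2 i : ℤ) := by
    refine natCast_dvd_of_squarefree hx.squarefree fun p hpp hpx => ?_
    rw [← ZMod.intCast_zmod_eq_zero_iff_dvd]
    push_cast
    rw [hp p hpp hpx i, sub_self]
  exact Nat.ModEq.eq_of_lt_of_lt (Nat.modEq_iff_dvd.2 h1) (hx.lt i) (h ▸ hy.lt i)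

/-- A point lies on few of the lattices. -/
theorem card_keys_le_of_mem {n N₀ d : ℕ} {forms : ∀ p : ℕ, Set (Fin n → ZMod p)}
    (hforms : ∀ p : ℕ, p.Prime → N₀ < p → (forms p).Finite ∧ (forms p).ncard ≤ d)
    (W : Finset ℕ) (T : Finset (ℕ × (Fin n → ℕ)))
    (hT : ∀ x ∈ T, IsKey N₀ forms x ∧ ∀ p : ℕ, p.Prime → p ∣ x.1 → p ∈ W) :
    T.card ≤ (d + 1) ^ W.card := by
  classical
  let S : ℕ → Finset (Option (Fin n → ℕ)) := fun p =>
    if h : p.Prime ∧ N₀ < p then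
      insert none (((hforms p h.1 h.2).1.toFinset).image fun c => some fun i => (c i).val)
    else {none}
  have hS : ∀ p, (S p).card ≤ d + 1 := by
    intro p
    by_cases h : p.Prime ∧ N₀ < p
    · simp only [S, dif_pos h]
      refine (Finset.card_insert_le _ _).trans (Nat.succ_le_succ (Finset.card_image_le.trans ?_))
      rw [← Set.ncard_eq_toFinset_card _ (hforms p h.1 h.2).1]
      exact (hforms p h.1 h.2).2
    · simp [S, dif_neg h]
  have hcard : (W.pi S).card ≤ (d + 1) ^ W.card := by
    rw [Finset.card_pi]
    exact Finset.prod_le_pow_card _ _ _ fun p _ => hS p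
  refine le_trans (Finset.card_le_card_of_injOn (fun x p _ => if p.Prime ∧ p ∣ x.1 then
    some (fun i => ((x.2 i : ℕ) : ZMod p).val) else none) ?_ ?_) hcard
  · intro x hx
    rw [Finset.mem_coe, Finset.mem_pi]
    intro p hp
    beta_reduce
    obtain ⟨hkey, -⟩ := hT x hx
    by_cases h : p.Prime ∧ p ∣ x.1
    · have h2 := hkey.lt_prime p h.1 h.2
      rw [if_pos h]
      simp only [S, dif_pos (show p.Prime ∧ N₀ < p from ⟨h.1, h2⟩)]
      refine Finset.mem_insert_of_mem (Finset.mem_image.2 ⟨fun i => ((x.2 i : ℕ) : ZMod p), ?_, rfl⟩)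
      exact (Set.Finite.mem_toFinset _).2 (hkey.mem_forms p h.1 h.2)
    · rw [if_neg h]
      by_cases h2 : p.Prime ∧ N₀ < p
      · simp [S, dif_pos h2]
      · simp [S, dif_neg h2]
  · intro x hx y hy hxy
    obtain ⟨hkx, hWx⟩ := hT x hx
    obtain ⟨hky, hWy⟩ := hT y hy
    have hval : ∀ p (hp : p ∈ W), (if p.Prime ∧ p ∣ x.1 then
        some (fun i => ((x.2 i : ℕ) : ZMod p).val) else none) =
        (if p.Prime ∧ p ∣ y.1 then some (fun i => ((y.2 i : ℕ) : ZMod p).val) else none) :=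
      fun p hp => congrFun (congrFun hxy p) hp
    have hxy1 : ∀ p : ℕ, p.Prime → p ∣ x.1 → p ∣ y.1 := by
      intro p hp hpx
      have := hval p (hWx p hp hpx)
      rw [if_pos ⟨hp, hpx⟩] at this
      by_contra h
      rw [if_neg fun h' => h h'.2] at this
      exact Option.some_ne_none _ this
    have hyx1 : ∀ p : ℕ, p.Prime → p ∣ y.1 → p ∣ x.1 := by
      intro p hp hpy
      have := hval p (hWy p hp hpy)
      rw [if_pos (⟨hp, hpy⟩ : p.Prime ∧ p ∣ y.1)] at this
      by_contra h
      rw [if_neg fun h' => h h'.2] at this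
      exact Option.some_ne_none _ this.symm
    have h1 : x.1 = y.1 := by
      refine Nat.dvd_antisymm ?_ ?_
      · exact Int.natCast_dvd_natCast.1 (natCast_dvd_of_squarefree hkx.squarefree fun p hp h =>
          Int.natCast_dvd_natCast.2 (hxy1 p hp h))
      · exact Int.natCast_dvd_natCast.1 (natCast_dvd_of_squarefree hky.squarefree fun p hp h =>
          Int.natCast_dvd_natCast.2 (hyx1 p hp h))
    refine hkx.ext_of_forall hky h1 fun p hp hpx i => ?_
    have h2 := hval p (hWx p hp hpx)
    rw [if_pos ⟨hp, hpx⟩, if_pos ⟨hp, hxy1 p hp hpx⟩] at h2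
    have : NeZero p := ⟨hp.ne_zero⟩
    exact ZMod.val_injective p (congrFun (Option.some_injective _ h2) i)

/-- The arithmetic information about a norm form that enters the sieve. -/
structure FormData {n : ℕ} (d : ℕ) (F : MvPolynomial (Fin n) ℤ) where
  /-- the primes exceeding `N₀` are unramified -/
  N₀ : ℕ
  /-- the constant in the bound for the number of keys -/
  K : ℕ
  /-- the constant in the trivial bound for the values of `F` -/
  A : ℕ
  /-- a point at which all the linear factors are normalized -/
  b : Fin n → ℤ
  /-- the normalized linear factors of `F` modulo `p` -/
  forms : ∀ p : ℕ, Set (Fin n → ZMod p)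
  eval_ne_zero : ∀ v : Fin n → ℤ, v ≠ 0 → MvPolynomial.eval v F ≠ 0
  abs_eval_le : ∀ (R : ℕ) (x : Fin n → ℤ), (∀ i, |x i| ≤ R) → |MvPolynomial.eval x F| ≤ A * R ^ d
  natDegree_le : ∀ y v : Fin n → ℤ, (linePoly F y v).natDegree ≤ d
  formVal_base : ∀ p : ℕ, p.Prime → N₀ < p → ∀ c ∈ forms p, formVal c b = 1
  dvd_eval : ∀ p : ℕ, p.Prime → N₀ < p → ∀ c ∈ forms p, ∀ z : Fin n → ℤ, formVal c z = 0 →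
    (p : ℤ) ∣ MvPolynomial.eval z F
  card_forms : ∀ p : ℕ, p.Prime → N₀ < p → (forms p).Finite ∧ (forms p).ncard ≤ d
  exists_mem : ∀ p : ℕ, p.Prime → N₀ < p → ∀ c : Fin n → ZMod p, c ≠ 0 →
    linForm c ∣ F.map (Int.castRingHom (ZMod p)) →
      ∃ c' ∈ forms p, ∀ x : Fin n → ℤ, formVal c x = 0 → formVal c' x = 0
  exists_subgroups : ∀ p : ℕ, p.Prime → N₀ < p → ∀ v : Fin n → ℤ, (∃ i, ¬ (p : ℤ) ∣ v i) →
    ∃ H : Fin d → AddSubgroup (Fin n → ℤ), (∀ j, v ∈ H j ∧ p ∣ (H j).index) ∧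
      ∀ y, (∀ j, y ∉ H j) → HasSimpleRootMod p (linePoly F y v)
  card_keys : ∀ U : ℕ, 1 ≤ U → ∀ T : Finset (ℕ × (Fin n → ℕ)),
    (∀ x ∈ T, IsKey N₀ forms x ∧ x.1 ≤ U) → T.card ≤ K * U

theorem exists_abs_eval_le {n d : ℕ} {F : MvPolynomial (Fin n) ℤ} {L : Fin d → Fin n → ℂ}
    (hF : F.map (Int.castRingHom ℂ) = ∏ j, linForm (L j)) :
    ∃ A : ℕ, ∀ (R : ℕ) (x : Fin n → ℤ), (∀ i, |x i| ≤ R) →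
      |MvPolynomial.eval x F| ≤ A * R ^ d := by
  refine ⟨⌈∏ j, ∑ i, ‖L j i‖⌉₊, fun R x hx => ?_⟩
  have h1 : ((|MvPolynomial.eval x F| : ℤ) : ℝ) = ∏ j, ‖formVal (L j) x‖ := by
    rw [← norm_prod, ← cast_eval_eq_prod_formVal hF x, Complex.norm_intCast, Int.cast_abs]
  have h2 : ∀ j, ‖formVal (L j) x‖ ≤ (∑ i, ‖L j i‖) * R := by
    intro j
    refine (norm_sum_le _ _).trans ?_
    rw [Finset.sum_mul]
    refine Finset.sum_le_sum fun i _ => ?_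
    rw [norm_mul, Complex.norm_intCast]
    refine mul_le_mul_of_nonneg_left ?_ (norm_nonneg _)
    exact_mod_cast hx i
  have h3 : ((|MvPolynomial.eval x F| : ℤ) : ℝ) ≤ ⌈∏ j, ∑ i, ‖L j i‖⌉₊ * (R : ℝ) ^ d := by
    rw [h1]
    calc ∏ j, ‖formVal (L j) x‖ ≤ ∏ j, ((∑ i, ‖L j i‖) * (R : ℝ)) :=
          Finset.prod_le_prod (fun j _ => norm_nonneg _) fun j _ => h2 j
      _ = (∏ j, ∑ i, ‖L j i‖) * (R : ℝ) ^ d := by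
          rw [Finset.prod_mul_distrib, Finset.prod_const, Finset.card_univ, Fintype.card_fin]
      _ ≤ _ := mul_le_mul_of_nonneg_right (Nat.le_ceil _) (by positivity)
  exact_mod_cast h3

theorem exists_card_keys_le {n d : ℕ} {F : MvPolynomial (Fin n) ℤ} {a b : Fin n → ℤ} {θ : ℂ}
    (hθ : IsIntegral ℤ θ) {N₁ : ℕ}
    (G : ∀ p : ℕ, p.Prime → N₁ < p → GoodReduction d F a b (minpoly ℤ θ) p)
    {forms : ∀ p : ℕ, Set (Fin n → ZMod p)}
    (hforms : ∀ p (hp : p.Prime) (hN : N₁ < p), forms p = (G p hp hN).forms) :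
    ∃ N K : ℕ, ∀ N₀, N ≤ N₀ → N₁ ≤ N₀ → ∀ U : ℕ, 1 ≤ U → ∀ T : Finset (ℕ × (Fin n → ℕ)),
      (∀ x ∈ T, IsKey N₀ forms x ∧ x.1 ≤ U) → T.card ≤ K * U := by
  obtain ⟨N, K, hN, hK⟩ := exists_card_root_pairs_le hθ
  refine ⟨N, K, fun N₀ hNN hN₁ U hU T hT => ?_⟩
  classical
  let r : ℕ × (Fin n → ℕ) → ℤ := fun x => MvPolynomial.eval b F * ∑ i, (x.2 i : ℤ) * a i
  have hr : ∀ (x : ℕ × (Fin n → ℕ)) (p : ℕ), ((r x : ℤ) : ZMod p) =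
      ((MvPolynomial.eval b F : ℤ) : ZMod p) * formVal (fun i => ((x.2 i : ℕ) : ZMod p)) a := by
    intro x p
    simp [r, formVal]
  let f : ℕ × (Fin n → ℕ) → ℕ × ℕ := fun x => (x.1, ((r x : ℤ) : ZMod x.1).val)
  have hf : ∀ x ∈ T, ((f x).2 : ℤ) % x.1 = r x % x.1 := by
    intro x hx
    have : NeZero x.1 := ⟨(hT x hx).1.pos.ne'⟩
    rw [← Int.ModEq, ← ZMod.intCast_eq_intCast_iff]
    simp [f]
  have hinj : Set.InjOn f T := by
    intro x hx y hy hxy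
    have h1 : x.1 = y.1 := congrArg (Prod.fst : ℕ × ℕ → ℕ) hxy
    refine (hT x hx).1.ext_of_forall (hT y hy).1 h1 fun p hp hpx i => ?_
    have hpN : N₁ < p := hN₁.trans_lt ((hT x hx).1.lt_prime p hp hpx)
    have : Fact p.Prime := ⟨hp⟩
    have hxf := (hT x hx).1.mem_forms p hp hpx
    have hyf := (hT y hy).1.mem_forms p hp (h1 ▸ hpx)
    rw [hforms p hp hpN] at hxf hyf
    refine congrFun ((G p hp hpN).forms_injOn hxf hyf ?_) i
    rw [← hr, ← hr, ZMod.intCast_eq_intCast_iff]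
    have h2 : r x ≡ r y [ZMOD x.1] := by
      have h3 := hf x hx
      have h4 := hf y hy
      rw [hxy, h1] at h3
      rw [h1]
      exact h3.symm.trans h4
    exact h2.of_dvd (Int.natCast_dvd_natCast.2 hpx)
  rw [← Finset.card_image_of_injOn hinj]
  refine hK U hU _ fun y hy => ?_
  obtain ⟨x, hx, rfl⟩ := Finset.mem_image.1 hy
  obtain ⟨hkey, hxU⟩ := hT x hx
  have : NeZero x.1 := ⟨hkey.pos.ne'⟩
  refine ⟨hkey.pos, hxU, ZMod.val_lt _, ?_, ?_⟩
  · refine Nat.Coprime.symm (Nat.coprime_of_dvd fun p hp hpN hpx => ?_)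
    exact absurd (Nat.le_of_dvd hN hpN) (not_le.2 (hNN.trans_lt (hkey.lt_prime p hp hpx)))
  · refine natCast_dvd_of_squarefree hkey.squarefree fun p hp hpx => ?_
    have hpN : N₁ < p := hN₁.trans_lt (hkey.lt_prime p hp hpx)
    have : Fact p.Prime := ⟨hp⟩
    have hxf := hkey.mem_forms p hp hpx
    rw [hforms p hp hpN] at hxf
    have h1 := (G p hp hpN).eval₂_eq_zero hxf
    rw [← hr] at h1
    rw [← ZMod.intCast_zmod_eq_zero_iff_dvd, ← h1]
    have h2 : ((r x : ℤ) : ZMod p) = (((f x).2 : ℤ) : ZMod p) := by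
      rw [ZMod.intCast_eq_intCast_iff]
      exact Int.ModEq.of_dvd (Int.natCast_dvd_natCast.2 hpx) (hf x hx).symm
    rw [h2]
    exact (Polynomial.eval₂_at_apply (Int.castRingHom (ZMod p)) _).symm

theorem nonempty_formData {n d : ℕ} (hn : 2 ≤ n) (hd : n < d) {F : MvPolynomial (Fin n) ℤ}
    {L : Fin d → Fin n → ℂ} (hF : IsDecomp F L)
    (hirr : Irreducible (F.map (Int.castRingHom ℚ))) (hΔ : discProd L ≠ 0) :
    Nonempty (FormData d F) := by
  classical
  obtain ⟨a, b, hb, ha⟩ := exists_separating_points hn hd hΔ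
  let j₀ : Fin d := ⟨0, by omega⟩
  obtain ⟨N₁, hN₁⟩ := exists_goodReduction hd.le hF hirr hΔ hb ha j₀
  let G : ∀ p : ℕ, p.Prime → N₁ < p →
      GoodReduction d F a b (minpoly ℤ (ratioVal L a b j₀)) p :=
    fun p hp hN => (hN₁ p hp hN).some
  let forms : ∀ p : ℕ, Set (Fin n → ZMod p) := fun p =>
    if h : p.Prime ∧ N₁ < p then (G p h.1 h.2).forms else ∅
  have hforms : ∀ p (hp : p.Prime) (hN : N₁ < p), forms p = (G p hp hN).forms :=
    fun p hp hN => dif_pos ⟨hp, hN⟩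
  obtain ⟨N, K, hK⟩ := exists_card_keys_le (isIntegral_ratioVal hF.1 a b j₀) G hforms
  obtain ⟨A, hA⟩ := exists_abs_eval_le hF.2
  refine ⟨⟨max N N₁, K, A, b, forms, fun v hv => eval_ne_zero_of_irreducible hd.le hF hirr hΔ hb ha hv,
    hA, natDegree_linePoly_le hF.2, fun p hp hN c hc => ?_, fun p hp hN c hc z hz => ?_,
    fun p hp hN => ?_, fun p hp hN c hc hdvd => ?_, fun p hp hN v hv => ?_,
    hK _ (le_max_left _ _) (le_max_right _ _)⟩⟩
  all_goals
    have hN' : N₁ < p := (le_max_right _ _).trans_lt hN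
    have : Fact p.Prime := ⟨hp⟩
  · rw [hforms p hp hN'] at hc
    exact (G p hp hN').formVal_base hc
  · rw [hforms p hp hN'] at hc
    exact (G p hp hN').dvd_eval_of_formVal_eq_zero hc hz
  · rw [hforms p hp hN']
    exact ⟨(G p hp hN').finite_forms, (G p hp hN').ncard_forms_le⟩
  · rw [hforms p hp hN']
    exact (G p hp hN').exists_mem_forms hc hdvd
  · exact (G p hp hN').exists_subgroups hp (by omega) hv

/-! ### The sieve in a fixed lattice -/

/-- A bound for the number of points of a lattice with shortest vector `v` lying in a box and in
a hyperplane, but not on the line spanned by `v`. -/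
def hyperplaneBound {n : ℕ} (R : ℕ) (v : Fin n → ℤ) : ℝ :=
  if n = 2 then 0 else ((2 * n * R / supNorm v + 1 : ℕ) : ℝ) ^ (n - 1)

theorem hyperplaneBound_nonneg {n : ℕ} (R : ℕ) (v : Fin n → ℤ) : 0 ≤ hyperplaneBound R v := by
  unfold hyperplaneBound
  split_ifs <;> positivity

theorem card_le_of_mem_sublattice {n R s : ℕ} (hn : 2 ≤ n) {Λ M : AddSubgroup (Fin n → ℤ)}
    (hMΛ : M ≤ Λ) {v : Fin n → ℤ} (hv : v ∈ M) (hv0 : v ≠ 0)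
    (hmin : ∀ z ∈ Λ, z ≠ 0 → supNorm v ≤ supNorm z) (hvR : v ∈ intBox n R) (hs : 0 < s)
    (hsM : s ∣ M.index) (T : Finset (Fin n → ℤ))
    (hT : ∀ y ∈ T, y ∈ M ∧ y ∈ intBox n R ∧ ∀ q : ℤ, y ≠ q • v) :
    (T.card : ℝ) ≤ (2 * ((n + 1) * R) + 1 : ℝ) ^ n / s + hyperplaneBound R v := by
  rcases exists_linearIndependent_or_hyperplane (insert v (T : Set (Fin n → ℤ))) with
    ⟨w, hw, hli⟩ | ⟨h, hh, hT'⟩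
  · have hw' : ∀ i, w i ∈ M ∧ w i ∈ intBox n R := by
      intro i
      rcases hw i with h | h
      · rw [h]; exact ⟨hv, hvR⟩
      · exact ⟨(hT _ h).1, (hT _ h).2.1⟩
    obtain ⟨h0, h1⟩ := card_mul_index_le_of_span M w (fun i => (hw' i).1) (fun i => (hw' i).2) hli T
      fun x hx => ⟨(hT x hx).1, (hT x hx).2.1⟩
    have h2 : T.card * s ≤ (2 * ((n + 1) * R) + 1) ^ n :=
      (Nat.mul_le_mul_left _ (Nat.le_of_dvd (Nat.pos_of_ne_zero h0) hsM)).trans h1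
    have h3 : (T.card : ℝ) ≤ (2 * ((n + 1) * R) + 1 : ℝ) ^ n / s := by
      rw [le_div_iff₀ (by exact_mod_cast hs)]
      exact_mod_cast h2
    exact h3.trans (le_add_of_nonneg_right (hyperplaneBound_nonneg _ _))
  · have ha : (0 : ℝ) ≤ (2 * ((n + 1) * R) + 1 : ℝ) ^ n / s := by positivity
    refine le_trans ?_ (le_add_of_nonneg_left ha)
    unfold hyperplaneBound
    split_ifs with h2
    · suffices T = ∅ by simp [this]
      rw [Finset.eq_empty_iff_forall_notMem]
      intro y hy
      subst h2
      have e1 := hT' y (Set.mem_insert_of_mem _ hy)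
      have e2 := hT' v (Set.mem_insert _ _)
      simp only [Fin.sum_univ_two] at e1 e2
      have key : (y 0 * v 1 : ℤ) = y 1 * v 0 := by
        have : (y 0 * v 1 : ℚ) = y 1 * v 0 := by
          by_cases h0 : h 0 = 0
          · have h1 : h 1 ≠ 0 := by
              intro h1
              refine hh (funext fun i => ?_)
              fin_cases i <;> simp [h0, h1]
            have a1 : (y 1 : ℚ) = 0 := by simpa [h0, h1] using e1
            have a2 : (v 1 : ℚ) = 0 := by simpa [h0, h1] using e2
            rw [a1, a2]; ring
          · apply mul_left_cancel₀ h0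
            linear_combination (v 1 : ℚ) * e1 - (y 1 : ℚ) * e2
        exact_mod_cast this
      obtain ⟨q, hq⟩ := exists_smul_eq_of_parallel (by norm_num) Λ (hMΛ hv) hv0 hmin
        (hMΛ (hT y hy).1) (y := y) (by
          intro i j
          fin_cases i <;> fin_cases j <;> simp [key])
      exact (hT y hy).2.2 q hq
    · have := card_le_of_hyperplane Λ (supNorm_pos hv0) hmin h hh T (R := R) fun x hx =>
        ⟨hMΛ (hT x hx).1, (hT x hx).2.1, hT' x (Set.mem_insert_of_mem _ hx)⟩
      exact_mod_cast this

open Classical in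
theorem sum_prod_indicator_le {n d R : ℕ} (hn : 2 ≤ n) {Λ : AddSubgroup (Fin n → ℤ)}
    {v : Fin n → ℤ} (hv0 : v ≠ 0)
    (hmin : ∀ z ∈ Λ, z ≠ 0 → supNorm v ≤ supNorm z) (hvR : v ∈ intBox n R)
    (Y : Finset (Fin n → ℤ)) (hY : ∀ y ∈ Y, y ∈ intBox n R ∧ ∀ q : ℤ, y ≠ q • v)
    (H : ℕ → Fin d → AddSubgroup (Fin n → ℤ)) (E : Finset ℕ)
    (hE : ∀ p ∈ E, p.Prime ∧ ∀ j, v ∈ H p j ∧ p ∣ (H p j).index) :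
    ∀ (M : AddSubgroup (Fin n → ℤ)) (s : ℕ), M ≤ Λ → v ∈ M → 0 < s → s ∣ M.index →
      (∀ p ∈ E, p.Coprime s) →
      ∑ y ∈ Y with y ∈ M, ∏ p ∈ E, (7 / 8 + ∑ j, if y ∈ H p j then (1 : ℝ) else 0) ≤
        (2 * ((n + 1) * R) + 1 : ℝ) ^ n / s * ∏ p ∈ E, (7 / 8 + d / (p : ℝ)) +
          hyperplaneBound R v * ∏ _p ∈ E, (7 / 8 + (d : ℝ)) := by
  induction E using Finset.induction_on with
  | empty =>
    intro M s hM hv hs hsM _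
    simp only [Finset.prod_empty, Finset.sum_const, nsmul_eq_mul, mul_one]
    refine card_le_of_mem_sublattice hn hM hv hv0 hmin hvR hs hsM _ fun y hy => ?_
    rw [Finset.mem_filter] at hy
    exact ⟨hy.2, hY y hy.1⟩
  | insert p E hpE ih =>
    intro M s hM hv hs hsM hcop
    have ih' := ih fun q hq => hE q (Finset.mem_insert_of_mem hq)
    obtain ⟨hp, hHp⟩ := hE p (Finset.mem_insert_self _ _)
    set W : (Fin n → ℤ) → ℝ := fun y =>
      ∏ q ∈ E, (7 / 8 + ∑ j, if y ∈ H q j then (1 : ℝ) else 0) with hW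
    have hsplit : ∑ y ∈ Y with y ∈ M, ∏ q ∈ insert p E,
          (7 / 8 + ∑ j, if y ∈ H q j then (1 : ℝ) else 0) =
        7 / 8 * ∑ y ∈ Y with y ∈ M, W y + ∑ j, ∑ y ∈ Y with y ∈ M ⊓ H p j, W y := by
      have h1 : ∀ j, ∑ y ∈ Y with y ∈ M ⊓ H p j, W y =
          ∑ y ∈ Y with y ∈ M, (if y ∈ H p j then (1 : ℝ) else 0) * W y := by
        intro j
        simp only [AddSubgroup.mem_inf]
        rw [← Finset.filter_filter, Finset.sum_filter]
        exact Finset.sum_congr rfl fun y _ => by split_ifs <;> simp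
      simp_rw [h1]
      rw [Finset.sum_comm, Finset.mul_sum, ← Finset.sum_add_distrib]
      refine Finset.sum_congr rfl fun y _ => ?_
      rw [Finset.prod_insert hpE, ← Finset.sum_mul, hW]
      ring
    have hI0 := ih' M s hM hv hs hsM fun q hq => hcop q (Finset.mem_insert_of_mem hq)
    have hIj : ∀ j, ∑ y ∈ Y with y ∈ M ⊓ H p j, W y ≤
        (2 * ((n + 1) * R) + 1 : ℝ) ^ n / (s * p : ℕ) * ∏ q ∈ E, (7 / 8 + d / (q : ℝ)) +
          hyperplaneBound R v * ∏ _q ∈ E, (7 / 8 + (d : ℝ)) := by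
      intro j
      refine ih' (M ⊓ H p j) (s * p) (inf_le_left.trans hM) ⟨hv, (hHp j).1⟩
        (Nat.mul_pos hs hp.pos) ?_ ?_
      · refine Nat.Coprime.mul_dvd_of_dvd_of_dvd
          (hcop p (Finset.mem_insert_self _ _)).symm
          (hsM.trans (AddSubgroup.index_dvd_of_le inf_le_left))
          ((hHp j).2.trans (AddSubgroup.index_dvd_of_le inf_le_right))
      · intro q hq
        refine Nat.Coprime.mul_right (hcop q (Finset.mem_insert_of_mem hq)) ?_
        rw [Nat.coprime_primes (hE q (Finset.mem_insert_of_mem hq)).1 hp]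
        rintro rfl
        exact hpE hq
    rw [hsplit, Finset.prod_insert hpE, Finset.prod_insert hpE]
    have h2 := Finset.sum_le_sum fun j (_ : j ∈ Finset.univ) => hIj j
    rw [Finset.sum_const, Finset.card_univ, Fintype.card_fin, nsmul_eq_mul] at h2
    have hp0 : (p : ℝ) ≠ 0 := by exact_mod_cast hp.ne_zero
    have hs0 : (s : ℝ) ≠ 0 := by exact_mod_cast hs.ne'
    calc _ ≤ 7 / 8 * ((2 * ((n + 1) * R) + 1 : ℝ) ^ n / s * ∏ q ∈ E, (7 / 8 + d / (q : ℝ)) +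
          hyperplaneBound R v * ∏ _q ∈ E, (7 / 8 + (d : ℝ))) + d *
          ((2 * ((n + 1) * R) + 1 : ℝ) ^ n / (s * p : ℕ) * ∏ q ∈ E, (7 / 8 + d / (q : ℝ)) +
          hyperplaneBound R v * ∏ _q ∈ E, (7 / 8 + (d : ℝ))) :=
          add_le_add (mul_le_mul_of_nonneg_left hI0 (by norm_num)) h2
      _ = _ := by
          push_cast
          field_simp
          ring

theorem card_le_of_forall_eq_smul {n M₀ : ℕ} (hM₀ : 0 < M₀) {v : Fin n → ℤ}
    (X : Finset (Fin n → ℤ))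
    (hX : ∀ z ∈ X, (∃ q : ℤ, z = q • v) ∧ ∀ (m : ℤ) (y : Fin n → ℤ), z = m • y → |m| ≤ M₀) :
    X.card ≤ 3 * M₀ := by
  classical
  have h1 : X ⊆ (Finset.Icc (-(M₀ : ℤ)) M₀).image fun q : ℤ => q • v := by
    intro z hz
    obtain ⟨⟨q, hq⟩, h⟩ := hX z hz
    rw [Finset.mem_image]
    exact ⟨q, Finset.mem_Icc.2 (abs_le.1 (h q v hq)), hq.symm⟩
  have h2 := (Finset.card_le_card h1).trans Finset.card_image_le
  rw [Int.card_Icc] at h2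
  omega

/-- If the value of `F` at `z` is, up to the primes in `P`, a `k`-th power times `u`. -/
def IsPowerShape {n : ℕ} (F : MvPolynomial (Fin n) ℤ) (k : ℕ) (P : Finset ℕ) (u : ℕ)
    (z : Fin n → ℤ) : Prop :=
  ∃ (ε : Bool) (w : ℕ → ℕ) (q : ℤ), (∀ p ∈ P, w p < k) ∧ (∀ p ∈ P, ¬ (p : ℤ) ∣ q) ∧
    MvPolynomial.eval z F = (if ε then 1 else -1) * (∏ p ∈ P, (p : ℤ) ^ w p) * u * q ^ k

theorem FormData.card_le_of_key {n d k R : ℕ} {F : MvPolynomial (Fin n) ℤ} (D : FormData d F)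
    (hn : 2 ≤ n) (hk : 2 ≤ k) {x : ℕ × (Fin n → ℕ)} (hx : IsKey D.N₀ D.forms x)
    {v : Fin n → ℤ} (hv : v ∈ keyLattice x) (hv0 : v ≠ 0)
    (hmin : ∀ z ∈ keyLattice x, z ≠ 0 → supNorm v ≤ supNorm z) (hvn : supNorm v ^ n ≤ x.1)
    (P E : Finset ℕ) (hP : ∀ p ∈ P, p.Prime ∧ ¬ p ∣ x.1) (hEP : E ⊆ P)
    (hE : ∀ p ∈ E, k ∣ p - 1 ∧ 9 * k * (d + 2) ^ 3 ≤ p ∧ 16 * d ≤ p ∧ D.N₀ < p)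
    (hM₀ : (∏ p ∈ P, p ^ k) ^ 2 * x.1 ≤ R ^ 2) (X : Finset (Fin n → ℤ))
    (hX : ∀ z ∈ X, z ∈ keyLattice x ∧ z ∈ intBox n R ∧ IsPowerShape F k P x.1 z ∧
      ∀ (m : ℤ) (y : Fin n → ℤ), z = m • y → |m| ≤ (∏ p ∈ P, p ^ k : ℕ)) :
    (X.card : ℝ) ≤ 3 * (∏ p ∈ P, p ^ k : ℕ) +
      4 * ((2 * ((n + 1) * (2 * R : ℕ)) + 1 : ℝ) ^ n / x.1 * (15 / 16) ^ E.card +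
        hyperplaneBound (2 * R) v * (d + 1) ^ E.card) := by
  classical
  set M₀ := ∏ p ∈ P, p ^ k with hM₀def
  have hM₀pos : 0 < M₀ := Finset.prod_pos fun p hp => pow_pos (hP p hp).1.pos _
  have hvpos := supNorm_pos hv0
  have hvM : M₀ * supNorm v ≤ R := by
    have h1 : supNorm v ^ 2 ≤ x.1 := (Nat.pow_le_pow_right hvpos hn).trans hvn
    refine le_of_pow_le_pow_left₀ two_ne_zero (Nat.zero_le _) ?_
    rw [mul_pow]
    exact (Nat.mul_le_mul_left _ h1).trans hM₀
  set T := R / supNorm v with hT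
  have hMT : M₀ ≤ T := (Nat.le_div_iff_mul_le hvpos).2 hvM
  have hTpos : 0 < T := hM₀pos.trans_le hMT
  have hTv : T * supNorm v ≤ R := Nat.div_mul_le_self _ _
  -- the points on the line spanned by the shortest vector
  have hline : ((X.filter fun z => ∃ q : ℤ, z = q • v).card : ℝ) ≤ 3 * M₀ := by
    exact_mod_cast card_le_of_forall_eq_smul hM₀pos (X.filter fun z => ∃ q : ℤ, z = q • v)
      fun z hz => ⟨(Finset.mem_filter.1 hz).2, (hX z (Finset.mem_filter.1 hz).1).2.2.2⟩
  set X' := X.filter fun z => ¬ ∃ q : ℤ, z = q • v with hX'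
  set Y := (intBox n (2 * R)).filter fun y => y ∈ keyLattice x ∧ ∀ q : ℤ, y ≠ q • v with hYdef
  have hvp : ∀ p ∈ E, ∃ i, ¬ (p : ℤ) ∣ v i := by
    intro p hp
    by_contra! hcon
    choose z hz using hcon
    have hvz : v = (p : ℤ) • z := funext fun i => by simp [hz i]
    have hzΛ : z ∈ keyLattice x := by
      rw [mem_keyLattice] at hv ⊢
      have e : ∑ i, (x.2 i : ℤ) * v i = p * ∑ i, (x.2 i : ℤ) * z i := by
        rw [Finset.mul_sum]
        exact Finset.sum_congr rfl fun i _ => by rw [hz i]; ring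
      rw [e] at hv
      refine IsCoprime.dvd_of_dvd_mul_left ?_ hv
      rw [Nat.isCoprime_iff_coprime, Nat.coprime_comm]
      exact ((hP p (hEP hp)).1.coprime_iff_not_dvd).2 (hP p (hEP hp)).2
    have hz0 : z ≠ 0 := by
      rintro rfl
      exact hv0 (by rw [hvz, smul_zero])
    have h1 := hmin z hzΛ hz0
    obtain ⟨i, hi⟩ := exists_abs_eq_supNorm (by omega) z
    have h2 := abs_le_supNorm v i
    rw [hz i, abs_mul, hi, Nat.abs_cast] at h2
    have h3 : p * supNorm z ≤ supNorm v := by exact_mod_cast h2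
    have h4 := (hP p (hEP hp)).1.two_le
    have h5 := supNorm_pos hz0
    nlinarith
  have hsub : ∀ p, ∃ H : Fin d → AddSubgroup (Fin n → ℤ), p ∈ E →
      (∀ j, v ∈ H j ∧ p ∣ (H j).index) ∧
      ∀ y, (∀ j, y ∉ H j) → HasSimpleRootMod p (linePoly F y v) := by
    intro p
    by_cases hp : p ∈ E
    · obtain ⟨H, hH⟩ := D.exists_subgroups p (hP p (hEP hp)).1 (hE p hp).2.2.2 v (hvp p hp)
      exact ⟨H, fun _ => hH⟩
    · exact ⟨fun _ => ⊤, fun h => absurd h hp⟩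
  choose H hH using hsub
  have hfib : ∀ y ∈ Y, (((Finset.range T).filter fun t : ℕ => y + (t : ℤ) • v ∈ X').card : ℝ) ≤
      4 * T * ∏ p ∈ E, (7 / 8 + ∑ j, if y ∈ H p j then (1 : ℝ) else 0) := by
    intro y _
    have h1 := card_le_of_simple_roots (k := k) (ℓ := k) (d := d) (T := T) (by omega) hk dvd_rfl
      (linePoly F y v) (D.natDegree_le y v) P (E.filter fun p => ∀ j, y ∉ H p j)
      (fun p hp => (hP p hp).1) ((Finset.filter_subset _ _).trans hEP)
      (fun p hp => by
        obtain ⟨h1, h2⟩ := Finset.mem_filter.1 hp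
        exact ⟨(hE p h1).1, (hE p h1).2.1, (hH p h1).2 y h2⟩)
      x.1 (fun p hp h => (hP p hp).2 (by exact_mod_cast h))
      ((Finset.range T).filter fun t : ℕ => y + (t : ℤ) • v ∈ X')
      (fun t ht => by
        obtain ⟨h1, h2⟩ := Finset.mem_filter.1 ht
        obtain ⟨ε, w, q, hw, hq, he⟩ := (hX _ (Finset.mem_filter.1 h2).1).2.2.1
        exact ⟨Finset.mem_range.1 h1, ε, w, q, hw, hq, by rw [eval_linePoly, he]⟩) hMT
    refine h1.trans (mul_le_mul_of_nonneg_left ?_ (by positivity))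
    rw [← Finset.prod_const, Finset.prod_filter]
    refine Finset.prod_le_prod (fun p _ => by split_ifs <;> norm_num) fun p _ => ?_
    split_ifs with h
    · exact le_add_of_nonneg_right (Finset.sum_nonneg fun j _ => by split_ifs <;> norm_num)
    · push Not at h
      obtain ⟨j, hj⟩ := h
      have := Finset.single_le_sum (f := fun j => if y ∈ H p j then (1 : ℝ) else 0)
        (fun j _ => by split_ifs <;> norm_num) (Finset.mem_univ j)
      simp only [hj, if_true] at this
      linarith
  have hcount : (T : ℝ) * X'.card ≤
      ∑ y ∈ Y, (((Finset.range T).filter fun t : ℕ => y + (t : ℤ) • v ∈ X').card : ℝ) := by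
    have h1 := Finset.sum_card_bipartiteAbove_eq_sum_card_bipartiteBelow
      (fun (y : Fin n → ℤ) (t : ℕ) => y + (t : ℤ) • v ∈ X') (s := Y) (t := Finset.range T)
    have h2 : T * X'.card ≤ ∑ t ∈ Finset.range T,
        (Y.bipartiteBelow (fun (y : Fin n → ℤ) (t : ℕ) => y + (t : ℤ) • v ∈ X') t).card := by
      have : T * X'.card = ∑ t ∈ Finset.range T, X'.card := by simp
      rw [this]
      refine Finset.sum_le_sum fun t ht => ?_
      refine Finset.card_le_card_of_injOn (fun z => z - (t : ℤ) • v) ?_ ?_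
      · intro z hz
        have hz' := Finset.mem_coe.1 hz
        obtain ⟨hzX, hzv⟩ := Finset.mem_filter.1 hz'
        obtain ⟨hzΛ, hzR, -⟩ := hX z hzX
        rw [Finset.mem_coe, Finset.mem_bipartiteBelow, hYdef, Finset.mem_filter]
        refine ⟨⟨mem_intBox.2 fun i => ?_, sub_mem hzΛ (zsmul_mem hv _), fun q hq => hzv ?_⟩, ?_⟩
        · have a1 := mem_intBox.1 hzR i
          have a2 := abs_le_supNorm v i
          have a3 : (t : ℤ) * supNorm v ≤ R := by
            have := (Nat.mul_le_mul_right (supNorm v) (Finset.mem_range.1 ht).le).trans hTv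
            exact_mod_cast this
          have a4 : |(t : ℤ) * v i| ≤ t * supNorm v := by
            rw [abs_mul, Nat.abs_cast]
            exact mul_le_mul_of_nonneg_left a2 (by positivity)
          have a5 : |z i - t * v i| ≤ |z i| + |t * v i| := abs_sub _ _
          simp only [Pi.sub_apply, Pi.smul_apply, smul_eq_mul]
          push_cast
          linarith
        · exact ⟨q + t, by rw [add_smul, ← hq, sub_add_cancel]⟩
        · simpa using hz'
      · intro z _ z' _ h
        simpa using h
    rw [← h1] at h2
    exact_mod_cast h2
  have hYM : Y.filter (fun y => y ∈ keyLattice x) = Y :=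
    Finset.filter_true_of_mem fun y hy => (Finset.mem_filter.1 hy).2.1
  have hidx := hx.index_keyLattice D.formVal_base
  have hmain := sum_prod_indicator_le (R := 2 * R) hn hv0 hmin
    (mem_intBox.2 fun i => (abs_le_supNorm v i).trans (by
      have : supNorm v ≤ R := (Nat.le_mul_of_pos_left _ hM₀pos).trans hvM
      push_cast
      omega)) Y (fun y hy => ⟨(Finset.mem_filter.1 hy).1, (Finset.mem_filter.1 hy).2.2⟩) H E
    (fun p hp => ⟨(hP p (hEP hp)).1, (hH p hp).1⟩) (keyLattice x) x.1 le_rfl hv hx.pos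
    (by rw [hidx]) (fun p hp =>
      ((hP p (hEP hp)).1.coprime_iff_not_dvd).2 (hP p (hEP hp)).2)
  rw [hYM] at hmain
  have hX'le : (X'.card : ℝ) ≤ 4 * ∑ y ∈ Y, ∏ p ∈ E,
      (7 / 8 + ∑ j, if y ∈ H p j then (1 : ℝ) else 0) := by
    have h1 := hcount.trans (Finset.sum_le_sum hfib)
    rw [← Finset.mul_sum] at h1
    have hT0 : (0 : ℝ) < T := by exact_mod_cast hTpos
    refine le_of_mul_le_mul_left ?_ hT0
    linarith
  have hprod1 : ∏ p ∈ E, (7 / 8 + d / (p : ℝ)) ≤ (15 / 16) ^ E.card := by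
    rw [← Finset.prod_const]
    refine Finset.prod_le_prod (fun p _ => by positivity) fun p hp => ?_
    have hp0 : (0 : ℝ) < p := by exact_mod_cast (hP p (hEP hp)).1.pos
    have h1 : (16 * d : ℝ) ≤ p := by exact_mod_cast (hE p hp).2.2.1
    have : d / (p : ℝ) ≤ 1 / 16 := by rw [div_le_iff₀ hp0]; linarith
    linarith
  have hprod2 : ∏ _p ∈ E, (7 / 8 + (d : ℝ)) ≤ (d + 1) ^ E.card := by
    rw [Finset.prod_const]
    exact pow_le_pow_left₀ (by positivity) (by linarith) _
  have hcard : (X.card : ℝ) = (X.filter fun z => ∃ q : ℤ, z = q • v).card + X'.card := by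
    exact_mod_cast (Finset.card_filter_add_card_filter_not (s := X)
      (fun z => ∃ q : ℤ, z = q • v)).symm
  rw [hcard]
  refine add_le_add hline (hX'le.trans (mul_le_mul_of_nonneg_left (hmain.trans ?_) (by norm_num)))
  push_cast
  exact add_le_add (mul_le_mul_of_nonneg_left hprod1 (by positivity))
    (mul_le_mul_of_nonneg_left hprod2 (hyperplaneBound_nonneg _ _))

/-! ### Sums over keys -/

theorem FormData.sum_one_div_le {n d : ℕ} {F : MvPolynomial (Fin n) ℤ} (D : FormData d F)
    {U₀ U₁ : ℕ} (hU₀ : 1 ≤ U₀) (T : Finset (ℕ × (Fin n → ℕ)))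
    (hT : ∀ x ∈ T, IsKey D.N₀ D.forms x ∧ U₀ ≤ x.1 ∧ x.1 ≤ U₁) :
    ∑ x ∈ T, (1 / x.1 : ℝ) ≤ 2 * D.K * (Nat.log 2 U₁ + 1 - Nat.log 2 U₀ : ℕ) := by
  have hmaps : ∀ x ∈ T, Nat.log 2 x.1 ∈ Finset.Icc (Nat.log 2 U₀) (Nat.log 2 U₁) := by
    intro x hx
    exact Finset.mem_Icc.2 ⟨Nat.log_mono_right (hT x hx).2.1, Nat.log_mono_right (hT x hx).2.2⟩
  rw [← Finset.sum_fiberwise_of_maps_to hmaps]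
  have hj : ∀ j ∈ Finset.Icc (Nat.log 2 U₀) (Nat.log 2 U₁),
      ∑ x ∈ T with Nat.log 2 x.1 = j, (1 / x.1 : ℝ) ≤ 2 * D.K := by
    intro j _
    have h1 : ∀ x ∈ T.filter (fun x => Nat.log 2 x.1 = j), (1 / x.1 : ℝ) ≤ 1 / 2 ^ j := by
      intro x hx
      obtain ⟨hxT, hxj⟩ := Finset.mem_filter.1 hx
      have h : 2 ^ j ≤ x.1 := hxj ▸ Nat.pow_log_le_self 2 (by have := (hT x hxT).2.1; omega)
      exact one_div_le_one_div_of_le (by positivity) (by exact_mod_cast h)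
    have h2 := D.card_keys (2 ^ (j + 1)) Nat.one_le_two_pow
      (T.filter fun x => Nat.log 2 x.1 = j) fun x hx => by
        obtain ⟨hxT, hxj⟩ := Finset.mem_filter.1 hx
        exact ⟨(hT x hxT).1, hxj ▸ (Nat.lt_pow_succ_log_self (by norm_num) _).le⟩
    have h2' : ((T.filter fun x => Nat.log 2 x.1 = j).card : ℝ) ≤ D.K * 2 ^ (j + 1) := by
      exact_mod_cast h2
    calc _ ≤ (T.filter fun x => Nat.log 2 x.1 = j).card • (1 / 2 ^ j : ℝ) :=
          Finset.sum_le_card_nsmul _ _ _ h1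
      _ ≤ D.K * 2 ^ (j + 1) * (1 / 2 ^ j) := by
          rw [nsmul_eq_mul]
          exact mul_le_mul_of_nonneg_right h2' (by positivity)
      _ = 2 * D.K := by
          rw [pow_succ]
          field_simp
  refine (Finset.sum_le_card_nsmul _ _ _ hj).trans_eq ?_
  rw [Nat.card_Icc, nsmul_eq_mul]
  ring

theorem card_supNorm_eq_le {n : ℕ} (m : ℕ) (S : Finset (Fin n → ℤ))
    (hS : ∀ w ∈ S, w ≠ 0 ∧ supNorm w = m) : S.card ≤ 2 * n * (2 * m + 1) ^ (n - 1) := by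
  classical
  have hsub : S ⊆ Finset.univ.biUnion fun i : Fin n =>
      Fintype.piFinset (Function.update (fun _ => Finset.Icc (-(m : ℤ)) m) i
        ({(m : ℤ), -(m : ℤ)} : Finset ℤ)) := by
    intro w hw
    obtain ⟨hw0, hwm⟩ := hS w hw
    have hn : 0 < n := by
      rcases Nat.eq_zero_or_pos n with rfl | h
      · exact absurd (Subsingleton.elim _ _) hw0
      · exact h
    obtain ⟨i, hi⟩ := exists_abs_eq_supNorm hn w
    rw [Finset.mem_biUnion]
    refine ⟨i, Finset.mem_univ _, Fintype.mem_piFinset.2 fun j => ?_⟩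
    by_cases hj : j = i
    · subst hj
      rw [hwm] at hi
      rcases (abs_eq (by positivity)).1 hi with h | h <;> simp [h]
    · rw [Function.update_of_ne hj, Finset.mem_Icc]
      exact abs_le.1 (hwm ▸ abs_le_supNorm w j)
  have h1 : ∀ i ∈ (Finset.univ : Finset (Fin n)), (Fintype.piFinset
      (Function.update (fun _ => Finset.Icc (-(m : ℤ)) m) i ({(m : ℤ), -(m : ℤ)} : Finset ℤ))).card ≤
      2 * (2 * m + 1) ^ (n - 1) := by
    intro i hi
    rw [Fintype.card_piFinset, ← Finset.mul_prod_erase _ _ hi]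
    refine Nat.mul_le_mul ?_ (le_of_eq ?_)
    · rw [Function.update_self]
      exact Finset.card_le_two
    · rw [Finset.prod_congr rfl fun j hj => by
        rw [Function.update_of_ne (Finset.ne_of_mem_erase hj)], Finset.prod_const,
        Finset.card_erase_of_mem hi, Finset.card_univ, Fintype.card_fin, Int.card_Icc]
      congr 1
      omega
  refine (Finset.card_le_card hsub).trans ((Finset.card_biUnion_le).trans
    ((Finset.sum_le_card_nsmul _ _ _ h1).trans_eq ?_))
  rw [Finset.card_univ, Fintype.card_fin, smul_eq_mul]
  ring

theorem sum_inv_supNorm_le {n V : ℕ} (S : Finset (Fin n → ℤ))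
    (hS : ∀ w ∈ S, w ≠ 0 ∧ supNorm w ≤ V) :
    ∑ w ∈ S, (1 / (supNorm w : ℝ)) ^ (n - 1) ≤ 2 * n * 3 ^ (n - 1) * V := by
  have hmaps : ∀ w ∈ S, supNorm w ∈ Finset.Icc 1 V := fun w hw =>
    Finset.mem_Icc.2 ⟨supNorm_pos (hS w hw).1, (hS w hw).2⟩
  rw [← Finset.sum_fiberwise_of_maps_to hmaps]
  have hj : ∀ m ∈ Finset.Icc 1 V, ∑ w ∈ S with supNorm w = m, (1 / (supNorm w : ℝ)) ^ (n - 1) ≤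
      2 * n * 3 ^ (n - 1) := by
    intro m hm
    have hm1 := (Finset.mem_Icc.1 hm).1
    have hm0 : (0 : ℝ) < m := by exact_mod_cast hm1
    have h1 := card_supNorm_eq_le m (S.filter fun w => supNorm w = m) fun w hw =>
      ⟨(hS w (Finset.mem_filter.1 hw).1).1, (Finset.mem_filter.1 hw).2⟩
    have h2 : ((S.filter fun w => supNorm w = m).card : ℝ) ≤ 2 * n * (3 * m) ^ (n - 1) := by
      calc ((S.filter fun w => supNorm w = m).card : ℝ) ≤
          (2 * n * (2 * m + 1) ^ (n - 1) : ℕ) := by exact_mod_cast h1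
        _ ≤ (2 * n * (3 * m) ^ (n - 1) : ℕ) := by
            gcongr
            omega
        _ = _ := by push_cast; ring
    rw [Finset.sum_congr rfl fun w hw => by rw [(Finset.mem_filter.1 hw).2], Finset.sum_const,
      nsmul_eq_mul]
    refine (mul_le_mul_of_nonneg_right h2 (by positivity)).trans_eq ?_
    rw [mul_assoc, ← mul_pow]
    congr 2
    field_simp
  refine (Finset.sum_le_card_nsmul _ _ _ hj).trans_eq ?_
  rw [Nat.card_Icc, nsmul_eq_mul]
  push_cast
  ring

theorem FormData.card_keys_at_le {n d R : ℕ} {F : MvPolynomial (Fin n) ℤ} (D : FormData d F)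
    {g : ℝ} (hg : 0 ≤ g) (hgR : g ^ 12 = R) (hAR : D.A ≤ R) {w : Fin n → ℤ} (hw0 : w ≠ 0)
    (hwR : supNorm w ≤ R) (T : Finset (ℕ × (Fin n → ℕ)))
    (hT : ∀ x ∈ T, IsKey D.N₀ D.forms x ∧
      (∀ p : ℕ, p.Prime → p ∣ x.1 → (d + 1) ^ (12 * (d + 1)) ≤ p) ∧ w ∈ keyLattice x) :
    (T.card : ℝ) ≤ g := by
  set N := (MvPolynomial.eval w F).natAbs with hN
  have hN0 : N ≠ 0 := Int.natAbs_ne_zero.2 (D.eval_ne_zero w hw0)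
  set W := N.primeFactors.filter fun p => (d + 1) ^ (12 * (d + 1)) ≤ p with hW
  have h1 := card_keys_le_of_mem D.card_forms W T fun x hx => ⟨(hT x hx).1, fun p hp hpx => by
    rw [hW, Finset.mem_filter, Nat.mem_primeFactors]
    refine ⟨⟨hp, ?_, hN0⟩, (hT x hx).2.1 p hp hpx⟩
    have h := (hT x hx).1.dvd_eval D.dvd_eval (hT x hx).2.2
    exact hpx.trans (Int.natCast_dvd.1 h)⟩
  have h2 : ((d + 1) ^ W.card) ^ (12 * (d + 1)) ≤ R ^ (d + 1) := by
    calc ((d + 1) ^ W.card) ^ (12 * (d + 1)) = ∏ _p ∈ W, (d + 1) ^ (12 * (d + 1)) := by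
          rw [Finset.prod_const, ← pow_mul, ← pow_mul, mul_comm]
      _ ≤ ∏ p ∈ W, p := Finset.prod_le_prod' fun p hp => (Finset.mem_filter.1 hp).2
      _ ≤ ∏ p ∈ N.primeFactors, p := Finset.prod_le_prod_of_subset_of_one_le'
          (Finset.filter_subset _ _) fun p hp _ => (Nat.prime_of_mem_primeFactors hp).one_le
      _ ≤ N := Nat.le_of_dvd (Nat.pos_of_ne_zero hN0) (Nat.prod_primeFactors_dvd N)
      _ ≤ D.A * R ^ d := by
          have := D.abs_eval_le R w fun i => (abs_le_supNorm w i).trans (by exact_mod_cast hwR)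
          rw [Int.abs_eq_natAbs] at this
          exact_mod_cast this
      _ ≤ R ^ (d + 1) := by
          rw [pow_succ']
          exact Nat.mul_le_mul_right _ hAR
  have h3 : (((d + 1 : ℕ) : ℝ) ^ W.card) ^ (12 * (d + 1)) ≤ g ^ (12 * (d + 1)) := by
    rw [pow_mul g, hgR]
    exact_mod_cast h2
  have h4 := le_of_pow_le_pow_left₀ (by positivity) hg h3
  calc (T.card : ℝ) ≤ ((d + 1 : ℕ) : ℝ) ^ W.card := by exact_mod_cast h1
    _ ≤ g := h4

theorem FormData.sum_hyperplaneBound_le {n d R : ℕ} {F : MvPolynomial (Fin n) ℤ}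
    (D : FormData d F) (hn : 2 ≤ n) {g : ℝ} (hg : 0 ≤ g) (hgR : g ^ 12 = R) (hAR : D.A ≤ R)
    (v : ℕ × (Fin n → ℕ) → Fin n → ℤ) (T : Finset (ℕ × (Fin n → ℕ)))
    (hT : ∀ x ∈ T, IsKey D.N₀ D.forms x ∧ x.1 ≤ R ^ 2 ∧
      (∀ p : ℕ, p.Prime → p ∣ x.1 → (d + 1) ^ (12 * (d + 1)) ≤ p) ∧ v x ∈ keyLattice x ∧
        v x ≠ 0 ∧ supNorm (v x) ^ n ≤ x.1) :
    ∑ x ∈ T, hyperplaneBound (2 * R) (v x) ≤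
      2 * n * (12 * n + 3) ^ (n - 1) * g ^ (12 * (n - 1) + 9) := by
  classical
  by_cases hn2 : n = 2
  · simp only [hyperplaneBound, hn2, if_true, Finset.sum_const_zero]
    positivity
  have hn3 : 3 ≤ n := by omega
  have hpos : ∀ x ∈ T, 0 < supNorm (v x) := fun x hx => supNorm_pos (hT x hx).2.2.2.2.1
  have hvR : ∀ x ∈ T, supNorm (v x) ≤ R := by
    intro x hx
    obtain ⟨-, h1, -, -, -, h2⟩ := hT x hx
    exact le_of_pow_le_pow_left₀ two_ne_zero (Nat.zero_le _)
      (((Nat.pow_le_pow_right (hpos x hx) hn).trans h2).trans h1)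
  have hvg : ∀ x ∈ T, supNorm (v x) ≤ ⌊g ^ 8⌋₊ := by
    intro x hx
    obtain ⟨-, h1, -, -, -, h2⟩ := hT x hx
    have h3 : supNorm (v x) ^ 3 ≤ R ^ 2 :=
      ((Nat.pow_le_pow_right (hpos x hx) hn3).trans h2).trans h1
    have h4 : (supNorm (v x) : ℝ) ^ 3 ≤ (g ^ 8) ^ 3 := by
      have : (g ^ 8) ^ 3 = (g ^ 12) ^ 2 := by ring
      rw [this, hgR]
      exact_mod_cast h3
    exact Nat.le_floor (le_of_pow_le_pow_left₀ three_ne_zero (by positivity) h4)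
  have hR0 : (0 : ℝ) ≤ (4 * n + 1) * R := by positivity
  have hterm : ∀ x ∈ T, hyperplaneBound (2 * R) (v x) ≤
      ((4 * n + 1) * R) ^ (n - 1) * (1 / (supNorm (v x) : ℝ)) ^ (n - 1) := by
    intro x hx
    have hp : (0 : ℝ) < supNorm (v x) := by exact_mod_cast hpos x hx
    have hle : (supNorm (v x) : ℝ) ≤ R := by exact_mod_cast hvR x hx
    rw [hyperplaneBound, if_neg hn2, ← mul_pow]
    refine pow_le_pow_left₀ (by positivity) ?_ _
    push_cast
    refine (add_le_add_left (Nat.cast_div_le (α := ℝ)) 1).trans ?_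
    push_cast
    rw [mul_one_div, ← sub_nonneg]
    have : (4 * n + 1) * (R : ℝ) / supNorm (v x) - (2 * n * (2 * R) / supNorm (v x) + 1) =
        (R - supNorm (v x)) / supNorm (v x) := by
      field_simp
      ring
    rw [this]
    exact div_nonneg (by linarith) hp.le
  calc _ ≤ ∑ x ∈ T, ((4 * n + 1) * R) ^ (n - 1) * (1 / (supNorm (v x) : ℝ)) ^ (n - 1) :=
        Finset.sum_le_sum hterm
    _ = ((4 * n + 1) * R) ^ (n - 1) * ∑ w ∈ T.image v, ∑ x ∈ T with v x = w,
          (1 / (supNorm (v x) : ℝ)) ^ (n - 1) := by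
        rw [← Finset.mul_sum, Finset.sum_fiberwise_of_maps_to fun x hx =>
          Finset.mem_image_of_mem v hx]
    _ ≤ ((4 * n + 1) * R) ^ (n - 1) * ∑ w ∈ T.image v, g * (1 / (supNorm w : ℝ)) ^ (n - 1) := by
        refine mul_le_mul_of_nonneg_left (Finset.sum_le_sum fun w hw => ?_) (by positivity)
        rw [Finset.sum_congr rfl fun x hx => by rw [(Finset.mem_filter.1 hx).2], Finset.sum_const,
          nsmul_eq_mul]
        refine mul_le_mul_of_nonneg_right ?_ (by positivity)
        obtain ⟨x, hx, rfl⟩ := Finset.mem_image.1 hw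
        refine D.card_keys_at_le hg hgR hAR (hT x hx).2.2.2.2.1 (hvR x hx) _ fun y hy => ?_
        obtain ⟨hyT, hyv⟩ := Finset.mem_filter.1 hy
        exact ⟨(hT y hyT).1, (hT y hyT).2.2.1, hyv ▸ (hT y hyT).2.2.2.1⟩
    _ ≤ ((4 * n + 1) * R) ^ (n - 1) * (g * (2 * n * 3 ^ (n - 1) * g ^ 8)) := by
        rw [← Finset.mul_sum]
        refine mul_le_mul_of_nonneg_left (mul_le_mul_of_nonneg_left ?_ hg) (by positivity)
        refine (sum_inv_supNorm_le (V := ⌊g ^ 8⌋₊) _ fun w hw => ?_).trans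
          (mul_le_mul_of_nonneg_left (Nat.floor_le (by positivity)) (by positivity))
        obtain ⟨x, hx, rfl⟩ := Finset.mem_image.1 hw
        exact ⟨(hT x hx).2.2.2.2.1, hvg x hx⟩
    _ = _ := by
        have : (12 * n + 3 : ℝ) = (4 * n + 1) * 3 := by ring
        rw [this, mul_pow, mul_pow, ← hgR, pow_add, pow_mul]
        ring

theorem FormData.card_le_of_forall_exists_key {n d k R U₀ U₁ : ℕ} {F : MvPolynomial (Fin n) ℤ}
    (D : FormData d F) (hn : 2 ≤ n) (hk : 2 ≤ k) {g : ℝ} (hg : 0 ≤ g) (hgR : g ^ 12 = R)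
    (hAR : D.A ≤ R) (hU₀ : 1 ≤ U₀) (hU₁ : 1 ≤ U₁) (P E : Finset ℕ) (hP : ∀ p ∈ P, p.Prime)
    (hEP : E ⊆ P)
    (hE : ∀ p ∈ E, k ∣ p - 1 ∧ 9 * k * (d + 2) ^ 3 ≤ p ∧ 16 * d ≤ p ∧ D.N₀ < p)
    (hM₀ : (∏ p ∈ P, p ^ k) ^ 2 * U₁ ≤ R ^ 2) (Z : Finset (Fin n → ℤ))
    (hZ : ∀ z ∈ Z, z ∈ intBox n R ∧
      (∀ (m : ℤ) (y : Fin n → ℤ), z = m • y → |m| ≤ (∏ p ∈ P, p ^ k : ℕ)) ∧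
      ∃ x, IsKey D.N₀ D.forms x ∧ U₀ ≤ x.1 ∧ x.1 ≤ U₁ ∧
        (∀ p : ℕ, p.Prime → p ∣ x.1 → (d + 1) ^ (12 * (d + 1)) ≤ p ∧ p ∉ P) ∧
        z ∈ keyLattice x ∧ IsPowerShape F k P x.1 z) :
    (Z.card : ℝ) ≤ 3 * (∏ p ∈ P, p ^ k : ℕ) * (D.K * U₁) +
      4 * ((2 * ((n + 1) * (2 * R : ℕ)) + 1 : ℝ) ^ n * (15 / 16) ^ E.card *
        (2 * D.K * (Nat.log 2 U₁ + 1 - Nat.log 2 U₀ : ℕ))) +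
      4 * (2 * n * (12 * n + 3) ^ (n - 1) * g ^ (12 * (n - 1) + 9) * (d + 1) ^ E.card) := by
  classical
  choose! κ hκ using fun z hz => (hZ z hz).2.2
  set T := Z.image κ with hT
  have hTk : ∀ x ∈ T, IsKey D.N₀ D.forms x ∧ U₀ ≤ x.1 ∧ x.1 ≤ U₁ ∧
      (∀ p : ℕ, p.Prime → p ∣ x.1 → (d + 1) ^ (12 * (d + 1)) ≤ p ∧ p ∉ P) := by
    intro x hx
    obtain ⟨z, hz, rfl⟩ := Finset.mem_image.1 hx
    obtain ⟨h1, h2, h3, h4, -⟩ := hκ z hz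
    exact ⟨h1, h2, h3, h4⟩
  have hvex : ∀ x, ∃ v : Fin n → ℤ, IsKey D.N₀ D.forms x → v ∈ keyLattice x ∧ v ≠ 0 ∧
      (∀ z ∈ keyLattice x, z ≠ 0 → supNorm v ≤ supNorm z) ∧ supNorm v ^ n ≤ x.1 := by
    intro x
    by_cases hx : IsKey D.N₀ D.forms x
    · have hidx := hx.index_keyLattice D.formVal_base
      obtain ⟨v, h1, h2, h3, h4⟩ := exists_shortest_vector (by omega) (keyLattice x)
        (by rw [hidx]; exact hx.pos.ne')
      exact ⟨v, fun _ => ⟨h1, h2, h3, hidx ▸ h4⟩⟩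
    · exact ⟨0, fun h => absurd h hx⟩
  choose v hv using hvex
  have hM₀pos : 0 < ∏ p ∈ P, p ^ k := Finset.prod_pos fun p hp => pow_pos (hP p hp).pos _
  have hfib : ∀ x ∈ T, ((Z.filter fun z => κ z = x).card : ℝ) ≤ 3 * (∏ p ∈ P, p ^ k : ℕ) +
      4 * ((2 * ((n + 1) * (2 * R : ℕ)) + 1 : ℝ) ^ n / x.1 * (15 / 16) ^ E.card +
        hyperplaneBound (2 * R) (v x) * (d + 1) ^ E.card) := by
    intro x hx
    obtain ⟨hx1, hx2, hx3, hx4⟩ := hTk x hx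
    obtain ⟨hv1, hv2, hv3, hv4⟩ := hv x hx1
    refine D.card_le_of_key hn hk hx1 hv1 hv2 hv3 hv4 P E
      (fun p hp => ⟨hP p hp, fun h => (hx4 p (hP p hp) h).2 hp⟩) hEP hE
      ((Nat.mul_le_mul_left _ hx3).trans hM₀) _ fun z hz => ?_
    obtain ⟨hzZ, rfl⟩ := Finset.mem_filter.1 hz
    obtain ⟨-, -, -, -, h5, h6⟩ := hκ z hzZ
    exact ⟨h5, (hZ z hzZ).1, h6, (hZ z hzZ).2.1⟩
  have hcard : (Z.card : ℝ) = ∑ x ∈ T, ((Z.filter fun z => κ z = x).card : ℝ) := by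
    exact_mod_cast Finset.card_eq_sum_card_image κ Z
  have hTcard : (T.card : ℝ) ≤ D.K * U₁ := by
    exact_mod_cast D.card_keys U₁ hU₁ T fun x hx => ⟨(hTk x hx).1, (hTk x hx).2.2.1⟩
  have h1 := D.sum_one_div_le hU₀ T fun x hx =>
    ⟨(hTk x hx).1, (hTk x hx).2.1, (hTk x hx).2.2.1⟩
  have h2 := D.sum_hyperplaneBound_le hn hg hgR hAR v T fun x hx =>
    ⟨(hTk x hx).1, (hTk x hx).2.2.1.trans ((Nat.le_mul_of_pos_left _ (by positivity)).trans hM₀),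
      fun p hp hpx => ((hTk x hx).2.2.2 p hp hpx).1, (hv x (hTk x hx).1).1,
      (hv x (hTk x hx).1).2.1, (hv x (hTk x hx).1).2.2.2⟩
  rw [hcard]
  calc _ ≤ ∑ x ∈ T, (3 * ((∏ p ∈ P, p ^ k : ℕ) : ℝ) +
      4 * ((2 * ((n + 1) * (2 * R : ℕ)) + 1 : ℝ) ^ n / x.1 * (15 / 16) ^ E.card +
        hyperplaneBound (2 * R) (v x) * (d + 1) ^ E.card)) := Finset.sum_le_sum hfib
    _ = 3 * ((∏ p ∈ P, p ^ k : ℕ) : ℝ) * T.card +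
      4 * ((2 * ((n + 1) * (2 * R : ℕ)) + 1 : ℝ) ^ n * (15 / 16) ^ E.card *
        ∑ x ∈ T, (1 / x.1 : ℝ)) +
      4 * ((∑ x ∈ T, hyperplaneBound (2 * R) (v x)) * (d + 1) ^ E.card) := by
        rw [Finset.sum_add_distrib, Finset.sum_const, nsmul_eq_mul, ← Finset.mul_sum,
          Finset.sum_add_distrib, ← Finset.sum_mul, ← Finset.sum_mul, Finset.mul_sum (s := T)]
        simp only [div_eq_mul_inv, one_mul, ← Finset.mul_sum]
        ring
    _ ≤ _ := by gcongr

/-! ### Points whose values have a large `k`-th power factor -/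

theorem eval_zsmul_of_map_eq_prod {n d : ℕ} {F : MvPolynomial (Fin n) ℤ} {L : Fin d → Fin n → ℂ}
    (hF : F.map (Int.castRingHom ℂ) = ∏ j, linForm (L j)) (m : ℤ) (y : Fin n → ℤ) :
    MvPolynomial.eval (m • y) F = m ^ d * MvPolynomial.eval y F := by
  have h : ((MvPolynomial.eval (m • y) F : ℤ) : ℂ) = ((m ^ d * MvPolynomial.eval y F : ℤ) : ℂ) := by
    rw [Int.cast_mul, Int.cast_pow, cast_eval_eq_prod_formVal hF, cast_eval_eq_prod_formVal hF]
    simp_rw [formVal_zsmul]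
    rw [Finset.prod_mul_distrib, Finset.prod_const, Finset.card_univ, Fintype.card_fin]
  exact_mod_cast h

theorem exists_linForm_dvd_of_not_Sp {n p : ℕ} (hp : p.Prime) {F : MvPolynomial (Fin n) ℤ} {τ : ℕ}
    {𝓛 : Fin τ → Fin n → @PadicInt p ⟨hp⟩} {Fstar : MvPolynomial (Fin n) (@PadicInt p ⟨hp⟩)}
    (hfact : IsPadicFact F p hp 𝓛 Fstar) {y : Fin n → ℤ} (hy : ¬ (p : ℤ) ∣ MvPolynomial.eval y F)
    {x : Fin n → ℤ} (hx : (p : ℤ) ∣ MvPolynomial.eval x F)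
    (hSp : ¬ Sp p hp 𝓛 Fstar fun i => (x i : ZMod p)) :
    ∃ c : Fin n → ZMod p, c ≠ 0 ∧ linForm c ∣ F.map (Int.castRingHom (ZMod p)) ∧
      formVal c x = 0 := by
  have _ : Fact p.Prime := ⟨hp⟩
  let φ : ℤ_[p] →+* ZMod p := PadicInt.toZMod
  have hmap : F.map (Int.castRingHom (ZMod p)) =
      (MvPolynomial.map φ Fstar) * ∏ i, linForm fun m => φ (𝓛 i m) := by
    rw [← map_map_intCast φ F, hfact.1, map_mul, map_prod]
    simp_rw [map_linForm]
  have heval : ∀ z : Fin n → ℤ, ((MvPolynomial.eval z F : ℤ) : ZMod p) =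
      MvPolynomial.eval (fun i => (z i : ZMod p)) (F.map (Int.castRingHom (ZMod p))) := by
    intro z
    rw [MvPolynomial.eval_map]
    exact MvPolynomial.eval₂_comp_left (Int.castRingHom (ZMod p)) (RingHom.id ℤ) z F
  have hx0 := (ZMod.intCast_zmod_eq_zero_iff_dvd _ p).2 hx
  rw [heval, hmap, map_mul, map_prod, mul_eq_zero] at hx0
  obtain ⟨i, -, hi⟩ := Finset.prod_eq_zero_iff.1 (hx0.resolve_left fun h => hSp (Or.inr h))
  rw [eval_linForm] at hi
  have hdvd : (linForm fun m => φ (𝓛 i m)) ∣ F.map (Int.castRingHom (ZMod p)) :=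
    hmap ▸ (Finset.dvd_prod_of_mem (fun i => linForm fun m => φ (𝓛 i m))
      (Finset.mem_univ i)).mul_left _
  refine ⟨fun m => φ (𝓛 i m), fun hc => hy ?_, hdvd, hi⟩
  rw [← ZMod.intCast_zmod_eq_zero_iff_dvd, heval]
  obtain ⟨Q, hQ⟩ := hdvd
  rw [hQ, map_mul, eval_linForm]
  simp [fun m => congrFun hc m]

theorem Sp_zero {n d p : ℕ} (hd : 2 ≤ d) (hp : p.Prime) {F : MvPolynomial (Fin n) ℤ}
    (hF0 : F ≠ 0) (hFd : F.IsHomogeneous d) {τ : ℕ}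
    {𝓛 : Fin τ → Fin n → @PadicInt p ⟨hp⟩} {Fstar : MvPolynomial (Fin n) (@PadicInt p ⟨hp⟩)}
    (hfact : IsPadicFact F p hp 𝓛 Fstar) : Sp p hp 𝓛 Fstar 0 := by
  have _ : Fact p.Prime := ⟨hp⟩
  by_cases hτ : 2 ≤ τ
  · exact Or.inl ⟨⟨0, by omega⟩, ⟨1, by omega⟩, by simp [Fin.lt_def], by simp, by simp⟩
  right
  let ψ := Int.castRingHom ℤ_[p]
  have hψ : Function.Injective ψ := RingHom.injective_int ψ
  have hFd' := hFd.map ψ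
  have hcoeff : ∀ m : Fin n →₀ ℕ, m.degree ≠ d → (F.map ψ).coeff m = 0 := fun m hm =>
    hFd'.coeff_eq_zero hm
  suffices h : Fstar.coeff 0 = 0 by
    have h1 : MvPolynomial.eval (0 : Fin n → ZMod p) (MvPolynomial.map PadicInt.toZMod Fstar) =
        PadicInt.toZMod (Fstar.coeff 0) := by
      rw [← MvPolynomial.coeff_map]
      exact congrFun (congrArg DFunLike.coe MvPolynomial.eval_zero) _
    refine h1.trans ?_
    rw [h, map_zero]
  obtain rfl | rfl : τ = 0 ∨ τ = 1 := by omega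
  · have h1 : F.map ψ = Fstar := by simpa using hfact.1
    rw [← h1]
    exact hcoeff 0 (by simp; omega)
  · have h1 : F.map ψ = Fstar * linForm (𝓛 0) := by simpa using hfact.1
    have h2 : 𝓛 0 ≠ 0 := by
      intro h
      refine hF0 (MvPolynomial.map_injective ψ hψ ?_)
      rw [h1, h, map_zero]
      simp [linForm]
    obtain ⟨m, hm⟩ := Function.ne_iff.1 h2
    have h3 := hcoeff (Finsupp.single m 1) (by simp; omega)
    have h4 : (Fstar * linForm (𝓛 0)).coeff (Finsupp.single m 1) = 𝓛 0 m * Fstar.coeff 0 := by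
      classical
      rw [linForm, Finset.mul_sum, coeff_sum, Finset.sum_eq_single m]
      · rw [mul_left_comm, coeff_C_mul, coeff_mul_X']
        simp
      · intro j _ hj
        rw [mul_left_comm, coeff_C_mul, coeff_mul_X', if_neg, mul_zero]
        simpa [Finsupp.single_apply] using hj
      · simp
    rw [h1, h4] at h3
    exact (mul_eq_zero.1 h3).resolve_left hm

/-- The value of `F` at `x` is `±uq^k` with a large prime `q` and a cofactor `u` that is
`k`-free at the primes up to `ξ` and square-free at the others. -/
structure IsCofactor {n : ℕ} (F : MvPolynomial (Fin n) ℤ) (k : ℕ) (ξ ξ' : ℝ) (x : Fin n → ℤ)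
    (u : ℕ) : Prop where
  pos : 0 < u
  eval_eq : ∃ (ε : Bool) (q : ℕ), q.Prime ∧ ξ' < q ∧
    MvPolynomial.eval x F = (if ε then 1 else -1) * u * (q : ℤ) ^ k
  not_dvd : ∀ p : ℕ, p.Prime → (p : ℝ) ≤ ξ → ¬ p ^ k ∣ u
  not_sq_dvd : ∀ p : ℕ, p.Prime → ξ < p → ¬ p ^ 2 ∣ u

theorem exists_isCofactor {n k : ℕ} {F : MvPolynomial (Fin n) ℤ} {ξ ξ' : ℝ} {x : Fin n → ℤ}
    {U V : ℝ} (hV : (|MvPolynomial.eval x F| : ℤ) ≤ V) (hx0 : MvPolynomial.eval x F ≠ 0)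
    (hξ' : 0 < ξ') (hU : V ≤ U * ξ' ^ k) (hUξ : U ≤ ξ')
    (h₁ : ∃ p : ℕ, p.Prime ∧ ξ' < (p : ℝ) ∧ (p : ℤ) ^ k ∣ MvPolynomial.eval x F)
    (h₂ : ∀ p : ℕ, p.Prime → ξ < (p : ℝ) → (p : ℝ) ≤ ξ' → ¬ (p : ℤ) ^ 2 ∣ MvPolynomial.eval x F)
    (h₃ : ∀ p : ℕ, p.Prime → (p : ℤ) ^ k ∣ MvPolynomial.eval x F → ξ < (p : ℝ)) :
    ∃ u : ℕ, (u : ℝ) ≤ U ∧ IsCofactor F k ξ ξ' x u := by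
  obtain ⟨q, hq, hqξ, c, hc⟩ := h₁
  have hc0 : c ≠ 0 := by
    rintro rfl
    exact hx0 (by simpa using hc)
  have hu0 : 0 < c.natAbs := Int.natAbs_pos.2 hc0
  have hdvd : (c.natAbs : ℤ) ∣ MvPolynomial.eval x F := by
    rw [hc, Int.natCast_natAbs]
    exact (abs_dvd_self c).mul_left _
  have huU : (c.natAbs : ℝ) ≤ U := by
    have h1 : (c.natAbs : ℝ) * (q : ℝ) ^ k = ((|MvPolynomial.eval x F| : ℤ) : ℝ) := by
      rw [hc, abs_mul, Int.cast_mul, abs_pow, Nat.abs_cast, Nat.cast_natAbs]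
      push_cast
      ring
    have h2 : ξ' ^ k ≤ (q : ℝ) ^ k := pow_le_pow_left₀ hξ'.le hqξ.le _
    have h3 : (0 : ℝ) < ξ' ^ k := by positivity
    refine le_of_mul_le_mul_right ?_ h3
    calc (c.natAbs : ℝ) * ξ' ^ k ≤ c.natAbs * (q : ℝ) ^ k :=
          mul_le_mul_of_nonneg_left h2 (by positivity)
      _ ≤ U * ξ' ^ k := (h1.le.trans hV).trans hU
  refine ⟨c.natAbs, huU, hu0, ⟨decide (0 ≤ c), q, hq, hqξ, ?_⟩, fun p hp hpξ h => ?_,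
    fun p hp hpξ h => ?_⟩
  · rw [hc]
    rcases le_or_gt 0 c with h | h
    · simp only [h, decide_true, if_true]
      rw [Int.natAbs_of_nonneg h]
      ring
    · simp only [not_le.2 h, decide_false]
      rw [Int.ofNat_natAbs_of_nonpos h.le]
      simp
      ring
  · exact absurd (h₃ p hp ((by exact_mod_cast Int.natCast_dvd_natCast.2 h :
      (p : ℤ) ^ k ∣ (c.natAbs : ℤ)).trans hdvd)) (not_lt.2 hpξ)
  · refine h₂ p hp hpξ ?_ ((by exact_mod_cast Int.natCast_dvd_natCast.2 h :
      (p : ℤ) ^ 2 ∣ (c.natAbs : ℤ)).trans hdvd)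
    have h1 : p ≤ c.natAbs := Nat.le_of_dvd hu0 ((dvd_pow_self p two_ne_zero).trans h)
    exact (by exact_mod_cast h1 : (p : ℝ) ≤ c.natAbs).trans (huU.trans hUξ)

theorem FormData.exists_isKey_of_isCofactor {n d k u : ℕ} {F : MvPolynomial (Fin n) ℤ}
    (D : FormData d F) (hk : 2 ≤ k) {ξ ξ' : ℝ} {x : Fin n → ℤ} (hu : IsCofactor F k ξ ξ' x u)
    (P : Finset ℕ) (hP : ∀ p ∈ P, p.Prime ∧ (p : ℝ) ≤ ξ')
    (hPξ : ∀ p : ℕ, p.Prime → (p : ℝ) ≤ ξ → p ∈ P) (hN₀ : (D.N₀ : ℝ) ≤ ξ)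
    (hloc : ∀ p : ℕ, p.Prime → ξ < p → (p : ℤ) ∣ MvPolynomial.eval x F →
      ∃ c ∈ D.forms p, formVal c x = 0) :
    ∃ y, IsKey D.N₀ D.forms y ∧ y.1 ≤ u ∧ u ≤ (∏ p ∈ P, p ^ k) * y.1 ∧
      (∀ p : ℕ, p.Prime → p ∣ y.1 → ξ < p ∧ p ∉ P) ∧ x ∈ keyLattice y ∧
      IsPowerShape F k P y.1 x := by
  classical
  have hu0 := hu.pos.ne'
  obtain ⟨ε, q, hq, hqξ, heval⟩ := hu.eval_eq
  have hlarge : ∀ p : ℕ, p.Prime → p ∉ P → ξ < p := fun p hp hpP =>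
    lt_of_not_ge fun h => hpP (hPξ p hp h)
  have hfac1 : ∀ p ∈ u.primeFactors, p ∉ P → u.factorization p = 1 := by
    intro p hp hpP
    have hpp := Nat.prime_of_mem_primeFactors hp
    have h1 := hpp.factorization_pos_of_dvd hu0 (Nat.dvd_of_mem_primeFactors hp)
    have h2 : ¬ 2 ≤ u.factorization p := fun h =>
      hu.not_sq_dvd p hpp (hlarge p hpp hpP) ((hpp.pow_dvd_iff_le_factorization hu0).2 h)
    omega
  have hfack : ∀ p ∈ P, u.factorization p < k := by
    intro p hp
    have hpp := (hP p hp).1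
    rw [← not_le, ← hpp.pow_dvd_iff_le_factorization hu0]
    intro h
    rcases le_or_gt (p : ℝ) ξ with h1 | h1
    · exact hu.not_dvd p hpp h1 h
    · exact hu.not_sq_dvd p hpp h1 ((pow_dvd_pow p hk).trans h)
  set u₂ := ∏ p ∈ u.primeFactors \ P, p with hu₂
  have hmem : ∀ p : ℕ, p.Prime → p ∣ u₂ → p ∈ u.primeFactors \ P := by
    intro p hp hpu
    obtain ⟨r, hr, hpr⟩ := (hp.prime.dvd_finsetProd_iff _).1 hpu
    have hr' := Nat.prime_of_mem_primeFactors (Finset.mem_sdiff.1 hr).1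
    rwa [(Nat.prime_dvd_prime_iff_eq hp hr').1 hpr]
  have hdecomp : u = (∏ p ∈ P, p ^ u.factorization p) * u₂ := by
    conv_lhs => rw [← Nat.prod_factorization_pow_eq_self hu0]
    rw [Nat.prod_factorization_eq_prod_primeFactors,
      ← Finset.prod_inter_mul_prod_sdiff u.primeFactors P]
    congr 1
    · refine Finset.prod_subset Finset.inter_subset_right fun p hp hpn => ?_
      rw [Finsupp.notMem_support_iff.1 fun h => hpn (Finset.mem_inter.2 ⟨h, hp⟩), pow_zero]
    · refine Finset.prod_congr rfl fun p hp => ?_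
      rw [hfac1 p (Finset.mem_sdiff.1 hp).1 (Finset.mem_sdiff.1 hp).2, pow_one]
  have hu₂u : u₂ ∣ u := Dvd.intro_left _ hdecomp.symm
  have hsq : Squarefree u₂ := by
    rw [Nat.squarefree_iff_prime_squarefree]
    intro p hp h
    have h1 := Finset.mem_sdiff.1 (hmem p hp ((Dvd.intro _ rfl).trans h))
    have h2 := (hp.pow_dvd_iff_le_factorization hu0 (k := 2)).1 (by rw [sq]; exact h.trans hu₂u)
    rw [hfac1 p h1.1 h1.2] at h2
    omega
  have hdvdF : (u : ℤ) ∣ MvPolynomial.eval x F := by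
    rw [heval, mul_assoc, mul_comm, mul_assoc]
    exact Dvd.intro _ rfl
  obtain ⟨c, hc, hcx⟩ := exists_isKey (N₀ := D.N₀) (forms := D.forms) hsq (z := x)
    fun p hp hpu => by
      have h1 := hlarge p hp (Finset.mem_sdiff.1 (hmem p hp hpu)).2
      refine ⟨by exact_mod_cast hN₀.trans_lt h1, hloc p hp h1 ?_⟩
      exact (Int.natCast_dvd_natCast.2 (hpu.trans hu₂u)).trans hdvdF
  refine ⟨(u₂, c), hc, Nat.le_of_dvd hu.pos hu₂u, ?_, fun p hp hpu => ?_, hcx,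
    ε, u.factorization, q, hfack, fun p hp h => ?_, ?_⟩
  · conv_lhs => rw [hdecomp]
    refine Nat.mul_le_mul_right _ (Finset.prod_le_prod' fun p hp => ?_)
    exact Nat.pow_le_pow_right (hP p hp).1.pos (hfack p hp).le
  · have h1 := (Finset.mem_sdiff.1 (hmem p hp hpu)).2
    exact ⟨hlarge p hp h1, h1⟩
  · have h1 := (Nat.prime_dvd_prime_iff_eq (hP p hp).1 hq).1 (by exact_mod_cast h)
    have h2 := (hP p hp).2
    rw [h1] at h2
    exact absurd h2 (not_le.2 hqξ)
  · rw [heval]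
    conv_lhs => rw [hdecomp]
    push_cast
    ring

theorem abs_le_of_eq_zsmul {n d k R : ℕ} (hd : 2 ≤ d)
    {F : MvPolynomial (Fin n) ℤ}
    (hsmul : ∀ (m : ℤ) (y : Fin n → ℤ),
      MvPolynomial.eval (m • y) F = m ^ d * MvPolynomial.eval y F)
    {ξ ξ' : ℝ} (hRξ : (R : ℝ) ≤ ξ') {x : Fin n → ℤ} (hxR : x ∈ intBox n R) (hx0 : x ≠ 0)
    (P : Finset ℕ) (hP : ∀ p ∈ P, p.Prime) (hPξ : ∀ p : ℕ, p.Prime → (p : ℝ) ≤ ξ → p ∈ P)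
    (h₂ : ∀ p : ℕ, p.Prime → ξ < (p : ℝ) → (p : ℝ) ≤ ξ' → ¬ (p : ℤ) ^ 2 ∣ MvPolynomial.eval x F)
    (h₃ : ∀ p : ℕ, p.Prime → (p : ℤ) ^ k ∣ MvPolynomial.eval x F → ξ < (p : ℝ))
    (m : ℤ) (y : Fin n → ℤ) (hxy : x = m • y) : |m| ≤ (∏ p ∈ P, p ^ k : ℕ) := by
  classical
  have hm0 : m ≠ 0 := by
    rintro rfl
    exact hx0 (by rw [hxy, zero_smul])
  have hN0 : m.natAbs ≠ 0 := Int.natAbs_ne_zero.2 hm0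
  have hmR : m.natAbs ≤ R := by
    obtain ⟨i, hi⟩ := Function.ne_iff.1 hx0
    have h1 := mem_intBox.1 hxR i
    rw [hxy, Pi.smul_apply, smul_eq_mul, abs_mul] at h1
    have h2 : y i ≠ 0 := by
      intro h
      exact hi (by rw [hxy, Pi.smul_apply, h, smul_zero]; rfl)
    have h3 := Int.one_le_abs h2
    have h4 : |m| ≤ |m| * |y i| := le_mul_of_one_le_right (abs_nonneg _) h3
    have h5 := Int.abs_eq_natAbs m
    omega
  have hdvd : ∀ (p j : ℕ), p ^ j ∣ m.natAbs → (p : ℤ) ^ (j * d) ∣ MvPolynomial.eval x F := by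
    intro p j h
    rw [hxy, hsmul, pow_mul]
    refine (pow_dvd_pow_of_dvd ?_ d).mul_right _
    have := Int.natCast_dvd.2 h
    exact_mod_cast this
  have hmem : ∀ p ∈ m.natAbs.primeFactors, p ∈ P ∧ m.natAbs.factorization p ≤ k := by
    intro p hp
    have hpp := Nat.prime_of_mem_primeFactors hp
    have hpm := Nat.dvd_of_mem_primeFactors hp
    have hpξ : (p : ℝ) ≤ ξ := by
      by_contra! h
      refine h₂ p hpp h ?_ ((pow_dvd_pow (p : ℤ) (by omega)).trans (hdvd p 1 (by simpa using hpm)))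
      exact le_trans (by exact_mod_cast (Nat.le_of_dvd (Nat.pos_of_ne_zero hN0) hpm).trans hmR) hRξ
    refine ⟨hPξ p hpp hpξ, ?_⟩
    by_contra! h
    refine absurd (h₃ p hpp ((pow_dvd_pow (p : ℤ) ?_).trans (hdvd p k
      ((hpp.pow_dvd_iff_le_factorization hN0).2 h.le)))) (not_lt.2 hpξ)
    nlinarith
  have hle : m.natAbs ≤ ∏ p ∈ P, p ^ k := by
    conv_lhs => rw [← Nat.prod_factorization_pow_eq_self hN0,
      Nat.prod_factorization_eq_prod_primeFactors]
    refine (Finset.prod_le_prod' fun p hp => Nat.pow_le_pow_right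
      (Nat.prime_of_mem_primeFactors hp).pos (hmem p hp).2).trans ?_
    exact Finset.prod_le_prod_of_subset_of_one_le' (fun p hp => (hmem p hp).1)
      fun p hp _ => Nat.one_le_pow _ _ (hP p hp).pos
  rw [Int.abs_eq_natAbs]
  exact_mod_cast hle

theorem exists_sieving_sets {k : ℕ} (hk : 2 ≤ k) (N e : ℕ) {ξ : ℝ} (hξ : 0 ≤ ξ) :
    ∃ P E : Finset ℕ, (∀ p ∈ P, p.Prime) ∧ E ⊆ P ∧ E.card = e ∧ (∀ p ∈ E, k ∣ p - 1 ∧ N < p) ∧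
      (∀ p : ℕ, p.Prime → (p : ℝ) ≤ ξ → p ∈ P) ∧
      ((∏ p ∈ P, p ^ k : ℕ) : ℝ) ≤ Real.exp (k * (2 * ξ + ((k : ℝ) * (N + e)) ^ 4)) := by
  classical
  obtain ⟨E, hEe, hE, hEprod⟩ := exists_finset_primes_modEq_one hk N e
  set Q := (Finset.range (⌊ξ⌋₊ + 1)).filter Nat.Prime with hQ
  have hQE : ∀ p ∈ Q ∪ E, p.Prime := by
    intro p hp
    rcases Finset.mem_union.1 hp with h | h
    · exact (Finset.mem_filter.1 h).2
    · exact (hE p h).1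
  refine ⟨Q ∪ E, E, hQE, Finset.subset_union_right, hEe, fun p hp => (hE p hp).2,
    fun p hp hpξ => ?_, ?_⟩
  · refine Finset.mem_union_left _ (Finset.mem_filter.2 ⟨Finset.mem_range.2 ?_, hp⟩)
    exact Nat.lt_succ_of_le (Nat.le_floor hpξ)
  · have h1 : ((∏ p ∈ Q, p : ℕ) : ℝ) ≤ Real.exp (2 * ξ) := by
      have h2 : ((∏ p ∈ Q, p : ℕ) : ℝ) ≤ (4 : ℝ) ^ ⌊ξ⌋₊ := by
        exact_mod_cast primorial_le_four_pow ⌊ξ⌋₊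
      have h4 : (4 : ℝ) ≤ Real.exp 2 := by
        have h5 := Real.add_one_le_exp (1 : ℝ)
        have h6 : Real.exp 2 = Real.exp 1 * Real.exp 1 := by rw [← Real.exp_add]; norm_num
        nlinarith
      calc _ ≤ (4 : ℝ) ^ ⌊ξ⌋₊ := h2
        _ ≤ Real.exp 2 ^ ⌊ξ⌋₊ := pow_le_pow_left₀ (by norm_num) h4 _
        _ = Real.exp (⌊ξ⌋₊ * 2) := (Real.exp_nat_mul _ _).symm
        _ ≤ _ := Real.exp_le_exp.2 (by linarith [Nat.floor_le hξ])
    have h2 : ∏ p ∈ Q ∪ E, p ≤ (∏ p ∈ Q, p) * ∏ p ∈ E, p := by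
      rw [← Finset.prod_union_inter]
      exact Nat.le_mul_of_pos_right _ (Finset.prod_pos fun p hp =>
        (hE p (Finset.mem_inter.1 hp).2).1.pos)
    rw [Finset.prod_pow, Nat.cast_pow, Real.exp_nat_mul, Real.exp_add]
    refine pow_le_pow_left₀ (by positivity) ?_ _
    calc ((∏ p ∈ Q ∪ E, p : ℕ) : ℝ) ≤ ((∏ p ∈ Q, p : ℕ) : ℝ) * (∏ p ∈ E, p : ℕ) := by
          exact_mod_cast h2
      _ ≤ _ := mul_le_mul h1 hEprod (by positivity) (by positivity)

theorem log_add_one_sub_log_le {a b j : ℕ} (h : b ≤ a * 2 ^ j) :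
    Nat.log 2 b + 1 - Nat.log 2 a ≤ j + 1 := by
  rcases Nat.eq_zero_or_pos b with rfl | hb
  · simp only [Nat.log_zero_right]
    omega
  have h1 : a < 2 ^ (Nat.log 2 a + 1) := Nat.lt_pow_succ_log_self (by norm_num) a
  have h2 : b < 2 ^ (Nat.log 2 a + 1 + j) := by
    rw [pow_add]
    exact h.trans_lt (Nat.mul_lt_mul_of_pos_right h1 (by positivity))
  have := Nat.log_lt_of_lt_pow hb.ne' h2
  omega

/-- The threshold beyond which all primes are suitable for the sieve. -/
def FormData.sieveBound {n d : ℕ} {F : MvPolynomial (Fin n) ℤ} (D : FormData d F) (k : ℕ) : ℕ :=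
  9 * k * (d + 2) ^ 3 + 16 * d + D.N₀

theorem FormData.card_le_of_isCofactor {n d k R U₀ U₁ j e : ℕ} {F : MvPolynomial (Fin n) ℤ}
    (D : FormData d F) (hn : 2 ≤ n) (hk : 2 ≤ k) (hd : 2 ≤ d)
    (hsmul : ∀ (m : ℤ) (y : Fin n → ℤ),
      MvPolynomial.eval (m • y) F = m ^ d * MvPolynomial.eval y F)
    {g : ℝ} (hg : 0 ≤ g) (hgR : g ^ 12 = R) (hR : 1 ≤ R) (hAR : D.A ≤ R) (hU₁ : 1 ≤ U₁)
    {ξ ξ' M : ℝ} (hξ0 : 0 ≤ ξ) (hN₀ : (D.N₀ : ℝ) ≤ ξ)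
    (hdξ : (((d + 1) ^ (12 * (d + 1)) : ℕ) : ℝ) ≤ ξ) (hRξ : (R : ℝ) ≤ ξ')
    (hM : Real.exp (k * (2 * ξ + ((k : ℝ) * (D.sieveBound k + e)) ^ 4)) ≤ M)
    (hMU : M ^ 2 * U₁ ≤ (R : ℝ) ^ 2) (hMj : U₁ * M ≤ (U₀ + 1) * 2 ^ j)
    (Z : Finset (Fin n → ℤ)) (hZ : ∀ x ∈ Z, x ∈ intBox n R ∧ x ≠ 0 ∧
      (∀ p : ℕ, p.Prime → ξ < (p : ℝ) → (p : ℝ) ≤ ξ' → ¬ (p : ℤ) ^ 2 ∣ MvPolynomial.eval x F) ∧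
      (∀ p : ℕ, p.Prime → (p : ℤ) ^ k ∣ MvPolynomial.eval x F → ξ < (p : ℝ)) ∧
      (∀ p : ℕ, p.Prime → ξ < p → (p : ℤ) ∣ MvPolynomial.eval x F →
        ∃ c ∈ D.forms p, formVal c x = 0) ∧
      ∃ u : ℕ, IsCofactor F k ξ ξ' x u ∧ U₀ < u ∧ u ≤ U₁) :
    (Z.card : ℝ) ≤ 3 * M * (D.K * U₁) +
      4 * (((4 * n + 5) * R : ℝ) ^ n * (15 / 16) ^ e * (2 * D.K * (j + 1))) +
      4 * (2 * n * (12 * n + 3) ^ (n - 1) * g ^ (12 * (n - 1) + 9) * (d + 1) ^ e) := by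
  obtain ⟨P, E, hP, hEP, rfl, hE, hPξ, hPM⟩ := exists_sieving_sets hk (D.sieveBound k) e hξ0
  have hPM' := hPM.trans hM
  set M₀ := ∏ p ∈ P, p ^ k with hM₀
  have hM₀pos : 0 < M₀ := Finset.prod_pos fun p hp => pow_pos (hP p hp).pos _
  have hM₀U : M₀ ^ 2 * U₁ ≤ R ^ 2 := by
    have : (M₀ : ℝ) ^ 2 * U₁ ≤ (R : ℝ) ^ 2 := le_trans (by gcongr) hMU
    exact_mod_cast this
  have hM₀R : M₀ ≤ R := le_of_pow_le_pow_left₀ two_ne_zero (Nat.zero_le _)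
    ((Nat.le_mul_of_pos_right _ hU₁).trans hM₀U)
  have hPR : ∀ p ∈ P, p ≤ R := by
    intro p hp
    refine le_trans ?_ hM₀R
    refine (Nat.le_self_pow (show k ≠ 0 by omega) p).trans (Nat.le_of_dvd hM₀pos ?_)
    exact Finset.dvd_prod_of_mem (fun p => p ^ k) hp
  have hlog : Nat.log 2 U₁ + 1 - Nat.log 2 (U₀ / M₀ + 1) ≤ j + 1 := by
    refine log_add_one_sub_log_le ?_
    have h1 : U₁ * M₀ ≤ (U₀ + 1) * 2 ^ j := by
      have : (U₁ : ℝ) * M₀ ≤ (U₀ + 1) * 2 ^ j := le_trans (by gcongr) hMj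
      exact_mod_cast this
    have h2 : U₀ + 1 ≤ (U₀ / M₀ + 1) * M₀ := by
      have h3 := Nat.div_add_mod U₀ M₀
      have h4 := Nat.mod_lt U₀ hM₀pos
      nlinarith
    refine Nat.le_of_mul_le_mul_right ?_ hM₀pos
    calc U₁ * M₀ ≤ (U₀ + 1) * 2 ^ j := h1
      _ ≤ (U₀ / M₀ + 1) * M₀ * 2 ^ j := Nat.mul_le_mul_right _ h2
      _ = _ := by ring
  have hmain := D.card_le_of_forall_exists_key (U₀ := U₀ / M₀ + 1) hn hk hg hgR hAR
    (Nat.le_add_left _ _) hU₁ P E hP hEP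
    (fun p hp => by
      have h1 := (hE p hp).2
      unfold FormData.sieveBound at h1
      exact ⟨(hE p hp).1, by omega, by omega, by omega⟩) hM₀U Z fun x hx => by
      obtain ⟨h1, h2, h3, h4, h5, u, hu, hu₀, hu₁⟩ := hZ x hx
      refine ⟨h1, fun m y hxy => abs_le_of_eq_zsmul hd hsmul hRξ h1 h2 P hP hPξ h3 h4 m y hxy, ?_⟩
      obtain ⟨y, hy1, hy2, hy3, hy4, hy5, hy6⟩ := D.exists_isKey_of_isCofactor hk hu P
        (fun p hp => ⟨hP p hp, le_trans (by exact_mod_cast hPR p hp) hRξ⟩) hPξ hN₀ h5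
      refine ⟨y, hy1, ?_, hy2.trans hu₁, fun p hp hpy => ?_, hy5, hy6⟩
      · refine Nat.succ_le_of_lt ((Nat.div_lt_iff_lt_mul hM₀pos).2 ?_)
        rw [mul_comm]
        exact hu₀.trans_le hy3
      · refine ⟨?_, (hy4 p hp hpy).2⟩
        exact_mod_cast hdξ.trans (hy4 p hp hpy).1.le
  refine hmain.trans ?_
  have hR1 : (1 : ℝ) ≤ R := by exact_mod_cast hR
  have hbase : (2 * ((n + 1) * (2 * R : ℕ)) + 1 : ℝ) ≤ (4 * n + 5) * R := by
    push_cast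
    nlinarith
  have hlog' : ((Nat.log 2 U₁ + 1 - Nat.log 2 (U₀ / M₀ + 1) : ℕ) : ℝ) ≤ j + 1 := by
    exact_mod_cast hlog
  gcongr

theorem eventually_mul_pow_le_exp (c : ℝ) (m : ℕ) {b : ℝ} (hb : 0 < b) :
    ∀ᶠ x : ℝ in atTop, c * x ^ m ≤ Real.exp (b * x) := by
  have h := (isLittleO_pow_exp_pos_mul_atTop m hb).bound
    (show (0 : ℝ) < 1 / (|c| + 1) by positivity)
  filter_upwards [h, eventually_ge_atTop 0] with x hx hx0
  rw [Real.norm_of_nonneg (by positivity), Real.norm_of_nonneg (by positivity),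
    div_mul_eq_mul_div, one_mul, le_div_iff₀ (by positivity)] at hx
  have h1 : c ≤ |c| + 1 := by linarith [le_abs_self c]
  nlinarith [pow_nonneg hx0 m]

theorem eventually_mul_exp_neg_le (c : ℝ) (m : ℕ) {b : ℝ} (hb : 0 < b) :
    ∀ᶠ x : ℝ in atTop, c * Real.exp (-(b * x)) ≤ 1 / x ^ m := by
  filter_upwards [eventually_mul_pow_le_exp c m hb, eventually_gt_atTop 0] with x hx hx0
  rw [Real.exp_neg, ← div_eq_mul_inv, div_le_div_iff₀ (by positivity) (by positivity)]
  linarith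

theorem pow_fifteen_sixteenths_le (e : ℕ) : ((15 : ℝ) / 16) ^ e ≤ Real.exp (-(e / 16)) := by
  have h : (15 : ℝ) / 16 ≤ Real.exp (-(1 / 16)) := by
    have := Real.add_one_le_exp (-(1 / 16) : ℝ)
    linarith
  calc ((15 : ℝ) / 16) ^ e ≤ Real.exp (-(1 / 16)) ^ e := by gcongr
    _ = _ := by rw [← Real.exp_nat_mul]; ring_nf

theorem exp_le_two_pow {y : ℝ} {j : ℕ} (h : 2 * y ≤ j) : Real.exp y ≤ 2 ^ j := by
  have h2 : Real.exp (1 / 2) ≤ 2 := by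
    rw [← Real.le_log_iff_exp_le (by norm_num)]
    linarith [Real.log_two_gt_d9]
  calc Real.exp y ≤ Real.exp (j * (1 / 2)) := Real.exp_le_exp.2 (by linarith)
    _ = Real.exp (1 / 2) ^ j := Real.exp_nat_mul _ _
    _ ≤ _ := by gcongr

theorem natCast_add_one_pow_le_exp (d e : ℕ) : ((d : ℝ) + 1) ^ e ≤ Real.exp (d * e) := by
  rw [mul_comm, Real.exp_nat_mul]
  exact pow_le_pow_left₀ (by positivity) (Real.add_one_le_exp _) _

/-- The three contributions to the sieve bound, with the size of the box factored out. -/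
theorem sieve_terms_le {n d e j R U K : ℕ} {B M g t₁ t₂ t₃ : ℝ} (hn : 2 ≤ n) (hB : 1 ≤ B)
    (hRB : (R : ℝ) ≤ B) (hg : 0 ≤ g) (hgR : g ^ 12 = R) (ht₁ : M * U ≤ B ^ 2 * t₁)
    (ht₁0 : 0 ≤ t₁) (ht₂ : ((15 : ℝ) / 16) ^ e * (j + 1) ≤ t₂) (ht₃0 : 0 ≤ t₃)
    (ht₃ : ((d : ℝ) + 1) ^ e ≤ t₃ * g ^ 3) :
    3 * M * (K * U) + 4 * (((4 * n + 5) * R : ℝ) ^ n * (15 / 16) ^ e * (2 * K * (j + 1))) +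
      4 * (2 * n * (12 * n + 3) ^ (n - 1) * g ^ (12 * (n - 1) + 9) * (d + 1) ^ e) ≤
    B ^ n * (3 * K * t₁ + 8 * K * (4 * n + 5) ^ n * t₂ + 8 * n * (12 * n + 3) ^ (n - 1) * t₃) := by
  have hB2 : B ^ 2 ≤ B ^ n := pow_le_pow_right₀ hB hn
  have hRn : (R : ℝ) ^ n ≤ B ^ n := by gcongr
  have h1 : 3 * M * (K * U) ≤ B ^ n * (3 * K * t₁) := by
    calc 3 * M * (K * U) = 3 * K * (M * U) := by ring
      _ ≤ 3 * K * (B ^ 2 * t₁) := by gcongr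
      _ ≤ 3 * K * (B ^ n * t₁) := by gcongr
      _ = _ := by ring
  have h2 : 4 * (((4 * n + 5) * R : ℝ) ^ n * (15 / 16) ^ e * (2 * K * (j + 1))) ≤
      B ^ n * (8 * K * (4 * n + 5) ^ n * t₂) := by
    calc 4 * (((4 * n + 5) * R : ℝ) ^ n * (15 / 16) ^ e * (2 * K * (j + 1)))
        = 8 * K * (4 * n + 5) ^ n * ((R : ℝ) ^ n * ((15 / 16) ^ e * (j + 1))) := by
          rw [mul_pow]; ring
      _ ≤ 8 * K * (4 * n + 5) ^ n * (B ^ n * t₂) := by gcongr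
      _ = _ := by ring
  have h3 : 4 * (2 * n * (12 * n + 3) ^ (n - 1) * g ^ (12 * (n - 1) + 9) * (d + 1) ^ e) ≤
      B ^ n * (8 * n * (12 * n + 3) ^ (n - 1) * t₃) := by
    calc 4 * (2 * n * (12 * n + 3) ^ (n - 1) * g ^ (12 * (n - 1) + 9) * (d + 1) ^ e)
        ≤ 4 * (2 * n * (12 * n + 3) ^ (n - 1) * g ^ (12 * (n - 1) + 9) * (t₃ * g ^ 3)) := by gcongr
      _ = 8 * n * (12 * n + 3) ^ (n - 1) * ((g ^ 12) ^ n * t₃) := by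
          rw [← pow_mul, show 12 * n = 12 * (n - 1) + 9 + 3 by omega, pow_add _ _ 3]; ring
      _ ≤ 8 * n * (12 * n + 3) ^ (n - 1) * (B ^ n * t₃) := by rw [hgR]; gcongr
      _ = _ := by ring
  linarith

/-- Sieve parameters for which `FormData.card_le_of_isCofactor` gives the bound `T`. -/
def HasSieveParams (n d k K N R U₀ U₁ : ℕ) (ξ T : ℝ) : Prop :=
  ∃ (e j : ℕ) (M : ℝ), Real.exp (k * (2 * ξ + ((k : ℝ) * (N + e)) ^ 4)) ≤ M ∧
    M ^ 2 * U₁ ≤ (R : ℝ) ^ 2 ∧ U₁ * M ≤ (U₀ + 1) * 2 ^ j ∧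
    3 * M * (K * U₁) + 4 * (((4 * n + 5) * R : ℝ) ^ n * (15 / 16) ^ e * (2 * K * (j + 1))) +
      4 * (2 * n * (12 * n + 3) ^ (n - 1) * ((R : ℝ) ^ (1 / 12 : ℝ)) ^ (12 * (n - 1) + 9) *
        (d + 1) ^ e) ≤ T

theorem eventually_mul_exp_sub_exp_le {c : ℝ} (hc : 0 ≤ c) (d m : ℕ) :
    ∀ᶠ J : ℝ in atTop, c * (2 * Real.exp (d * (40 * J) - Real.exp J / 4)) ≤ 1 / J ^ m := by
  filter_upwards [eventually_mul_pow_le_exp (4 * (40 * d + 1)) 1 one_pos,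
    eventually_mul_exp_neg_le (c * 2) m one_pos] with J h1 h2
  rw [one_mul] at h1 h2
  refine le_trans ?_ h2
  rw [← mul_assoc]
  gcongr
  linarith

theorem sq_floor_le_of_le {B a : ℝ} (hB : 2 ≤ B) (ha : a ≤ B ^ 2 / 4) : a ≤ (⌊B⌋₊ : ℝ) ^ 2 := by
  have h := Nat.lt_floor_add_one B
  nlinarith

theorem exp_div_four_le_rpow {t : ℝ} (ht : 1 ≤ t) :
    Real.exp (t / 4) ≤ 2 * ((⌊Real.exp t⌋₊ : ℝ) ^ (1 / 12 : ℝ)) ^ 3 := by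
  have hB : 2 ≤ Real.exp t := by linarith [Real.add_one_le_exp t]
  have h := Nat.lt_floor_add_one (Real.exp t)
  refine le_of_pow_le_pow_left₀ (n := 4) (by norm_num) (by positivity) ?_
  rw [mul_pow, ← pow_mul, ← Real.rpow_natCast ((⌊Real.exp t⌋₊ : ℝ) ^ (1 / 12 : ℝ)),
    ← Real.rpow_mul (by positivity), ← Real.exp_nat_mul]
  norm_num
  rw [mul_div_cancel₀ _ (by norm_num : (4 : ℝ) ≠ 0)]
  linarith

/-- The hypotheses of `sieve_terms_le` at the double exponential scale. -/
theorem hasSieveParams_of_le {n d k K N U₀ U₁ e j : ℕ} {J ξ M t₁ t₂ : ℝ} (hn : 2 ≤ n) (hJ : 1 ≤ J)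
    (he : (e : ℝ) ≤ 40 * J) (hM : Real.exp (k * (2 * ξ + ((k : ℝ) * (N + e)) ^ 4)) ≤ M)
    (hMU : M ^ 2 * U₁ ≤ Real.exp (Real.exp J) ^ 2 / 4) (hMj : U₁ * M ≤ (U₀ + 1) * 2 ^ j)
    (ht₁ : M * U₁ ≤ Real.exp (Real.exp J) ^ 2 * t₁) (ht₁0 : 0 ≤ t₁)
    (ht₂ : ((15 : ℝ) / 16) ^ e * (j + 1) ≤ t₂)
    (h₁ : 6 * (3 * K) * t₁ ≤ 1 / J ^ n) (h₂ : 6 * (8 * K * (4 * n + 5) ^ n) * t₂ ≤ 1 / J ^ n)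
    (h₃ : 6 * (8 * n * (12 * n + 3) ^ (n - 1)) *
      (2 * Real.exp (d * (40 * J) - Real.exp J / 4)) ≤ 1 / J ^ n) :
    HasSieveParams n d k K N ⌊Real.exp (Real.exp J)⌋₊ U₀ U₁ ξ
      ((Real.exp (Real.exp J) / J) ^ n / 2) := by
  have hl : 1 ≤ Real.exp J := by linarith [Real.add_one_le_exp J]
  have hB : 2 ≤ Real.exp (Real.exp J) := by linarith [Real.add_one_le_exp (Real.exp J)]
  refine ⟨e, j, M, hM, sq_floor_le_of_le hB hMU, hMj, ?_⟩
  refine (sieve_terms_le hn (by linarith) (Nat.floor_le (by positivity)) (by positivity) ?_ ht₁ ht₁0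
    ht₂ (t₃ := 2 * Real.exp (d * (40 * J) - Real.exp J / 4)) (by positivity) ?_).trans ?_
  · rw [← Real.rpow_natCast, ← Real.rpow_mul (by positivity)]
    norm_num
  · have h := exp_div_four_le_rpow hl
    calc ((d : ℝ) + 1) ^ e ≤ Real.exp (d * e) := natCast_add_one_pow_le_exp d e
      _ ≤ Real.exp (d * (40 * J)) := by gcongr
      _ = Real.exp (d * (40 * J) - Real.exp J / 4) * Real.exp (Real.exp J / 4) := by
        rw [← Real.exp_add, sub_add_cancel]
      _ ≤ Real.exp (d * (40 * J) - Real.exp J / 4) *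
          (2 * ((⌊Real.exp (Real.exp J)⌋₊ : ℝ) ^ (1 / 12 : ℝ)) ^ 3) := by gcongr
      _ = _ := by ring
  · rw [div_pow, div_div, mul_comm (J ^ n), ← div_div, div_eq_mul_one_div (_ / 2 : ℝ)]
    rw [div_mul_eq_mul_div, mul_div_assoc]
    refine mul_le_mul_of_nonneg_left ?_ (by positivity)
    linarith

theorem eventually_hasSieveParams_of_large (n d k K N a : ℕ) (hn : 2 ≤ n) :
    ∀ᶠ J : ℝ in atTop, ∀ ξ : ℝ, 8 * k * ξ ≤ J →
      HasSieveParams n d k K N ⌊Real.exp (Real.exp J)⌋₊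
        ⌊Real.exp (Real.exp J) ^ 2 * Real.exp (-J ^ 6)⌋₊
        ⌊a * Real.exp (Real.exp J) ^ 2 * Real.exp (-(4 / 3 * J))⌋₊ ξ
        ((Real.exp (Real.exp J) / J) ^ n / 2) := by
  set C : ℝ := k * (N + 32 * (n + 8)) with hC
  have hlog := Real.tendsto_log_atTop
  filter_upwards [eventually_mul_exp_sub_exp_le
      (show (0 : ℝ) ≤ 6 * (8 * n * (12 * n + 3) ^ (n - 1)) by positivity) d n,
    eventually_mul_exp_neg_le (6 * (3 * K) * a) n (show (0 : ℝ) < 5 / 6 by norm_num),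
    eventually_mul_pow_le_exp (4 * a) 0 (show (0 : ℝ) < 1 / 3 by norm_num),
    hlog.eventually (eventually_mul_pow_le_exp (4 * k * C ^ 4) 4 one_pos),
    hlog.eventually (eventually_mul_pow_le_exp (32 * (n + 8)) 1 one_pos),
    hlog.eventually_ge_atTop 1, eventually_ge_atTop 1,
    eventually_ge_atTop (4 * (6 * (8 * K * (4 * n + 5) ^ n)) : ℝ)]
    with J h₃ h₁ ha hk he hs hJ h₂ ξ hξ
  have hJ0 : 0 < J := by linarith
  rw [one_mul, Real.exp_log hJ0] at hk he
  rw [pow_one] at he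
  rw [pow_zero, mul_one] at ha
  set B := Real.exp (Real.exp J) with hB
  set s := ⌈Real.log J⌉₊ with hsdef
  have hs1 : (s : ℝ) ≤ 2 * Real.log J := by
    linarith [Nat.ceil_lt_add_one (show 0 ≤ Real.log J by linarith)]
  have hs2 : Real.log J ≤ s := Nat.le_ceil _
  have hU₁ : (⌊a * B ^ 2 * Real.exp (-(4 / 3 * J))⌋₊ : ℝ) ≤
      a * B ^ 2 * Real.exp (-(4 / 3 * J)) := Nat.floor_le (by positivity)
  have hMU1 : Real.exp (J / 2) * (⌊a * B ^ 2 * Real.exp (-(4 / 3 * J))⌋₊ : ℝ) ≤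
      B ^ 2 * (a * Real.exp (-(5 / 6 * J))) := by
    calc _ ≤ Real.exp (J / 2) * (a * B ^ 2 * Real.exp (-(4 / 3 * J))) := by gcongr
      _ = B ^ 2 * (a * (Real.exp (J / 2) * Real.exp (-(4 / 3 * J)))) := by ring
      _ = _ := by rw [← Real.exp_add]; ring_nf
  refine hasSieveParams_of_le (e := 16 * (n + 8) * s) (j := ⌈2 * J ^ 6⌉₊) (M := Real.exp (J / 2))
    (t₁ := a * Real.exp (-(5 / 6 * J))) (t₂ := (J ^ (n + 8))⁻¹ * (2 * J ^ 6 + 2))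
    hn hJ ?_ ?_ ?_ ?_ hMU1 (by positivity) ?_ ?_ ?_ h₃
  · push_cast
    nlinarith
  · refine Real.exp_le_exp.2 ?_
    have h4 : (k : ℝ) * (N + (16 * (n + 8) * s : ℕ)) ≤ C * Real.log J := by
      push_cast
      rw [hC, mul_assoc (k : ℝ)]
      gcongr ?_ * ?_
      have : (N : ℝ) ≤ N * Real.log J := le_mul_of_one_le_right (by positivity) hs
      nlinarith
    have h5 : ((k : ℝ) * (N + (16 * (n + 8) * s : ℕ))) ^ 4 ≤ (C * Real.log J) ^ 4 := by gcongr
    have h6 := mul_le_mul_of_nonneg_left h5 (show (0 : ℝ) ≤ k by positivity)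
    rw [mul_pow] at h6
    linarith
  · calc Real.exp (J / 2) ^ 2 * (⌊a * B ^ 2 * Real.exp (-(4 / 3 * J))⌋₊ : ℝ)
        ≤ Real.exp (J / 2) ^ 2 * (a * B ^ 2 * Real.exp (-(4 / 3 * J))) := by gcongr
      _ = B ^ 2 / 4 * (4 * a * Real.exp (-(1 / 3 * J))) := by
        rw [← Real.exp_nat_mul, show (-(1 / 3 * J)) = (2 : ℕ) * (J / 2) + -(4 / 3 * J) by
          push_cast; ring, Real.exp_add]
        ring
      _ ≤ B ^ 2 / 4 * 1 := by
        gcongr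
        rw [Real.exp_neg, ← div_eq_mul_inv]
        exact div_le_one_of_le₀ ha (by positivity)
      _ = _ := by ring
  · rw [mul_comm]
    have h4 : B ^ 2 * Real.exp (-J ^ 6) ≤ (⌊B ^ 2 * Real.exp (-J ^ 6)⌋₊ : ℝ) + 1 :=
      (Nat.lt_floor_add_one _).le
    have h5 : Real.exp (J ^ 6) ≤ 2 ^ ⌈2 * J ^ 6⌉₊ := exp_le_two_pow (Nat.le_ceil _)
    calc _ ≤ _ := hMU1
      _ ≤ B ^ 2 * 1 := by
        gcongr
        have h6 : Real.exp (1 / 3 * J) ≤ Real.exp (5 / 6 * J) := Real.exp_le_exp.2 (by linarith)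
        rw [Real.exp_neg, ← div_eq_mul_inv]
        refine div_le_one_of_le₀ ?_ (by positivity)
        have : (0 : ℝ) ≤ a := by positivity
        linarith
      _ = B ^ 2 * Real.exp (-J ^ 6) * Real.exp (J ^ 6) := by
        rw [mul_assoc, ← Real.exp_add, neg_add_cancel, Real.exp_zero]
      _ ≤ _ := by gcongr
  · have h4 : (⌈2 * J ^ 6⌉₊ : ℝ) + 1 ≤ 2 * J ^ 6 + 2 := by
      linarith [Nat.ceil_lt_add_one (show 0 ≤ 2 * J ^ 6 by positivity)]
    have h5 : ((15 : ℝ) / 16) ^ (16 * (n + 8) * s) ≤ (J ^ (n + 8))⁻¹ := by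
      refine (pow_fifteen_sixteenths_le _).trans ?_
      rw [Real.exp_neg]
      gcongr
      calc J ^ (n + 8) = Real.exp ((n + 8 : ℕ) * Real.log J) := by
            rw [Real.exp_nat_mul, Real.exp_log hJ0]
        _ ≤ _ := by
          refine Real.exp_le_exp.2 ?_
          push_cast
          nlinarith
    gcongr
  · rw [← mul_assoc]
    exact h₁
  · rw [← div_eq_inv_mul, ← mul_div_assoc, div_le_div_iff₀ (by positivity) (by positivity),
      pow_add]
    have h4 : (1 : ℝ) ≤ J ^ 6 := one_le_pow₀ hJ
    have h5 : 6 * (8 * K * (4 * n + 5) ^ n) * (2 * J ^ 6 + 2) ≤ J ^ 8 := by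
      calc 6 * (8 * K * (4 * n + 5) ^ n) * (2 * J ^ 6 + 2)
          ≤ 6 * (8 * K * (4 * n + 5) ^ n) * (2 * J ^ 6 + 2 * J ^ 6) := by gcongr; linarith
        _ = 4 * (6 * (8 * K * (4 * n + 5) ^ n)) * J ^ 6 := by ring
        _ ≤ J * J ^ 6 := by gcongr
        _ = J ^ 7 := by ring
        _ ≤ J ^ 8 := pow_le_pow_right₀ hJ (by norm_num)
    have : 0 ≤ J ^ n := by positivity
    nlinarith

theorem eventually_hasSieveParams_of_small (n d k K N : ℕ) (hn : 2 ≤ n) :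
    ∀ᶠ J : ℝ in atTop, ∀ ξ : ℝ, 8 * k * ξ ≤ J →
      HasSieveParams n d k K N ⌊Real.exp (Real.exp J)⌋₊ 0
        ⌊Real.exp (Real.exp J) ^ 2 * Real.exp (-J ^ 6)⌋₊ ξ
        ((Real.exp (Real.exp J) / J) ^ n / 2) := by
  filter_upwards [eventually_mul_exp_sub_exp_le
      (show (0 : ℝ) ≤ 6 * (8 * n * (12 * n + 3) ^ (n - 1)) by positivity) d n,
    eventually_mul_exp_neg_le (6 * (3 * K)) n one_pos,
    eventually_mul_exp_neg_le (6 * (8 * K * (4 * n + 5) ^ n) * 6) n one_pos,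
    eventually_ge_atTop 4,
    eventually_ge_atTop (2 * (k * (k * (N + 40)) ^ 4) : ℝ)]
    with J h₃ h₁ h₂ hJ hk ξ hξ
  rw [one_mul] at h₁ h₂
  have hJ0 : 0 < J := by linarith
  have hJ4 : (1 : ℝ) ≤ J ^ 4 := one_le_pow₀ (by linarith)
  have hJ5 : J ≤ J ^ 5 := by nlinarith
  have hJ6 : J ^ 5 - J ^ 6 ≤ -(3 * J ^ 5) := by nlinarith [pow_pos hJ0 5]
  set B := Real.exp (Real.exp J) with hB
  have hs1 : ((32 * ⌈J⌉₊ : ℕ) : ℝ) ≤ 40 * J := by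
    push_cast
    linarith [Nat.ceil_lt_add_one hJ0.le]
  have hU₁ : (⌊B ^ 2 * Real.exp (-J ^ 6)⌋₊ : ℝ) ≤ B ^ 2 * Real.exp (-J ^ 6) :=
    Nat.floor_le (by positivity)
  have hMU1 : Real.exp (J ^ 5) * (⌊B ^ 2 * Real.exp (-J ^ 6)⌋₊ : ℝ) ≤ B ^ 2 * Real.exp (-J) := by
    calc _ ≤ Real.exp (J ^ 5) * (B ^ 2 * Real.exp (-J ^ 6)) := by gcongr
      _ = B ^ 2 * (Real.exp (J ^ 5) * Real.exp (-J ^ 6)) := by ring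
      _ ≤ B ^ 2 * Real.exp (-J) := by
        rw [← Real.exp_add]
        gcongr
        linarith
  refine hasSieveParams_of_le (e := 32 * ⌈J⌉₊) (j := ⌈4 * Real.exp J⌉₊) (M := Real.exp (J ^ 5))
    (t₁ := Real.exp (-J)) (t₂ := 6 * Real.exp (-J))
    hn (by linarith) hs1 ?_ ?_ ?_ hMU1 (by positivity) ?_ h₁ ?_ h₃
  · refine Real.exp_le_exp.2 ?_
    have h4 : (k : ℝ) * (N + (32 * ⌈J⌉₊ : ℕ)) ≤ k * (N + 40) * J := by
      rw [mul_assoc]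
      gcongr
      have : (N : ℝ) ≤ N * J := le_mul_of_one_le_right (by positivity) (by linarith)
      linarith
    have h5 : ((k : ℝ) * (N + (32 * ⌈J⌉₊ : ℕ))) ^ 4 ≤ (k * (N + 40) * J) ^ 4 := by gcongr
    have h6 := mul_le_mul_of_nonneg_left h5 (show (0 : ℝ) ≤ k by positivity)
    rw [mul_pow] at h6
    nlinarith
  · have h4 : Real.exp (-2) ≤ 1 / 4 := by
      rw [Real.exp_neg, one_div]
      gcongr
      rw [show (2 : ℝ) = 1 + 1 by norm_num, Real.exp_add]
      nlinarith [Real.add_one_le_exp (1 : ℝ)]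
    calc Real.exp (J ^ 5) ^ 2 * (⌊B ^ 2 * Real.exp (-J ^ 6)⌋₊ : ℝ)
        ≤ Real.exp (J ^ 5) ^ 2 * (B ^ 2 * Real.exp (-J ^ 6)) := by gcongr
      _ = B ^ 2 * Real.exp (2 * J ^ 5 + -J ^ 6) := by
        rw [← Real.exp_nat_mul, Real.exp_add]
        push_cast
        ring
      _ ≤ B ^ 2 * Real.exp (-2) := by
        gcongr
        linarith
      _ ≤ B ^ 2 * (1 / 4) := by gcongr
      _ = _ := by ring
  · rw [mul_comm]
    calc _ ≤ _ := hMU1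
      _ ≤ B ^ 2 * 1 := by
        gcongr
        exact Real.exp_le_one_iff.2 (by linarith)
      _ = Real.exp (2 * Real.exp J) := by
        rw [hB, ← Real.exp_nat_mul, mul_one]
        norm_cast
      _ ≤ 2 ^ ⌈4 * Real.exp J⌉₊ := exp_le_two_pow (by linarith [Nat.le_ceil (4 * Real.exp J)])
      _ = _ := by simp
  · have h4 : (⌈4 * Real.exp J⌉₊ : ℝ) + 1 ≤ 6 * Real.exp J := by
      linarith [Nat.ceil_lt_add_one (show 0 ≤ 4 * Real.exp J by positivity),
        Real.add_one_le_exp J]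
    have h5 : ((15 : ℝ) / 16) ^ (32 * ⌈J⌉₊) ≤ Real.exp (-(2 * J)) := by
      refine (pow_fifteen_sixteenths_le _).trans (Real.exp_le_exp.2 ?_)
      push_cast
      linarith [Nat.le_ceil J]
    calc _ ≤ Real.exp (-(2 * J)) * (6 * Real.exp J) := by gcongr
      _ = 6 * (Real.exp (-(2 * J)) * Real.exp J) := by ring
      _ = _ := by rw [← Real.exp_add]; ring_nf
  · rw [← mul_assoc]
    exact h₂

theorem FormData.eventually_card_le {n d k : ℕ} {F : MvPolynomial (Fin n) ℤ} (D : FormData d F)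
    (hn : 2 ≤ n) (hk : 2 ≤ k) (hd : 2 ≤ d) (hdk : d ≤ n * k + 2)
    (hsmul : ∀ (m : ℤ) (y : Fin n → ℤ),
      MvPolynomial.eval (m • y) F = m ^ d * MvPolynomial.eval y F) :
    ∀ᶠ J : ℝ in atTop, ∀ ξ ξ' : ℝ, (D.N₀ : ℝ) ≤ ξ → (((d + 1) ^ (12 * (d + 1)) : ℕ) : ℝ) ≤ ξ →
      8 * k * ξ ≤ J → ξ' = Real.exp (Real.exp J) ^ n * Real.exp (2 / 3 * J) →
      ∀ Z : Finset (Fin n → ℤ), (∀ x ∈ Z, x ∈ intBox n ⌊Real.exp (Real.exp J)⌋₊ ∧ x ≠ 0 ∧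
        (∃ p : ℕ, p.Prime ∧ ξ' < (p : ℝ) ∧ (p : ℤ) ^ k ∣ MvPolynomial.eval x F) ∧
        (∀ p : ℕ, p.Prime → ξ < (p : ℝ) → (p : ℝ) ≤ ξ' →
          ¬ (p : ℤ) ^ 2 ∣ MvPolynomial.eval x F) ∧
        (∀ p : ℕ, p.Prime → (p : ℤ) ^ k ∣ MvPolynomial.eval x F → ξ < (p : ℝ)) ∧
        (∀ p : ℕ, p.Prime → ξ < p → (p : ℤ) ∣ MvPolynomial.eval x F →
          ∃ c ∈ D.forms p, formVal c x = 0)) →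
      (Z.card : ℝ) ≤ (Real.exp (Real.exp J) / J) ^ n := by
  classical
  set a := D.A + 1 with ha
  filter_upwards [eventually_hasSieveParams_of_large n d k D.K (D.sieveBound k) a hn,
    eventually_hasSieveParams_of_small n d k D.K (D.sieveBound k) hn,
    eventually_mul_pow_le_exp 1 6 one_pos, eventually_ge_atTop 1,
    eventually_ge_atTop (a : ℝ)] with J hlarge hsmall hJ6 hJ hJa ξ ξ' hN₀ hdξ hξJ hξ' Z hZ
  rw [one_mul, one_mul] at hJ6
  have hξ0 : 0 ≤ ξ := le_trans (by positivity) hN₀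
  have hJl : J + 1 ≤ Real.exp J := Real.add_one_le_exp J
  have hlB : Real.exp J + 1 ≤ Real.exp (Real.exp J) := Real.add_one_le_exp _
  set B := Real.exp (Real.exp J) with hB
  have hB1 : 1 ≤ B := by linarith
  have hBsq : B ^ 2 = Real.exp (2 * Real.exp J) := by
    rw [hB, ← Real.exp_nat_mul]
    norm_cast
  have haB : a ≤ ⌊B⌋₊ := Nat.le_floor (by linarith)
  have hR : 1 ≤ ⌊B⌋₊ := le_trans (Nat.le_add_left _ _) haB
  have hBn : B ≤ B ^ n := le_self_pow₀ hB1 (by omega)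
  have hBn2 : B ^ 2 ≤ B ^ n := pow_le_pow_right₀ hB1 hn
  have hexp1 : (1 : ℝ) ≤ Real.exp (2 / 3 * J) := Real.one_le_exp (by positivity)
  have hBξ : B ≤ ξ' := by
    rw [hξ']
    exact hBn.trans (le_mul_of_one_le_right (by positivity) hexp1)
  have hRξ : (⌊B⌋₊ : ℝ) ≤ ξ' := (Nat.floor_le (by positivity)).trans hBξ
  have hg0 : 0 ≤ (⌊B⌋₊ : ℝ) ^ (1 / 12 : ℝ) := by positivity
  have hgR : ((⌊B⌋₊ : ℝ) ^ (1 / 12 : ℝ)) ^ 12 = (⌊B⌋₊ : ℝ) := by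
    rw [← Real.rpow_natCast, ← Real.rpow_mul (by positivity)]
    norm_num
  have hcof : ∀ x ∈ Z, ∃ u : ℕ, (u : ℝ) ≤ a * B ^ 2 * Real.exp (-(4 / 3 * J)) ∧
      IsCofactor F k ξ ξ' x u := by
    intro x hx
    obtain ⟨h1, h2, h3, h4, h5, -⟩ := hZ x hx
    have h6 : ((|MvPolynomial.eval x F| : ℤ) : ℝ) ≤ a * B ^ (n * k + 2) := by
      calc ((|MvPolynomial.eval x F| : ℤ) : ℝ) ≤ D.A * (⌊B⌋₊ : ℝ) ^ d := by
            exact_mod_cast D.abs_eval_le _ x (mem_intBox.1 h1)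
        _ ≤ a * B ^ d := by
          gcongr
          · omega
          · exact Nat.floor_le (by positivity)
        _ ≤ _ := by gcongr
    refine exists_isCofactor h6 (D.eval_ne_zero x h2) (by linarith) ?_ ?_ h3 h4 h5
    · have h7 : (1 : ℝ) ≤ Real.exp (-(4 / 3 * J)) * Real.exp (2 / 3 * J) ^ k := by
        rw [← Real.exp_nat_mul, ← Real.exp_add]
        refine Real.one_le_exp ?_
        have : (2 : ℝ) ≤ k := by exact_mod_cast hk
        nlinarith
      rw [hξ', mul_pow, ← pow_mul]
      calc a * B ^ (n * k + 2) = a * B ^ (n * k + 2) * 1 := by ring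
        _ ≤ a * B ^ (n * k + 2) * (Real.exp (-(4 / 3 * J)) * Real.exp (2 / 3 * J) ^ k) := by gcongr
        _ = _ := by ring
    · have h7 : (a : ℝ) * Real.exp (-(4 / 3 * J)) ≤ 1 := by
        rw [Real.exp_neg, ← div_eq_mul_inv]
        refine div_le_one_of_le₀ ?_ (by positivity)
        linarith [Real.add_one_le_exp (4 / 3 * J)]
      rw [hξ']
      calc a * B ^ 2 * Real.exp (-(4 / 3 * J)) = B ^ 2 * (a * Real.exp (-(4 / 3 * J))) := by ring
        _ ≤ B ^ 2 * 1 := by gcongr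
        _ ≤ B ^ n * Real.exp (2 / 3 * J) := by gcongr
  set U₀ := ⌊B ^ 2 * Real.exp (-J ^ 6)⌋₊ with hU₀
  set U₁ := ⌊a * B ^ 2 * Real.exp (-(4 / 3 * J))⌋₊ with hU₁
  have hU₀1 : 1 ≤ U₀ := by
    refine Nat.le_floor ?_
    rw [hBsq, ← Real.exp_add, Nat.cast_one]
    exact Real.one_le_exp (by linarith)
  have hU₁1 : 1 ≤ U₁ := by
    refine Nat.le_floor ?_
    rw [Nat.cast_one, hBsq, mul_assoc, ← Real.exp_add]
    have h1 : (1 : ℝ) ≤ a := by exact_mod_cast Nat.le_add_left 1 D.A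
    have h2 : 1 ≤ Real.exp (2 * Real.exp J + -(4 / 3 * J)) := Real.one_le_exp (by linarith)
    nlinarith
  set Z₁ := Z.filter fun x => ∃ u : ℕ, IsCofactor F k ξ ξ' x u ∧ 0 < u ∧ u ≤ U₀ with hZ₁
  set Z₂ := Z.filter fun x => ∃ u : ℕ, IsCofactor F k ξ ξ' x u ∧ U₀ < u ∧ u ≤ U₁ with hZ₂
  have hcover : Z ⊆ Z₁ ∪ Z₂ := by
    intro x hx
    obtain ⟨u, hu, hcof⟩ := hcof x hx
    rw [Finset.mem_union, hZ₁, hZ₂, Finset.mem_filter, Finset.mem_filter]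
    by_cases h : u ≤ U₀
    · exact Or.inl ⟨hx, u, hcof, hcof.pos, h⟩
    · exact Or.inr ⟨hx, u, hcof, by omega, Nat.le_floor hu⟩
  have hcard : Z.card ≤ Z₁.card + Z₂.card :=
    (Finset.card_le_card hcover).trans (Finset.card_union_le _ _)
  have hcard' : (Z.card : ℝ) ≤ Z₁.card + Z₂.card := by exact_mod_cast hcard
  obtain ⟨e₁, j₁, M₁, hM₁, hMU₁, hMj₁, hle₁⟩ := hsmall ξ hξJ
  obtain ⟨e₂, j₂, M₂, hM₂, hMU₂, hMj₂, hle₂⟩ := hlarge ξ hξJ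
  have h₁ := D.card_le_of_isCofactor hn hk hd hsmul hg0 hgR hR (by omega) hU₀1 hξ0 hN₀ hdξ hRξ
    hM₁ hMU₁ hMj₁ Z₁ fun x hx => by
      obtain ⟨hx, hu⟩ := Finset.mem_filter.1 hx
      obtain ⟨h1, h2, h3, h4, h5, h6⟩ := hZ x hx
      exact ⟨h1, h2, h4, h5, h6, hu⟩
  have h₂ := D.card_le_of_isCofactor hn hk hd hsmul hg0 hgR hR (by omega) hU₁1 hξ0 hN₀ hdξ hRξ
    hM₂ hMU₂ hMj₂ Z₂ fun x hx => by
      obtain ⟨hx, hu⟩ := Finset.mem_filter.1 hx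
      obtain ⟨h1, h2, h3, h4, h5, h6⟩ := hZ x hx
      exact ⟨h1, h2, h4, h5, h6, hu⟩
  have := h₁.trans hle₁
  have := h₂.trans hle₂
  linarith

theorem forall_abs_cast_le_iff {n : ℕ} {B : ℝ} (hB : 0 ≤ B) {x : Fin n → ℤ} :
    (∀ i, |(x i : ℝ)| ≤ B) ↔ x ∈ intBox n ⌊B⌋₊ := by
  rw [mem_intBox]
  refine forall_congr' fun i => ?_
  rw [← Int.cast_abs, Int.abs_eq_natAbs, Int.cast_natCast, Nat.cast_le, Nat.le_floor_iff hB]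

theorem exists_prime_gt_le_two_mul {ξ : ℝ} (hξ : 1 ≤ ξ) :
    ∃ p : ℕ, p.Prime ∧ ξ < p ∧ (p : ℝ) ≤ 2 * ξ := by
  obtain ⟨p, hp, h1, h2⟩ := Nat.exists_prime_lt_and_le_two_mul ⌊ξ⌋₊ (Nat.floor_pos.2 hξ).ne'
  refine ⟨p, hp, (Nat.floor_lt (by linarith)).1 h1, ?_⟩
  have h3 : (p : ℝ) ≤ 2 * ⌊ξ⌋₊ := by exact_mod_cast h2
  linarith [Nat.floor_le (show 0 ≤ ξ by linarith)]

theorem isHomogeneous_of_map_eq_prod {n d : ℕ} {F : MvPolynomial (Fin n) ℤ}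
    {L : Fin d → Fin n → ℂ} (hF : F.map (Int.castRingHom ℂ) = ∏ j, linForm (L j)) :
    F.IsHomogeneous d := by
  have h := isHomogeneous_prod_linForm Finset.univ L
  rw [← hF, Finset.card_univ, Fintype.card_fin] at h
  exact h.of_map (RingHom.injective_int _)

theorem pow_div_le_ncard_of_forall_smul_mem {n p : ℕ} (hp : 0 < p) {B J : ℝ} (hB : 0 ≤ B)
    (hpJ : (p : ℝ) ≤ J) {S : Set (Fin n → ℤ)} (hS : S.Finite)
    (h : ∀ y ∈ intBox n (⌊B⌋₊ / p), (p : ℤ) • y ∈ S) : (B / J) ^ n ≤ S.ncard := by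
  classical
  have hp0 : (0 : ℝ) < p := by exact_mod_cast hp
  have hinj : Function.Injective fun y : Fin n → ℤ => (p : ℤ) • y :=
    smul_right_injective _ (by exact_mod_cast hp.ne')
  have h1 : (intBox n (⌊B⌋₊ / p)).card ≤ S.ncard := by
    rw [← Finset.card_image_of_injective _ hinj, ← Set.ncard_coe_finset]
    refine Set.ncard_le_ncard (fun x hx => ?_) hS
    obtain ⟨y, hy, rfl⟩ := Finset.mem_image.1 hx
    exact h y hy
  rw [card_intBox] at h1
  have h2 : ((2 * (⌊B⌋₊ / p) + 1 : ℕ) : ℝ) ^ n ≤ S.ncard := by exact_mod_cast h1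
  refine le_trans ?_ h2
  refine pow_le_pow_left₀ (div_nonneg hB (hp0.le.trans hpJ)) ?_ _
  rw [div_le_iff₀ (hp0.trans_le hpJ)]
  have h3 : ⌊B⌋₊ + 1 ≤ (2 * (⌊B⌋₊ / p) + 1) * p := by
    have h4 := Nat.div_add_mod ⌊B⌋₊ p
    have h5 := Nat.mod_lt ⌊B⌋₊ hp
    nlinarith [Nat.zero_le (⌊B⌋₊ / p * p)]
  have h6 : ((⌊B⌋₊ : ℝ) + 1) ≤ ((2 * (⌊B⌋₊ / p) + 1 : ℕ) : ℝ) * p := by exact_mod_cast h3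
  calc B ≤ (⌊B⌋₊ : ℝ) + 1 := (Nat.lt_floor_add_one B).le
    _ ≤ _ := h6
    _ ≤ _ := by gcongr

theorem Xi1Good.eventually_mul_le {ξ₁ : ℝ → ℝ} (h : Xi1Good ξ₁) (c : ℝ) :
    ∀ᶠ B in atTop, c * ξ₁ B ≤ Real.log (Real.log B) := by
  obtain ⟨C, hC⟩ := h.2.2.bound
  have hlog := Real.tendsto_log_atTop
  filter_upwards [hC, hlog.eventually_ge_atTop 1, (hlog.comp hlog).eventually_ge_atTop 1,
    ((hlog.comp hlog).comp hlog).eventually_ge_atTop (max 1 (|c| * C))] with B h1 h2 h3 h4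
  simp only [Function.comp_apply] at h3 h4
  have h5 := le_of_max_le_left h4
  have h6 := le_of_max_le_right h4
  have e1 : log1 B = Real.log B := max_eq_right h2
  have e2 : log2 B = Real.log (Real.log B) := by
    rw [log2, e1]
    exact max_eq_right h3
  have e3 : log3 B = Real.log (Real.log (Real.log B)) := by
    rw [log3, e2]
    exact max_eq_right h5
  set J := Real.log (Real.log B)
  have hs : 0 < Real.log J := by linarith
  rw [e2, e3, Real.norm_of_nonneg (by positivity : 0 ≤ J / Real.log J)] at h1
  calc c * ξ₁ B ≤ |c * ξ₁ B| := le_abs_self _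
    _ = |c| * ‖ξ₁ B‖ := abs_mul _ _
    _ ≤ |c| * (C * (J / Real.log J)) := by gcongr
    _ = |c| * C * J / Real.log J := by ring
    _ ≤ Real.log J * J / Real.log J := by gcongr
    _ = J := by field_simp

theorem eventually_N3count_le_N3starCount {n d k : ℕ} (hn : 2 ≤ n) (hd : n < d) (hk : 2 ≤ k)
    (hdk : d ≤ n * k + 2) {F : MvPolynomial (Fin n) ℤ} {L : Fin d → Fin n → ℂ}
    (hF : IsDecomp F L) (hirr : Irreducible (F.map (Int.castRingHom ℚ)))
    (hΔ : discProd L ≠ 0) {ξ₁ : ℝ → ℝ} (hξ : Xi1Good ξ₁) {τ : ∀ p : ℕ, p.Prime → ℕ}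
    {𝓛 : ∀ (p : ℕ) (hp : p.Prime), Fin (τ p hp) → Fin n → @PadicInt p ⟨hp⟩}
    {Fstar : ∀ (p : ℕ) (hp : p.Prime), MvPolynomial (Fin n) (@PadicInt p ⟨hp⟩)}
    (hfact : ∀ (p : ℕ) (hp : p.Prime), IsPadicFact F p hp (𝓛 p hp) (Fstar p hp)) :
    ∀ᶠ B : ℝ in atTop, N3count F k (ξ₁ B) (xi2 n B) B ≤ N3starCount 𝓛 Fstar (ξ₁ B) B := by
  classical
  obtain ⟨D⟩ := nonempty_formData hn hd hF hirr hΔ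
  have hsmul := eval_zsmul_of_map_eq_prod hF.2
  have hhom := isHomogeneous_of_map_eq_prod hF.2
  have hd2 : 2 ≤ d := by omega
  set y : Fin n → ℤ := Pi.single ⟨0, by omega⟩ 1 with hy
  have hy0 : MvPolynomial.eval y F ≠ 0 := D.eval_ne_zero y (by simp [hy])
  have hF0 : F ≠ 0 := by
    rintro rfl
    exact hy0 (map_zero _)
  have hlog := Real.tendsto_log_atTop
  filter_upwards [(hlog.comp hlog).eventually (D.eventually_card_le hn hk hd2 hdk hsmul),
    hξ.eventually_mul_le (8 * k), hξ.2.1.eventually_ge_atTop (D.N₀ : ℝ),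
    hξ.2.1.eventually_ge_atTop (((d + 1) ^ (12 * (d + 1)) : ℕ) : ℝ),
    hξ.2.1.eventually_ge_atTop ((MvPolynomial.eval y F).natAbs : ℝ),
    hξ.2.1.eventually_ge_atTop 2, hlog.eventually_gt_atTop 0, eventually_gt_atTop 0,
    (hlog.comp hlog).eventually_ge_atTop 0]
    with B hcard hξJ hN₀ hdξ hyξ hξ2 hl hB hJ0
  simp only [Function.comp_apply] at hcard hJ0
  have hexp : Real.exp (Real.exp (Real.log (Real.log B))) = B := by
    rw [Real.exp_log hl, Real.exp_log hB]
  set J := Real.log (Real.log B) with hJ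
  have hlJ : Real.exp J = Real.log B := Real.exp_log hl
  rw [hexp] at hcard
  have hxi2 : xi2 n B = B ^ n * Real.exp (2 / 3 * J) := by
    rw [xi2, ← hlJ, ← Real.exp_mul, mul_comm J]
  have hlB : J + 1 ≤ B := by
    have h1 := Real.add_one_le_exp J
    have h2 := Real.add_one_le_exp (Real.exp J)
    rw [hexp] at h2
    linarith
  have hξ2k : 2 * ξ₁ B ≤ J := by
    have : (2 : ℝ) ≤ k := by exact_mod_cast hk
    nlinarith
  have hBxi : B ≤ xi2 n B := by
    rw [hxi2]
    refine (le_self_pow₀ (by linarith) (by omega)).trans (le_mul_of_one_le_right (by positivity) ?_)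
    exact Real.one_le_exp (by positivity)
  have hfin : {x : Fin n → ℤ | ∀ i, |(x i : ℝ)| ≤ B}.Finite := by
    refine (intBox n ⌊B⌋₊).finite_toSet.subset fun x hx => ?_
    exact (forall_abs_cast_le_iff hB.le).1 hx
  unfold N3count N3starCount
  set S₃ := {x : Fin n → ℤ | (∀ i, |(x i : ℝ)| ≤ B) ∧
    (∃ p : ℕ, p.Prime ∧ xi2 n B < (p : ℝ) ∧ (p : ℤ) ^ k ∣ MvPolynomial.eval x F) ∧
    (∀ p : ℕ, p.Prime → ξ₁ B < (p : ℝ) → (p : ℝ) ≤ xi2 n B →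
      ¬ ((p : ℤ) ^ 2 ∣ MvPolynomial.eval x F)) ∧
    (∀ p : ℕ, p.Prime → (p : ℤ) ^ k ∣ MvPolynomial.eval x F → ξ₁ B < (p : ℝ))} with hS₃
  set S := {x : Fin n → ℤ | (∀ i, |(x i : ℝ)| ≤ B) ∧ ∃ (p : ℕ) (hp : p.Prime), ξ₁ B < (p : ℝ) ∧
    Sp p hp (𝓛 p hp) (Fstar p hp) (fun i => ((x i : ZMod p)))} with hS
  have hfin₃ : S₃.Finite := hfin.subset fun x hx => hx.1
  have hfinS : S.Finite := hfin.subset fun x hx => hx.1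
  rw [Set.ncard_le_ncard_iff_ncard_sdiff_le_ncard_sdiff hfin₃ hfinS]
  suffices h : ((S₃ \ S).ncard : ℝ) ≤ ((S \ S₃).ncard : ℝ) by exact_mod_cast h
  have hfindiff : (S₃ \ S).Finite := hfin₃.subset Set.sdiff_subset
  refine le_trans (b := (B / J) ^ n) ?_ ?_
  · rw [Set.ncard_eq_toFinset_card _ hfindiff]
    refine hcard (ξ₁ B) (xi2 n B) hN₀ hdξ hξJ hxi2 _ fun x hx => ?_
    obtain ⟨⟨hxB, h3, h4, h5⟩, hxS⟩ := hfindiff.mem_toFinset.1 hx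
    refine ⟨(forall_abs_cast_le_iff hB.le).1 hxB, ?_, h3, h4, h5, fun p hp hpξ hpx => ?_⟩
    · rintro rfl
      have h6 : MvPolynomial.eval (0 : Fin n → ℤ) F = 0 := by
        have := hsmul 0 0
        rwa [zero_smul, zero_pow (by omega), zero_mul] at this
      have h7 := h5 2 Nat.prime_two (by rw [h6]; exact dvd_zero _)
      norm_num at h7
      linarith
    · have hpy : ¬ (p : ℤ) ∣ MvPolynomial.eval y F := by
        intro h
        have h8 := Nat.le_of_dvd (Int.natAbs_pos.2 hy0) (Int.natCast_dvd.1 h)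
        have h9 : (p : ℝ) ≤ (MvPolynomial.eval y F).natAbs := by exact_mod_cast h8
        linarith
      obtain ⟨c, hc0, hcF, hcx⟩ := exists_linForm_dvd_of_not_Sp hp (hfact p hp) hpy hpx
        fun h => hxS ⟨hxB, p, hp, hpξ, h⟩
      obtain ⟨c', hc', h⟩ := D.exists_mem p hp (by exact_mod_cast hN₀.trans_lt hpξ) c hc0 hcF
      exact ⟨c', hc', h x hcx⟩
  · obtain ⟨p, hp, hpξ, hp2⟩ := exists_prime_gt_le_two_mul (show 1 ≤ ξ₁ B by linarith)
    refine pow_div_le_ncard_of_forall_smul_mem hp.pos hB.le (hp2.trans hξ2k)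
      (hfinS.subset Set.sdiff_subset) fun z hz => ?_
    have hdvd : (p : ℤ) ^ 2 ∣ MvPolynomial.eval ((p : ℤ) • z) F := by
      rw [hsmul]
      exact (pow_dvd_pow _ hd2).mul_right _
    refine ⟨⟨(forall_abs_cast_le_iff hB.le).2 (mem_intBox.2 fun i => ?_), p, hp, hpξ, ?_⟩,
      fun h => h.2.2.1 p hp hpξ (by linarith) hdvd⟩
    · rw [Pi.smul_apply, smul_eq_mul, abs_mul, Nat.abs_cast]
      have h1 := mem_intBox.1 hz i
      have h2 : (p : ℤ) * (⌊B⌋₊ / p : ℕ) ≤ ⌊B⌋₊ := by exact_mod_cast Nat.mul_div_le _ _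
      exact (mul_le_mul_of_nonneg_left h1 (by positivity)).trans h2
    · have h1 : (fun i => ((((p : ℤ) • z) i : ℤ) : ZMod p)) = 0 := by
        ext i
        simp
      rw [h1]
      exact Sp_zero hd2 hp hF0 hhom (hfact p hp)

theorem stmt13 (n d k : ℕ) (hn : 2 ≤ n) (hd : n < d) (hk : 2 ≤ k)
    (F : MvPolynomial (Fin n) ℤ) (L : Fin d → Fin n → ℂ)
    (hF : IsDecomp F L) (hirr : Irreducible (F.map (Int.castRingHom ℚ)))
    (hΔ : discProd L ≠ 0)
    (hkd : ((d : ℝ) - 2) / (n : ℝ) ≤ (k : ℝ))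
    (ξ₁ : ℝ → ℝ) (hξ : Xi1Good ξ₁) (C₁ : ℝ) (hC₁ : 0 < C₁)
    (τ : ∀ p : ℕ, p.Prime → ℕ)
    (𝓛 : ∀ (p : ℕ) (hp : p.Prime), Fin (τ p hp) → Fin n → @PadicInt p ⟨hp⟩)
    (Fstar : ∀ (p : ℕ) (hp : p.Prime), MvPolynomial (Fin n) (@PadicInt p ⟨hp⟩))
    (hfact : ∀ (p : ℕ) (hp : p.Prime), IsPadicFact F p hp (𝓛 p hp) (Fstar p hp)) :
    ∀ᶠ B : ℝ in atTop,
      (N3count F k (ξ₁ B) (xi2 n B) B : ℝ) ≤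
        (∑ᶠ u₁ ∈ {u₁ : ℕ | u₁ ∣ Cxi k (ξ₁ B)},
          ∑ᶠ u₂ ∈ U2set (ξ₁ B) (xi2 n B) (xi3 C₁ k B),
            (Hcount F 𝓛 Fstar k u₁ u₂ (scrD k (ξ₁ B) B u₂) B : ℝ) /
              (k : ℝ) ^ (scrD k (ξ₁ B) B u₂).primeFactors.card) +
        (N3starCount 𝓛 Fstar (ξ₁ B) B : ℝ) := by
  have hdk : d ≤ n * k + 2 := by
    have hn0 : (0 : ℝ) < n := by exact_mod_cast (by omega : 0 < n)
    rw [div_le_iff₀ hn0] at hkd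
    have : (d : ℝ) ≤ n * k + 2 := by linarith
    exact_mod_cast this
  filter_upwards [eventually_N3count_le_N3starCount hn hd hk hdk hF hirr hΔ hξ hfact] with B hB
  refine le_add_of_nonneg_of_le ?_ (by exact_mod_cast hB)
  exact finsum_nonneg fun u₁ => finsum_nonneg fun _ => finsum_nonneg fun u₂ =>
    finsum_nonneg fun _ => by positivity

end
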